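/- If Assumption (*) holds, then for every ε > 0 the probability that the random graph G ∼ G(n,1/2) admits a (γ_crit/√2 − ε)·√n-friendly equipartition tends to 1 as n → ∞. -/

import Mathlib

open MeasureTheory ProbabilityTheory

/-- `P[Z ≥ t]` for a standard Gaussian `Z`. -/
noncomputable def gaussTail (t : ℝ) : ℝ :=
  ((gaussianReal 0 1) {x | t ≤ x}).toReal

/-- The law of a pair of independent standard Gaussians. -/
noncomputable def gauss2 : Measure (ℝ × ℝ) :=
  (gaussianReal 0 1).prod (gaussianReal 0 1)

/-- `F₁(α) = log 2 − α² + log P[Z ≥ (γ+α)√2]`. -/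
noncomputable def F1 (γ α : ℝ) : ℝ :=
  Real.log 2 - α ^ 2 + Real.log (gaussTail ((γ + α) * Real.sqrt 2))

/-- `f(β,α) = P[√(β/2)Z₁ + √((1−β)/2)Z₂ ≥ γ+α ∧ √(β/2)Z₁ − √((1−β)/2)Z₂ ≥ γ+α]`. -/
noncomputable def fB (γ β α : ℝ) : ℝ :=
  (gauss2 {p : ℝ × ℝ |
      γ + α ≤ Real.sqrt (β / 2) * p.1 + Real.sqrt ((1 - β) / 2) * p.2 ∧
      γ + α ≤ Real.sqrt (β / 2) * p.1 - Real.sqrt ((1 - β) / 2) * p.2}).toReal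

/-- The two-partition exponent function `F₂`. -/
noncomputable def F2 (γ β α₁ α₂ : ℝ) : ℝ :=
  2 * Real.log 2 - 2 * β * Real.log β - 2 * (1 - β) * Real.log (1 - β)
    - 2 * α₁ ^ 2 - 2 * α₂ ^ 2
    + 2 * β * Real.log (fB γ β α₁) + 2 * (1 - β) * Real.log (fB γ (1 - β) α₂)

/-- `γ` is the critical constant: `γ > 0` and
`log 2 + sup_α (−α² + log P[Z ≥ (γ+α)√2]) = 0`. -/
def IsGammaCrit (γ : ℝ) : Prop :=
  0 < γ ∧
    Real.log 2 +
      (⨆ α : ℝ, (-α ^ 2 + Real.log (gaussTail ((γ + α) * Real.sqrt 2)))) = 0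

/-- Assumption (*) from the paper, with `ε₀ = 10⁻²⁵`: for every
`γ ∈ [γ_crit − ε₀, γ_crit + ε₀]`, (i) the sup of `F₂` over `β ∈ [0,.001]` is `2 sup F₁`,
(ii) the sup of `F₂` over `β ∈ [.001,.999]` is `4 sup F₁`, and (iii) writing `α(γ)` for
the maximizer of `F₁`, the Hessian of `F₂` at `(1/2, α(γ), α(γ))` is strictly negative
definite and this point is the unique maximizer of `F₂` over `β ∈ [.001,.999]`. -/
def AssumptionStar (γcrit : ℝ) : Prop :=
  ∀ γ ∈ Set.Icc (γcrit - (10 : ℝ) ^ (-25 : ℤ)) (γcrit + (10 : ℝ) ^ (-25 : ℤ)),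
    sSup {x : ℝ | ∃ β ∈ Set.Icc (0 : ℝ) 0.001, ∃ α₁ α₂ : ℝ, x = F2 γ β α₁ α₂}
        = 2 * (⨆ α : ℝ, F1 γ α) ∧
    sSup {x : ℝ | ∃ β ∈ Set.Icc (0.001 : ℝ) 0.999, ∃ α₁ α₂ : ℝ, x = F2 γ β α₁ α₂}
        = 4 * (⨆ α : ℝ, F1 γ α) ∧
    ∀ αγ : ℝ, (∀ α : ℝ, F1 γ α ≤ F1 γ αγ) →
      ((∀ v : ℝ × ℝ × ℝ, v ≠ 0 →
          iteratedFDeriv ℝ 2 (fun p : ℝ × ℝ × ℝ => F2 γ p.1 p.2.1 p.2.2)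
            (1 / 2, αγ, αγ) ![v, v] < 0) ∧
       (∀ β ∈ Set.Icc (0.001 : ℝ) 0.999, ∀ α₁ α₂ : ℝ,
          F2 γ β α₁ α₂ ≤ F2 γ (1 / 2) αγ αγ ∧
          (F2 γ β α₁ α₂ = F2 γ (1 / 2) αγ αγ → (β, α₁, α₂) = (1 / 2, αγ, αγ))))

/-- The probability, under the uniform measure on labeled graphs on `Fin n`
(equivalently under `G(n,1/2)`), of a graph property `P`. -/
noncomputable def graphProb (n : ℕ) (P : SimpleGraph (Fin n) → Prop) : ℝ :=
  (Nat.card {G : SimpleGraph (Fin n) // P G} : ℝ) / 2 ^ n.choose 2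

/-- `deg(v,S)`: the number of neighbors of `v` inside the vertex set `S`. -/
noncomputable def degIn {n : ℕ} (G : SimpleGraph (Fin n)) (v : Fin n)
    (S : Finset (Fin n)) : ℕ :=
  Nat.card {w : Fin n // w ∈ S ∧ G.Adj v w}

/-- `G` has an `H`-friendly equipartition: a partition `A ∪ Aᶜ` of the vertex set with
`||A| − |Aᶜ|| ≤ 1` such that every vertex has at least `H` more neighbours in its own
part than in the other part. -/
def HasFriendlyEquipartition {n : ℕ} (G : SimpleGraph (Fin n)) (H : ℝ) : Prop :=
  ∃ A : Finset (Fin n),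
    |(A.card : ℤ) - ((Aᶜ : Finset (Fin n)).card : ℤ)| ≤ 1 ∧
    (∀ v ∈ A, (degIn G v Aᶜ : ℝ) + H ≤ (degIn G v A : ℝ)) ∧
    (∀ v ∈ (Aᶜ : Finset (Fin n)), (degIn G v A : ℝ) + H ≤ (degIn G v Aᶜ : ℝ))

open scoped BigOperators

/-- The sign `±1` attached to a Boolean. -/
def spin (b : Bool) : ℝ := if b then 1 else -1

@[simp] lemma spin_true : spin true = 1 := rfl
@[simp] lemma spin_false : spin false = -1 := rfl

lemma spin_mul_self (b : Bool) : spin b * spin b = 1 := by cases b <;> norm_num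

lemma spin_sq (b : Bool) : spin b ^ 2 = 1 := by cases b <;> norm_num

lemma abs_spin (b : Bool) : |spin b| = 1 := by cases b <;> norm_num

lemma spin_not (b : Bool) : spin (!b) = -spin b := by cases b <;> norm_num

lemma spin_eq_or (b : Bool) : spin b = 1 ∨ spin b = -1 := by cases b <;> simp

open Classical in
/-- The probability of a predicate under the uniform measure on a finite type. -/
noncomputable def unifProb {α : Type*} [Fintype α] (p : α → Prop) : ℝ :=
  𝔼 x, if p x then (1 : ℝ) else 0

section UnifProb

variable {α β : Type*} [Fintype α] [Fintype β]

lemma unifProb_nonneg (p : α → Prop) : 0 ≤ unifProb p :=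
  Finset.expect_nonneg fun x _ => by split_ifs <;> norm_num

lemma unifProb_mono {p q : α → Prop} (h : ∀ x, p x → q x) : unifProb p ≤ unifProb q := by
  refine Finset.expect_le_expect fun x _ => ?_
  by_cases hp : p x
  · simp [hp, h x hp]
  · simp only [hp, if_false]; split_ifs <;> norm_num

lemma unifProb_le_one (p : α → Prop) : unifProb p ≤ 1 := by
  rcases isEmpty_or_nonempty α with h | h
  · simp [unifProb]
  · calc unifProb p ≤ 𝔼 _x : α, (1 : ℝ) := by
          refine Finset.expect_le_expect fun x _ => ?_
          split_ifs <;> norm_num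
      _ = 1 := by simp

lemma unifProb_not [Nonempty α] (p : α → Prop) : unifProb (fun x => ¬ p x) = 1 - unifProb p := by
  have : unifProb (fun x => ¬ p x) + unifProb p = 1 := by
    rw [unifProb, unifProb, ← Finset.expect_add_distrib]
    rw [show (1 : ℝ) = 𝔼 _x : α, (1 : ℝ) by simp]
    refine Finset.expect_congr rfl fun x _ => ?_
    by_cases h : p x <;> simp [h]
  linarith

lemma unifProb_or_le (p q : α → Prop) :
    unifProb (fun x => p x ∨ q x) ≤ unifProb p + unifProb q := by
  rw [unifProb, unifProb, unifProb, ← Finset.expect_add_distrib]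
  refine Finset.expect_le_expect fun x _ => ?_
  by_cases hp : p x <;> by_cases hq : q x <;> simp [hp, hq]

lemma unifProb_exists_le {ι : Type*} (s : Finset ι) (p : ι → α → Prop) :
    unifProb (fun x => ∃ i ∈ s, p i x) ≤ ∑ i ∈ s, unifProb (p i) := by
  classical
  induction s using Finset.induction_on with
  | empty => simp [unifProb]
  | insert a s ha ih =>
    rw [Finset.sum_insert ha]
    refine le_trans ?_ (le_trans (unifProb_or_le (p a) _) (add_le_add_right ih _))
    exact unifProb_mono fun x ⟨i, hi, h⟩ => by
      rcases Finset.mem_insert.1 hi with rfl | hi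
      · exact Or.inl h
      · exact Or.inr ⟨i, hi, h⟩

lemma unifProb_le_expect {p : α → Prop} {f : α → ℝ} (hf : ∀ x, 0 ≤ f x)
    (h : ∀ x, p x → 1 ≤ f x) : unifProb p ≤ 𝔼 x, f x := by
  refine Finset.expect_le_expect fun x _ => ?_
  split_ifs with hp
  · exact h x hp
  · exact hf x

lemma unifProb_equiv (e : α ≃ β) (p : β → Prop) :
    unifProb (fun x => p (e x)) = unifProb p :=
  Fintype.expect_equiv e _ _ fun _ => rfl

/-- A Chernoff bound. -/
lemma unifProb_ge_le_exp (f : α → ℝ) (l r : ℝ) (hl : 0 ≤ l) :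
    unifProb (fun x => r ≤ f x) ≤ Real.exp (-(l * r)) * 𝔼 x, Real.exp (l * f x) := by
  rw [Finset.mul_expect]
  refine unifProb_le_expect (fun x => by positivity) fun x hx => ?_
  rw [← Real.exp_add]
  exact Real.one_le_exp (by nlinarith)

end UnifProb

section Cube

lemma expect_cons {N : ℕ} (f : (Fin (N + 1) → Bool) → ℝ) :
    𝔼 x, f x = (𝔼 x : Fin N → Bool, f (Fin.cons true x) +
      𝔼 x : Fin N → Bool, f (Fin.cons false x)) / 2 := by
  rw [← Fintype.expect_equiv (Fin.consEquiv (fun _ : Fin (N + 1) => Bool))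
    (fun p => f (Fin.cons p.1 p.2)) f (fun p => rfl)]
  rw [← Finset.univ_product_univ, Finset.expect_product, Finset.expect_eq_sum_div_card
    (s := (Finset.univ : Finset Bool))]
  simp

/-- Flip the coordinate `i`. -/
def flipAt {ι : Type*} [DecidableEq ι] (i : ι) (x : ι → Bool) : ι → Bool :=
  Function.update x i (!x i)

lemma flipAt_flipAt {ι : Type*} [DecidableEq ι] (i : ι) (x : ι → Bool) :
    flipAt i (flipAt i x) = x := by
  simp [flipAt]

/-- Flipping a coordinate as a permutation of the cube. -/
def flipEquiv {ι : Type*} [DecidableEq ι] (i : ι) : Equiv.Perm (ι → Bool) :=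
  ⟨flipAt i, flipAt i, flipAt_flipAt i, flipAt_flipAt i⟩

lemma flipAt_zero_cons {N : ℕ} (b : Bool) (x : Fin N → Bool) :
    flipAt 0 (Fin.cons b x : Fin (N + 1) → Bool) = Fin.cons (!b) x := by
  simp [flipAt]

lemma flipAt_succ_cons {N : ℕ} (b : Bool) (x : Fin N → Bool) (i : Fin N) :
    flipAt i.succ (Fin.cons b x : Fin (N + 1) → Bool) = Fin.cons b (flipAt i x) := by
  simp [flipAt, Fin.cons_update]

lemma expect_sq_le {α : Type*} [Fintype α] [Nonempty α] (f : α → ℝ) :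
    (𝔼 x, f x) ^ 2 ≤ 𝔼 x, f x ^ 2 := by
  have h : 0 ≤ 𝔼 x, (f x - 𝔼 y, f y) ^ 2 := Finset.expect_nonneg fun _ _ => sq_nonneg _
  have h2 : 𝔼 x, (f x - 𝔼 y, f y) ^ 2 = 𝔼 x, f x ^ 2 - (𝔼 x, f x) ^ 2 := by
    set m := 𝔼 y, f y
    calc 𝔼 x, (f x - m) ^ 2 = 𝔼 x, (f x ^ 2 - 2 * m * f x + m ^ 2) := by
          refine Finset.expect_congr rfl fun x _ => by ring
      _ = 𝔼 x, f x ^ 2 - 2 * m * 𝔼 x, f x + m ^ 2 := by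
          rw [Finset.expect_add_distrib, Finset.expect_sub_distrib, ← Finset.mul_expect]
          simp
      _ = _ := by change _ - 2 * m * m + m ^ 2 = _ - m ^ 2; ring
  linarith

/-- The Poincaré inequality on the discrete cube. -/
lemma poincare_cube : ∀ {N : ℕ} (f : (Fin N → Bool) → ℝ),
    𝔼 x, f x ^ 2 - (𝔼 x, f x) ^ 2 ≤ (∑ i, 𝔼 x, (f x - f (flipAt i x)) ^ 2) / 4
  | 0, f => by simp
  | N + 1, f => by
    have h1 := poincare_cube fun x => f (Fin.cons true x)
    have h0 := poincare_cube fun x => f (Fin.cons false x)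
    have h2 := expect_sq_le fun x : Fin N → Bool => f (Fin.cons true x) - f (Fin.cons false x)
    have h3 : 𝔼 x : Fin N → Bool, (f (Fin.cons false x) - f (Fin.cons true x)) ^ 2 =
        𝔼 x : Fin N → Bool, (f (Fin.cons true x) - f (Fin.cons false x)) ^ 2 :=
      Finset.expect_congr rfl fun x _ => by ring
    rw [Finset.expect_sub_distrib] at h2
    rw [Fin.sum_univ_succ]
    simp only [expect_cons, flipAt_zero_cons, flipAt_succ_cons, Bool.not_true, Bool.not_false]
    rw [h3, ← Finset.sum_div, Finset.sum_add_distrib]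
    nlinarith

lemma sq_exp_sub_exp_le (a b : ℝ) :
    (Real.exp a - Real.exp b) ^ 2 ≤
      (a - b) ^ 2 * ((Real.exp (2 * a) + Real.exp (2 * b)) / 2) := by
  wlog h : b ≤ a generalizing a b
  · have := this b a (le_of_not_ge h)
    nlinarith
  have e2 : ∀ x : ℝ, Real.exp (2 * x) = Real.exp x ^ 2 := fun x => by
    rw [← Real.exp_nat_mul]; norm_num
  have h1 : Real.exp a - Real.exp b ≤ (a - b) * Real.exp a := by
    have := Real.add_one_le_exp (b - a)
    have h2 : Real.exp b = Real.exp a * Real.exp (b - a) := by rw [← Real.exp_add]; ring_nf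
    nlinarith [Real.exp_pos a]
  -- `tanh u ≤ u`
  have key : Real.exp a - Real.exp b ≤ (a - b) * ((Real.exp a + Real.exp b) / 2) := by
    have : ∀ u : ℝ, 0 ≤ u → 0 ≤ (u - 2) * Real.exp u + u + 2 := by
      intro u hu
      have hmono : MonotoneOn (fun u : ℝ => (u - 2) * Real.exp u + u + 2) (Set.Ici 0) := by
        refine monotoneOn_of_deriv_nonneg (convex_Ici 0) (by fun_prop) (by fun_prop) ?_
        intro x hx
        simp only [interior_Ici, Set.mem_Ioi] at hx
        have hd : HasDerivAt (fun u : ℝ => (u - 2) * Real.exp u + u + 2)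
            (1 * Real.exp x + (x - 2) * Real.exp x + 1) x :=
          ((((hasDerivAt_id x).sub_const 2).mul (Real.hasDerivAt_exp x)).add
            (hasDerivAt_id x)).add_const 2
        rw [hd.deriv]
        have := Real.add_one_le_exp (-x)
        have h3 : Real.exp x * Real.exp (-x) = 1 := by rw [← Real.exp_add]; simp
        nlinarith [Real.exp_pos x]
      have := hmono (Set.mem_Ici.2 le_rfl) (Set.mem_Ici.2 hu) hu
      simpa using this
    have h4 := this (a - b) (by linarith)
    have h2 : Real.exp a = Real.exp b * Real.exp (a - b) := by rw [← Real.exp_add]; ring_nf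
    rw [h2]
    nlinarith [Real.exp_pos b]
  have h5 : 0 ≤ Real.exp a - Real.exp b := by
    have := Real.exp_le_exp.2 h; linarith
  rw [e2, e2]
  calc (Real.exp a - Real.exp b) ^ 2 ≤ ((a - b) * ((Real.exp a + Real.exp b) / 2)) ^ 2 := by
        gcongr
    _ ≤ _ := by
        rw [mul_pow]
        refine mul_le_mul_of_nonneg_left ?_ (sq_nonneg _)
        nlinarith [sq_nonneg (Real.exp a - Real.exp b)]

/-- One halving step for the moment generating function, from the Poincaré inequality. -/
lemma mgf_halving {N : ℕ} (f : (Fin N → Bool) → ℝ) (V l : ℝ)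
    (hV : ∀ x, ∑ i, (f x - f (flipAt i x)) ^ 2 ≤ V) (hl : l ^ 2 * V ≤ 8) :
    𝔼 x, Real.exp (l * f x) ≤
      Real.exp (l ^ 2 * V / 8) * (𝔼 x, Real.exp (l / 2 * f x)) ^ 2 := by
  have h := poincare_cube fun x => Real.exp (l / 2 * f x)
  have e2 : ∀ x, Real.exp (l / 2 * f x) ^ 2 = Real.exp (l * f x) := fun x => by
    rw [← Real.exp_nat_mul]; ring_nf
  simp only [e2] at h
  have h2 : (∑ i, 𝔼 x, (Real.exp (l / 2 * f x) - Real.exp (l / 2 * f (flipAt i x))) ^ 2) ≤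
      l ^ 2 / 4 * V * 𝔼 x, Real.exp (l * f x) := by
    calc _ ≤ ∑ i, 𝔼 x, l ^ 2 / 4 * ((f x - f (flipAt i x)) ^ 2 * (Real.exp (l * f x) / 2) +
            (f x - f (flipAt i x)) ^ 2 * (Real.exp (l * f (flipAt i x)) / 2)) := by
          refine Finset.sum_le_sum fun i _ => Finset.expect_le_expect fun x _ => ?_
          refine (sq_exp_sub_exp_le _ _).trans (le_of_eq ?_)
          ring_nf
      _ = ∑ i, 𝔼 x, l ^ 2 / 4 * ((f x - f (flipAt i x)) ^ 2 * Real.exp (l * f x)) := by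
          refine Finset.sum_congr rfl fun i _ => ?_
          rw [← Finset.mul_expect, ← Finset.mul_expect, Finset.expect_add_distrib]
          congr 1
          have : 𝔼 x, (f x - f (flipAt i x)) ^ 2 * (Real.exp (l * f (flipAt i x)) / 2) =
              𝔼 x, (f x - f (flipAt i x)) ^ 2 * (Real.exp (l * f x) / 2) := by
            refine Fintype.expect_equiv (flipEquiv i) _ _ fun x => ?_
            change _ = (f (flipAt i x) - f (flipAt i (flipAt i x))) ^ 2 *
              (Real.exp (l * f (flipAt i x)) / 2)
            rw [flipAt_flipAt]; ring
          rw [this, ← Finset.expect_add_distrib]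
          exact Finset.expect_congr rfl fun x _ => by ring
      _ = 𝔼 x, l ^ 2 / 4 * ((∑ i, (f x - f (flipAt i x)) ^ 2) * Real.exp (l * f x)) := by
          rw [← Finset.expect_sum_comm]
          refine Finset.expect_congr rfl fun x _ => ?_
          rw [Finset.sum_mul, Finset.mul_sum]
      _ ≤ 𝔼 x, l ^ 2 / 4 * (V * Real.exp (l * f x)) := by
          refine Finset.expect_le_expect fun x _ => ?_
          have := hV x
          gcongr
      _ = _ := by rw [← Finset.mul_expect, ← Finset.mul_expect]; ring
  set M := 𝔼 x, Real.exp (l * f x) with hM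
  set m := 𝔼 x, Real.exp (l / 2 * f x) with hm
  have hM0 : 0 ≤ M := Finset.expect_nonneg fun _ _ => (Real.exp_pos _).le
  have h3 : M * (1 - l ^ 2 * V / 16) ≤ m ^ 2 := by nlinarith
  have h4 : 1 ≤ Real.exp (l ^ 2 * V / 8) * (1 - l ^ 2 * V / 16) := by
    have hVn : 0 ≤ V := le_trans (Finset.sum_nonneg fun _ _ => sq_nonneg _) (hV fun _ => true)
    set u := l ^ 2 * V / 8 with hu
    have hu0 : 0 ≤ u := by positivity
    have hu1 : u ≤ 1 := by rw [hu]; linarith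
    have := Real.add_one_le_exp u
    have : l ^ 2 * V / 16 = u / 2 := by rw [hu]; ring
    rw [this]
    nlinarith
  calc M ≤ M * (Real.exp (l ^ 2 * V / 8) * (1 - l ^ 2 * V / 16)) := le_mul_of_one_le_right hM0 h4
    _ = Real.exp (l ^ 2 * V / 8) * (M * (1 - l ^ 2 * V / 16)) := by ring
    _ ≤ _ := by gcongr

lemma mgf_le_of_bdd {N : ℕ} (f : (Fin N → Bool) → ℝ) (V B : ℝ)
    (hf : 𝔼 x, f x = 0) (hB : ∀ x, |f x| ≤ B)
    (hV : ∀ x, ∑ i, (f x - f (flipAt i x)) ^ 2 ≤ V) :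
    ∀ (k : ℕ) (l : ℝ), l ^ 2 * V ≤ 8 → |l| * B ≤ 2 ^ k →
      𝔼 x, Real.exp (l * f x) ≤ Real.exp (l ^ 2 * V / 4 + l ^ 2 * B ^ 2 / 2 ^ k) := by
  intro k
  have hVn : 0 ≤ V := le_trans (Finset.sum_nonneg fun _ _ => sq_nonneg _) (hV fun _ => true)
  induction k with
  | zero =>
    intro l _ hl
    calc 𝔼 x, Real.exp (l * f x) ≤ 𝔼 x, (1 + l * f x + l ^ 2 * B ^ 2) := by
          refine Finset.expect_le_expect fun x _ => ?_
          have h1 : |l * f x| ≤ 1 := by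
            rw [abs_mul]
            calc |l| * |f x| ≤ |l| * B := by gcongr; exact hB x
              _ ≤ 1 := by simpa using hl
          have h2 := Real.abs_exp_sub_one_sub_id_le h1
          have h3 : (l * f x) ^ 2 ≤ l ^ 2 * B ^ 2 := by
            rw [mul_pow]
            exact mul_le_mul_of_nonneg_left (sq_le_sq' (abs_le.1 (hB x)).1 (abs_le.1 (hB x)).2)
              (sq_nonneg _)
          linarith [(abs_le.1 h2).2]
      _ = 1 + l ^ 2 * B ^ 2 := by
          rw [Finset.expect_add_distrib, Finset.expect_add_distrib, ← Finset.mul_expect, hf]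
          simp
      _ ≤ Real.exp (l ^ 2 * B ^ 2) := by linarith [Real.add_one_le_exp (l ^ 2 * B ^ 2)]
      _ ≤ _ := by
          apply Real.exp_le_exp.2
          have : 0 ≤ l ^ 2 * V / 4 := by positivity
          simp only [pow_zero]; linarith
  | succ k ih =>
    intro l hl hb
    have h1 := mgf_halving f V l hV hl
    have h2 := ih (l / 2) (by nlinarith [mul_nonneg (sq_nonneg l) hVn]) (by
      rw [abs_div, abs_two]; rw [pow_succ] at hb; linarith)
    refine h1.trans ?_
    calc _ ≤ Real.exp (l ^ 2 * V / 8) *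
          (Real.exp ((l / 2) ^ 2 * V / 4 + (l / 2) ^ 2 * B ^ 2 / 2 ^ k)) ^ 2 := by
          have : 0 ≤ 𝔼 x, Real.exp (l / 2 * f x) :=
            Finset.expect_nonneg fun _ _ => (Real.exp_pos _).le
          gcongr
      _ = _ := by
          rw [← Real.exp_nat_mul, ← Real.exp_add]
          congr 1
          rw [pow_succ]; field_simp; push_cast; ring

lemma mgf_centered_le {N : ℕ} (f : (Fin N → Bool) → ℝ) (V l : ℝ)
    (hV : ∀ x, ∑ i, (f x - f (flipAt i x)) ^ 2 ≤ V) (hl : l ^ 2 * V ≤ 8) :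
    𝔼 x, Real.exp (l * (f x - 𝔼 y, f y)) ≤ Real.exp (l ^ 2 * V / 4) := by
  set m := 𝔼 y, f y with hm
  obtain ⟨B, hB⟩ : ∃ B, ∀ x, |f x - m| ≤ B := by
    refine ⟨∑ x, |f x - m|, fun x => ?_⟩
    exact Finset.single_le_sum (f := fun x => |f x - m|) (fun _ _ => abs_nonneg _)
      (Finset.mem_univ x)
  have h0 : 𝔼 x, (f x - m) = 0 := by
    rw [Finset.expect_sub_distrib]; simp [hm]
  have hk : ∀ᶠ k : ℕ in Filter.atTop, 𝔼 x, Real.exp (l * (f x - m)) ≤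
      Real.exp (l ^ 2 * V / 4 + l ^ 2 * B ^ 2 / 2 ^ k) := by
    have : Filter.Tendsto (fun k : ℕ => (2 : ℝ) ^ k) Filter.atTop Filter.atTop :=
      tendsto_pow_atTop_atTop_of_one_lt (by norm_num)
    filter_upwards [this.eventually_ge_atTop (|l| * B)] with k hk
    refine mgf_le_of_bdd (fun x => f x - m) V B h0 hB (fun x => ?_) k l hl hk
    simpa using hV x
  have ht : Filter.Tendsto (fun k : ℕ => Real.exp (l ^ 2 * V / 4 + l ^ 2 * B ^ 2 / 2 ^ k))
      Filter.atTop (nhds (Real.exp (l ^ 2 * V / 4))) := by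
    have h1 : Filter.Tendsto (fun k : ℕ => l ^ 2 * B ^ 2 / 2 ^ k) Filter.atTop (nhds 0) :=
      tendsto_const_nhds.div_atTop (tendsto_pow_atTop_atTop_of_one_lt (by norm_num))
    have := (h1.const_add (l ^ 2 * V / 4))
    rw [add_zero] at this
    exact (Real.continuous_exp.tendsto _).comp this
  exact ge_of_tendsto ht hk

/-- Exponential concentration below the mean for functions on the cube with bounded gradient. -/
lemma unifProb_le_expect_sub {N : ℕ} (f : (Fin N → Bool) → ℝ) (V t : ℝ) (hV0 : 0 < V)
    (hV : ∀ x, ∑ i, (f x - f (flipAt i x)) ^ 2 ≤ V) :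
    unifProb (fun x => f x ≤ 𝔼 y, f y - t) ≤ Real.exp (1 / 4 - t / Real.sqrt V) := by
  have hs : 0 < Real.sqrt V := Real.sqrt_pos.2 hV0
  have hsq : Real.sqrt V ^ 2 = V := Real.sq_sqrt hV0.le
  have h := mgf_centered_le f V (-(1 / Real.sqrt V)) hV (by
    rw [neg_sq, div_pow, hsq]; field_simp; norm_num)
  have h2 := unifProb_ge_le_exp (fun x => -(f x - 𝔼 y, f y)) (1 / Real.sqrt V) t (by positivity)
  calc _ = unifProb (fun x => t ≤ -(f x - 𝔼 y, f y)) := by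
        congr 1; ext x; constructor <;> intro h <;> linarith
    _ ≤ _ := h2
    _ ≤ Real.exp (-(1 / Real.sqrt V * t)) * Real.exp ((-(1 / Real.sqrt V)) ^ 2 * V / 4) := by
        gcongr
        refine le_trans (le_of_eq ?_) h
        refine Finset.expect_congr rfl fun x _ => ?_
        ring_nf
    _ = _ := by
        rw [← Real.exp_add]
        congr 1
        rw [neg_sq, div_pow, hsq]; field_simp; ring

end Cube

lemma mgf_le_of_lipschitz : ∀ {N : ℕ} (f : (Fin N → Bool) → ℝ) (l : ℝ),
    (∀ x i, |f x - f (flipAt i x)| ≤ 1) →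
    𝔼 x, Real.exp (l * f x) ≤ Real.exp (l * 𝔼 x, f x + l ^ 2 / 8 * N)
  | 0, f, l, _ => by simp
  | N + 1, f, l, hf => by
    have h1 := mgf_le_of_lipschitz (fun x => f (Fin.cons true x)) l fun x i => by
      simpa [flipAt_succ_cons] using hf (Fin.cons true x) i.succ
    have h0 := mgf_le_of_lipschitz (fun x => f (Fin.cons false x)) l fun x i => by
      simpa [flipAt_succ_cons] using hf (Fin.cons false x) i.succ
    rw [expect_cons, expect_cons]
    set m1 := 𝔼 x : Fin N → Bool, f (Fin.cons true x)
    set m0 := 𝔼 x : Fin N → Bool, f (Fin.cons false x)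
    have hm : |m1 - m0| ≤ 1 := by
      rw [← Finset.expect_sub_distrib]
      refine (Finset.abs_expect_le _ _).trans ?_
      calc _ ≤ 𝔼 _x : Fin N → Bool, (1 : ℝ) := by
            refine Finset.expect_le_expect fun x _ => ?_
            simpa [flipAt_zero_cons] using hf (Fin.cons true x) 0
        _ = 1 := by simp
    have hc := Real.cosh_le_exp_half_sq (l * (m1 - m0) / 2)
    have hle : (l * (m1 - m0) / 2) ^ 2 / 2 ≤ l ^ 2 / 8 := by
      have : (m1 - m0) ^ 2 ≤ 1 := by
        rw [← sq_abs]; nlinarith [abs_nonneg (m1 - m0)]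
      nlinarith [sq_nonneg l]
    calc _ ≤ (Real.exp (l * m1 + l ^ 2 / 8 * N) + Real.exp (l * m0 + l ^ 2 / 8 * N)) / 2 := by
          gcongr
      _ = Real.exp (l * ((m1 + m0) / 2) + l ^ 2 / 8 * N) * Real.cosh (l * (m1 - m0) / 2) := by
          rw [Real.cosh_eq, mul_div_assoc', mul_add, ← Real.exp_add, ← Real.exp_add]
          congr 3 <;> ring
      _ ≤ Real.exp (l * ((m1 + m0) / 2) + l ^ 2 / 8 * N) * Real.exp (l ^ 2 / 8) := by
          gcongr
          exact hc.trans (Real.exp_le_exp.2 hle)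
      _ = _ := by
          rw [← Real.exp_add]; congr 1; push_cast; ring

lemma unifProb_hamming_fin {N : ℕ} (hN : 0 < N) (p : (Fin N → Bool) → Prop) (s : ℝ) (hs : 0 < s)
    (hp : Real.exp (-s) ≤ unifProb p) :
    unifProb (fun x => ¬ ∃ y, p y ∧ (hammingDist x y : ℝ) ≤ 3 * Real.sqrt (s * N)) ≤
      Real.exp (-s) := by
  classical
  have hne : ∃ y, p y := by
    by_contra h
    push Not at h
    have : unifProb p = 0 := by simp [unifProb, h]
    rw [this] at hp
    exact absurd (Real.exp_pos (-s)) (not_lt.2 hp)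
  obtain ⟨y0, hy0⟩ := hne
  have hN' : (0 : ℝ) < N := by exact_mod_cast hN
  let T : Finset (Fin N → Bool) := Finset.univ.filter p
  have hT : T.Nonempty := ⟨y0, by simp [T, hy0]⟩
  let d : (Fin N → Bool) → ℕ := fun x => T.inf' hT (fun y => hammingDist x y)
  have hd : ∀ x, ∃ y, p y ∧ d x = hammingDist x y := fun x => by
    obtain ⟨y, hy, h⟩ := Finset.exists_mem_eq_inf' hT (fun y => hammingDist x y)
    exact ⟨y, by simpa [T] using hy, h⟩
  have hdle : ∀ x y, p y → d x ≤ hammingDist x y := fun x y hy =>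
    Finset.inf'_le _ (by simp [T, hy])
  have hflip : ∀ (x : Fin N → Bool) i, hammingDist x (flipAt i x) ≤ 1 := fun x i => by
    rw [hammingDist]
    calc _ ≤ ({i} : Finset (Fin N)).card := by
          refine Finset.card_le_card fun j hj => ?_
          by_contra h
          simp only [Finset.mem_singleton] at h
          exact (Finset.mem_filter.1 hj).2 (by simp [flipAt, Function.update_of_ne h])
      _ = 1 := by simp
  have hstep : ∀ x i, d x ≤ d (flipAt i x) + 1 := fun x i => by
    obtain ⟨y, hy, h⟩ := hd (flipAt i x)
    calc d x ≤ hammingDist x y := hdle x y hy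
      _ ≤ hammingDist x (flipAt i x) + hammingDist (flipAt i x) y := hammingDist_triangle _ _ _
      _ ≤ _ := by rw [h]; have := hflip x i; omega
  have hlip : ∀ x i, |(d x : ℝ) - d (flipAt i x)| ≤ 1 := fun x i => by
    have h1 := hstep x i
    have h2 := hstep (flipAt i x) i
    rw [flipAt_flipAt] at h2
    rw [abs_le]
    constructor
    · have : (d (flipAt i x) : ℝ) ≤ d x + 1 := by exact_mod_cast h2
      linarith
    · have : (d x : ℝ) ≤ d (flipAt i x) + 1 := by exact_mod_cast h1
      linarith
  set l := Real.sqrt (s / N) with hl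
  have hl0 : 0 < l := Real.sqrt_pos.2 (by positivity)
  have hl2 : l ^ 2 * N = s := by rw [hl, Real.sq_sqrt (by positivity)]; field_simp
  have hls : l * Real.sqrt (s * N) = s := by
    rw [hl, ← Real.sqrt_mul (by positivity)]
    rw [show s / N * (s * N) = s ^ 2 by field_simp]
    exact Real.sqrt_sq hs.le
  set m := 𝔼 x, (d x : ℝ) with hm
  have hneg := mgf_le_of_lipschitz (fun x => (d x : ℝ)) (-l) hlip
  have hpos := mgf_le_of_lipschitz (fun x => (d x : ℝ)) l hlip
  have hm' : l * m ≤ s + s / 8 := by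
    have h1 : unifProb p ≤ 𝔼 x, Real.exp (-l * d x) := by
      refine unifProb_le_expect (fun x => (Real.exp_pos _).le) fun x hx => ?_
      have : d x = 0 := by
        have := hdle x x hx
        rw [hammingDist_self] at this; omega
      simp [this]
    have h2 := (hp.trans h1).trans hneg
    rw [Real.exp_le_exp, ← hm] at h2
    have : (-l) ^ 2 / 8 * N = s / 8 := by rw [← hl2]; ring
    rw [this] at h2
    linarith
  have hch := unifProb_ge_le_exp (fun x => (d x : ℝ)) l (3 * Real.sqrt (s * N)) hl0.le
  calc _ ≤ unifProb (fun x => 3 * Real.sqrt (s * N) ≤ (d x : ℝ)) := by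
        refine unifProb_mono fun x hx => ?_
        by_contra hlt
        obtain ⟨y, hy, h⟩ := hd x
        exact hx ⟨y, hy, by rw [← h]; exact (not_le.1 hlt).le⟩
    _ ≤ Real.exp (-(l * (3 * Real.sqrt (s * N)))) * Real.exp (l * m + l ^ 2 / 8 * N) := by
        refine hch.trans ?_
        gcongr
    _ ≤ Real.exp (-s) := by
        rw [← Real.exp_add, Real.exp_le_exp]
        have : l ^ 2 / 8 * N = s / 8 := by rw [← hl2]; ring
        have h3 : l * (3 * Real.sqrt (s * N)) = 3 * s := by linear_combination 3 * hls
        rw [this, h3]; linarith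

/-- Concentration of measure for the Hamming distance on the discrete cube: a set of
probability at least `exp (-s)` is within distance `3 √(s N)` of most points. -/
lemma unifProb_hamming {ι : Type*} [Fintype ι] [Nonempty ι] [DecidableEq ι]
    (p : (ι → Bool) → Prop) (s : ℝ) (hs : 0 < s) (hp : Real.exp (-s) ≤ unifProb p) :
    unifProb (fun x => ¬ ∃ y, p y ∧ (hammingDist x y : ℝ) ≤ 3 * Real.sqrt (s * Fintype.card ι)) ≤
      Real.exp (-s) := by
  let e := Fintype.equivFin ι
  let E : (Fin (Fintype.card ι) → Bool) ≃ (ι → Bool) := Equiv.arrowCongr e.symm (Equiv.refl _)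
  have hE : ∀ x i, E x i = x (e i) := fun x i => rfl
  have hham : ∀ x y, hammingDist (E x) (E y) = hammingDist x y := fun x y => by
    simp only [hammingDist, hE]
    refine Finset.card_bij (fun i _ => e i) (by simp) (by simp) fun j hj =>
      ⟨e.symm j, by simpa using hj, by simp⟩
  have h := unifProb_hamming_fin Fintype.card_pos (fun x => p (E x)) s hs (by
    rwa [unifProb_equiv E p])
  rw [← unifProb_equiv E]
  refine (unifProb_mono fun x hx => ?_).trans h
  rintro ⟨y, hy, hd⟩
  exact hx ⟨E y, hy, by rwa [hham]⟩

section ProductExpectation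

lemma expect_prod_apply {ι κ : Type*} [Fintype ι] [DecidableEq ι] [Fintype κ]
    (f : ι → κ → ℝ) :
    𝔼 y : ι → κ, ∏ i, f i (y i) = ∏ i, 𝔼 b, f i b := by
  simp only [Fintype.expect_eq_sum_div_card, Finset.prod_div_distrib]
  rw [Finset.prod_univ_sum, Fintype.piFinset_univ]
  simp

lemma expect_bool (f : Bool → ℝ) : 𝔼 b, f b = (f true + f false) / 2 := by
  rw [Fintype.expect_eq_sum_div_card]; simp

lemma expect_exp_linear_le {ι : Type*} [Fintype ι] [DecidableEq ι] (c : ι → ℝ) :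
    𝔼 y : ι → Bool, Real.exp (∑ i, c i * spin (y i)) ≤ Real.exp ((∑ i, c i ^ 2) / 2) := by
  simp only [Real.exp_sum]
  rw [expect_prod_apply fun i b => Real.exp (c i * spin b), Finset.sum_div, Real.exp_sum]
  refine Finset.prod_le_prod (fun i _ => Finset.expect_nonneg fun _ _ => (Real.exp_pos _).le)
    fun i _ => ?_
  rw [expect_bool]
  have := Real.cosh_le_exp_half_sq (c i)
  rw [Real.cosh_eq] at this
  simpa using this

lemma expect_odd {ι : Type*} [Fintype ι] [DecidableEq ι] (f : (ι → Bool) → ℝ)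
    (hf : ∀ y, f (fun i => !y i) = -f y) : 𝔼 y, f y = 0 := by
  let e : (ι → Bool) ≃ (ι → Bool) := Equiv.arrowCongr (Equiv.refl _) Equiv.boolNot
  have h : 𝔼 y, -f y = 𝔼 y, f y := Fintype.expect_equiv e _ _ fun y => by
    rw [← hf]; rfl
  rw [Finset.expect_neg_distrib] at h
  linarith

lemma expect_linear_sq {ι : Type*} [Fintype ι] [DecidableEq ι] (c : ι → ℝ) :
    𝔼 y : ι → Bool, (∑ i, c i * spin (y i)) ^ 2 = ∑ i, c i ^ 2 := by
  have h : ∀ i j, 𝔼 y : ι → Bool, (c i * spin (y i)) * (c j * spin (y j)) =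
      if i = j then c i ^ 2 else 0 := by
    intro i j
    split_ifs with hij
    · subst hij
      calc _ = 𝔼 _y : ι → Bool, c i ^ 2 := by
            refine Finset.expect_congr rfl fun y _ => ?_
            linear_combination c i ^ 2 * spin_mul_self (y i)
        _ = _ := by simp
    · have hf : 𝔼 y : ι → Bool, (c i * spin (y i)) * (c j * spin (y j)) =
          𝔼 y : ι → Bool, -((c i * spin (y i)) * (c j * spin (y j))) := by
        refine Fintype.expect_equiv (flipEquiv i) _ _ fun y => ?_
        change _ = -((c i * spin (flipAt i y i)) * (c j * spin (flipAt i y j)))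
        rw [flipAt, Function.update_self, Function.update_of_ne (Ne.symm hij), spin_not]
        ring
      rw [Finset.expect_neg_distrib] at hf
      linarith
  simp only [sq, Finset.sum_mul_sum]
  rw [Finset.expect_sum_comm]
  refine Finset.sum_congr rfl fun i _ => ?_
  rw [Finset.expect_sum_comm]
  simp only [h]
  simp [sq]

end ProductExpectation

section Bump

/-- The square of the positive part. -/
noncomputable def sqPos (u : ℝ) : ℝ := max u 0 ^ 2

/-- A `C^{1,1}` smooth step function vanishing on `u ≤ 0` and equal to `2` for `u ≥ 2`. -/
noncomputable def smoothStep (u : ℝ) : ℝ := sqPos u - 2 * sqPos (u - 1) + sqPos (u - 2)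

lemma sqPos_second_diff (u k : ℝ) (hk : 0 ≤ k) :
    0 ≤ sqPos (u + k) - 2 * sqPos u + sqPos (u - k) ∧
      sqPos (u + k) - 2 * sqPos u + sqPos (u - k) ≤ 2 * k ^ 2 := by
  unfold sqPos
  rcases max_cases (u + k) 0 with ⟨h1, h1'⟩ | ⟨h1, h1'⟩ <;>
  rcases max_cases u 0 with ⟨h2, h2'⟩ | ⟨h2, h2'⟩ <;>
  rcases max_cases (u - k) 0 with ⟨h3, h3'⟩ | ⟨h3, h3'⟩ <;>
  rw [h1, h2, h3] <;> constructor <;> nlinarith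

lemma smoothStep_second_diff (u k : ℝ) (hk : 0 ≤ k) :
    |smoothStep (u + k) - 2 * smoothStep u + smoothStep (u - k)| ≤ 8 * k ^ 2 := by
  obtain ⟨a1, a2⟩ := sqPos_second_diff u k hk
  obtain ⟨b1, b2⟩ := sqPos_second_diff (u - 1) k hk
  obtain ⟨c1, c2⟩ := sqPos_second_diff (u - 2) k hk
  have e1 : u + k - 1 = u - 1 + k := by ring
  have e2 : u + k - 2 = u - 2 + k := by ring
  have e3 : u - k - 1 = u - 1 - k := by ring
  have e4 : u - k - 2 = u - 2 - k := by ring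
  simp only [smoothStep, e1, e2, e3, e4]
  rw [abs_le]
  have := sq_nonneg k
  constructor <;> linarith

lemma smoothStep_of_nonpos {u : ℝ} (h : u ≤ 0) : smoothStep u = 0 := by
  simp [smoothStep, sqPos, max_eq_right h, max_eq_right (show u - 1 ≤ 0 by linarith),
    max_eq_right (show u - 2 ≤ 0 by linarith)]

lemma smoothStep_mono_lip {a b : ℝ} (h : b ≤ a) :
    0 ≤ smoothStep a - smoothStep b ∧ smoothStep a - smoothStep b ≤ 2 * (a - b) := by
  unfold smoothStep sqPos
  rcases max_cases a 0 with ⟨h1, h1'⟩ | ⟨h1, h1'⟩ <;>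
  rcases max_cases (a - 1) 0 with ⟨h2, h2'⟩ | ⟨h2, h2'⟩ <;>
  rcases max_cases (a - 2) 0 with ⟨h3, h3'⟩ | ⟨h3, h3'⟩ <;>
  rcases max_cases b 0 with ⟨k1, k1'⟩ | ⟨k1, k1'⟩ <;>
  rcases max_cases (b - 1) 0 with ⟨k2, k2'⟩ | ⟨k2, k2'⟩ <;>
  rcases max_cases (b - 2) 0 with ⟨k3, k3'⟩ | ⟨k3, k3'⟩ <;>
  first
  | (exfalso; linarith)
  | (rw [h1, h2, h3, k1, k2, k3]; constructor <;> nlinarith)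

lemma abs_smoothStep_sub_le (a b : ℝ) : |smoothStep a - smoothStep b| ≤ 2 * |a - b| := by
  rcases le_total b a with h | h
  · obtain ⟨h1, h2⟩ := smoothStep_mono_lip h
    rwa [abs_of_nonneg h1, abs_of_nonneg (by linarith)]
  · obtain ⟨h1, h2⟩ := smoothStep_mono_lip h
    rw [abs_sub_comm, abs_sub_comm a, abs_of_nonneg h1, abs_of_nonneg (by linarith)]
    exact h2

lemma smoothStep_nonneg (u : ℝ) : 0 ≤ smoothStep u := by
  rcases le_total u 0 with h | h
  · rw [smoothStep_of_nonpos h]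
  · have := (smoothStep_mono_lip h).1
    rwa [smoothStep_of_nonpos le_rfl, sub_zero] at this

lemma smoothStep_le_two (u : ℝ) : smoothStep u ≤ 2 := by
  have h : smoothStep (max u 2) = 2 := by
    have : (2 : ℝ) ≤ max u 2 := le_max_right _ _
    generalize max u 2 = w at this
    rw [smoothStep, sqPos, sqPos, sqPos, max_eq_left (by linarith), max_eq_left (by linarith),
      max_eq_left (by linarith)]
    ring
  have := (smoothStep_mono_lip (le_max_left u 2)).1
  linarith

lemma smoothStep_lower {u : ℝ} (h : 0.05 ≤ u) : 0.0025 ≤ smoothStep u := by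
  have h1 : smoothStep 0.05 = 0.0025 := by
    norm_num [smoothStep, sqPos]
  have := (smoothStep_mono_lip h).1
  linarith

/-- A polynomial minorant of a multiple of the smooth step. -/
lemma poly_le_smoothStep (r k : ℝ) (hk : k ≤ 0.8) :
    (r - 0.85) * (r + 1) ^ 2 * (1000 - r) ≤ 10 ^ 15 * smoothStep (r - k) := by
  rcases le_total r 0.85 with h | h
  · have h1 : (r - 0.85) * (r + 1) ^ 2 * (1000 - r) ≤ 0 := by
      have : 0 ≤ (0.85 - r) * (r + 1) ^ 2 * (1000 - r) :=
        mul_nonneg (mul_nonneg (by linarith) (sq_nonneg _)) (by linarith)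
      linarith
    have := smoothStep_nonneg (r - k)
    linarith
  · rcases le_total r 1000 with h' | h'
    · have h1 := smoothStep_lower (u := r - k) (by linarith)
      have h2 : (r - 0.85) * (r + 1) ^ 2 * (1000 - r) ≤ 1000 * 1001 ^ 2 * 1000 := by
        gcongr <;> linarith
      linarith
    · have h1 : (r - 0.85) * (r + 1) ^ 2 * (1000 - r) ≤ 0 :=
        mul_nonpos_of_nonneg_of_nonpos (mul_nonneg (by linarith) (sq_nonneg _)) (by linarith)
      have := smoothStep_nonneg (r - k)
      linarith

end Bump

section OneStep

lemma expect_linear_fourth_le {ι : Type*} [Fintype ι] [DecidableEq ι] (c : ι → ℝ)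
    (hc : ∑ i, c i ^ 2 ≤ 1) : 𝔼 y : ι → Bool, (∑ i, c i * spin (y i)) ^ 4 ≤ 24 := by
  have h1 : ∀ r : ℝ, r ^ 4 ≤ 3 / 2 * (Real.exp (2 * r) + Real.exp (-(2 * r))) := fun r => by
    have h := Real.pow_div_factorial_le_exp (|2 * r|) (abs_nonneg _) 4
    have h2 : |2 * r| ^ 4 = 16 * r ^ 4 := by
      rw [show (4 : ℕ) = 2 * 2 by norm_num, pow_mul, sq_abs]; ring
    have h3 : Real.exp |2 * r| ≤ Real.exp (2 * r) + Real.exp (-(2 * r)) := by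
      rcases abs_cases (2 * r) with ⟨h, _⟩ | ⟨h, _⟩ <;> rw [h]
      · linarith [Real.exp_pos (-(2 * r))]
      · linarith [Real.exp_pos (2 * r)]
    have h4 : ((Nat.factorial 4 : ℕ) : ℝ) = 24 := by norm_num [Nat.factorial]
    rw [h2, h4] at h
    linarith
  have h2 := expect_exp_linear_le fun i => 2 * c i
  have h3 := expect_exp_linear_le fun i => -(2 * c i)
  have e2 : Real.exp 2 ≤ 8 := by
    have := Real.exp_one_lt_d9
    rw [show (2 : ℝ) = 1 + 1 by norm_num, Real.exp_add]
    nlinarith [Real.exp_pos 1]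
  have h4 : ∑ i, (2 * c i) ^ 2 = 4 * ∑ i, c i ^ 2 := by
    rw [Finset.mul_sum]; exact Finset.sum_congr rfl fun i _ => by ring
  have h5 : ∑ i, (-(2 * c i)) ^ 2 = 4 * ∑ i, c i ^ 2 := by
    rw [Finset.mul_sum]; exact Finset.sum_congr rfl fun i _ => by ring
  have h6 : Real.exp ((4 * ∑ i, c i ^ 2) / 2) ≤ Real.exp 2 := Real.exp_le_exp.2 (by linarith)
  rw [h4] at h2
  rw [h5] at h3
  calc _ ≤ 𝔼 y : ι → Bool, 3 / 2 * (Real.exp (∑ i, (2 * c i) * spin (y i)) +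
          Real.exp (∑ i, (-(2 * c i)) * spin (y i))) := by
        refine Finset.expect_le_expect fun y _ => (h1 _).trans (le_of_eq ?_)
        rw [Finset.mul_sum, ← Finset.sum_neg_distrib]
        congr 4 <;> ext i <;> ring
    _ ≤ _ := by
        rw [← Finset.mul_expect, Finset.expect_add_distrib]
        linarith

lemma expect_smoothStep_lower {ι : Type*} [Fintype ι] [DecidableEq ι] (c : ι → ℝ) (k : ℝ)
    (hk : k ≤ 0.8) (hc : ∑ i, c i ^ 2 ≤ 1) (hc' : 0.95 ≤ ∑ i, c i ^ 2) :
    10 ^ (-13 : ℤ) ≤ 𝔼 y : ι → Bool, smoothStep (∑ i, c i * spin (y i) - k) := by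
  have h4 := expect_linear_fourth_le c hc
  have h2 := expect_linear_sq c
  have hodd : ∀ y : ι → Bool, ∑ i, c i * spin (!y i) = -∑ i, c i * spin (y i) := fun y => by
    rw [← Finset.sum_neg_distrib]
    exact Finset.sum_congr rfl fun i _ => by rw [spin_not]; ring
  have h1 : 𝔼 y : ι → Bool, (∑ i, c i * spin (y i)) = 0 := expect_odd _ hodd
  have h3 : 𝔼 y : ι → Bool, (∑ i, c i * spin (y i)) ^ 3 = 0 := expect_odd _ fun y => by
    rw [hodd]; ring
  have hle : 𝔼 y : ι → Bool, (-(∑ i, c i * spin (y i)) ^ 4 +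
      998.85 * (∑ i, c i * spin (y i)) ^ 3 + (1999 - 998 * 0.85) * (∑ i, c i * spin (y i)) ^ 2
      + (1000 - 1999 * 0.85) * (∑ i, c i * spin (y i)) + -850) ≤
      𝔼 y : ι → Bool, 10 ^ 15 * smoothStep (∑ i, c i * spin (y i) - k) := by
    refine Finset.expect_le_expect fun y _ => ?_
    refine le_trans (le_of_eq ?_) (poly_le_smoothStep _ k hk)
    ring
  rw [← Finset.mul_expect, Finset.expect_add_distrib, Finset.expect_add_distrib,
    Finset.expect_add_distrib, Finset.expect_add_distrib, Finset.expect_neg_distrib,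
    ← Finset.mul_expect, ← Finset.mul_expect, ← Finset.mul_expect, h1, h2, h3,
    Fintype.expect_const] at hle
  norm_num at hle ⊢
  linarith

variable {ι : Type*} {n : ℕ}

lemma sq_avg_sub_flip_le (C : Finset ι) (a : ι → Fin n → ℝ)
    (ha : ∀ σ ∈ C, ∀ w, a σ w = 0 ∨ a σ w = 1 ∨ a σ w = -1) (h : ℝ) (hh : 0 ≤ h) (k : ℝ)
    (y : Fin n → Bool) (i : Fin n) :
    ((∑ σ ∈ C, smoothStep (h * ∑ w, a σ w * spin (y w) - k)) -
      ∑ σ ∈ C, smoothStep (h * ∑ w, a σ w * spin (flipAt i y w) - k)) ^ 2 ≤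
    2 * (∑ σ ∈ C, a σ i * ((smoothStep (h * ∑ w, a σ w * spin (y w) - k + 2 * h) -
        smoothStep (h * ∑ w, a σ w * spin (y w) - k - 2 * h)) / 2)) ^ 2 +
      2 * (C.card * (16 * h ^ 2)) ^ 2 := by
  set u : ι → ℝ := fun σ => h * ∑ w, a σ w * spin (y w) - k with hu
  set A : ι → ℝ := fun σ => (smoothStep (u σ + 2 * h) - smoothStep (u σ - 2 * h)) / 2 with hA
  set B : ι → ℝ := fun σ =>
    -(smoothStep (u σ + 2 * h) - 2 * smoothStep (u σ) + smoothStep (u σ - 2 * h)) / 2 with hB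
  have hflip : ∀ σ, h * ∑ w, a σ w * spin (flipAt i y w) - k =
      u σ - 2 * h * (a σ i * spin (y i)) := fun σ => by
    have : ∑ w, a σ w * spin (flipAt i y w) =
        ∑ w, a σ w * spin (y w) - 2 * (a σ i * spin (y i)) := by
      rw [← Finset.add_sum_erase _ _ (Finset.mem_univ i),
        ← Finset.add_sum_erase _ (fun w => a σ w * spin (y w)) (Finset.mem_univ i)]
      have h2 : ∑ w ∈ Finset.univ.erase i, a σ w * spin (flipAt i y w) =
          ∑ w ∈ Finset.univ.erase i, a σ w * spin (y w) :=
        Finset.sum_congr rfl fun w hw => by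
          rw [flipAt, Function.update_of_ne (Finset.ne_of_mem_erase hw)]
      rw [h2, flipAt, Function.update_self, spin_not]
      ring
    rw [this, hu]; ring
  have hBle : ∀ σ, |B σ| ≤ 16 * h ^ 2 := fun σ => by
    have := smoothStep_second_diff (u σ) (2 * h) (by linarith)
    rw [hB]; simp only [abs_div, abs_neg, abs_two]
    linarith
  have hd : ∀ σ ∈ C, smoothStep (u σ) - smoothStep (u σ - 2 * h * (a σ i * spin (y i))) =
      spin (y i) * (a σ i * A σ) + a σ i ^ 2 * B σ := fun σ hσ => by
    rcases ha σ hσ i with h0 | h0 | h0 <;> rcases spin_eq_or (y i) with h1 | h1 <;>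
      rw [h0, h1] <;> simp only [hA, hB] <;> ring_nf
  rw [← Finset.sum_sub_distrib]
  have hsum : ∑ σ ∈ C, (smoothStep (u σ) -
      smoothStep (h * ∑ w, a σ w * spin (flipAt i y w) - k)) =
      spin (y i) * (∑ σ ∈ C, a σ i * A σ) + ∑ σ ∈ C, a σ i ^ 2 * B σ := by
    rw [Finset.mul_sum, ← Finset.sum_add_distrib]
    exact Finset.sum_congr rfl fun σ hσ => by rw [hflip, hd σ hσ]
  have hsB : |∑ σ ∈ C, a σ i ^ 2 * B σ| ≤ C.card * (16 * h ^ 2) := by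
    refine (Finset.abs_sum_le_sum_abs _ _).trans ?_
    rw [← nsmul_eq_mul]
    refine Finset.sum_le_card_nsmul _ _ _ fun σ hσ => ?_
    rw [abs_mul]
    have := hBle σ
    rcases ha σ hσ i with h0 | h0 | h0 <;> rw [h0] <;> norm_num
    · positivity
    · exact this
    · exact this
  change (∑ σ ∈ C, (smoothStep (u σ) - _)) ^ 2 ≤ 2 * (∑ σ ∈ C, a σ i * A σ) ^ 2 + _
  rw [hsum]
  have h1 := sq_le_sq' (abs_le.1 hsB).1 (abs_le.1 hsB).2
  have h2 := spin_sq (y i)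
  set P := ∑ σ ∈ C, a σ i * A σ
  set R := ∑ σ ∈ C, a σ i ^ 2 * B σ
  have h3 : (spin (y i) * P) ^ 2 = P ^ 2 := by rw [mul_pow, h2, one_mul]
  nlinarith [sq_nonneg (spin (y i) * P - R)]

/-- If the rows of a family of sign vectors are nearly orthogonal on average, then with
overwhelming probability a random sign vector has large correlation with a positive
proportion of the family. -/
lemma unifProb_few_good_le (C : Finset ι) (hC : C.Nonempty) (a : ι → Fin n → ℝ)
    (hn : 0 < n)
    (ha : ∀ σ ∈ C, ∀ w, a σ w = 0 ∨ a σ w = 1 ∨ a σ w = -1)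
    (ha2 : ∀ σ ∈ C, 0.95 * (n : ℝ) ≤ ∑ w, a σ w ^ 2) (k v : ℝ) (hk : k ≤ 0.8) (hv : 0 ≤ v)
    (hov : ∑ σ ∈ C, ∑ τ ∈ C, |∑ w, a σ w * a τ w| ≤ v * n * (C.card : ℝ) ^ 2) :
    unifProb (fun y : Fin n → Bool =>
      ∃ D : Finset ι, (∀ σ ∈ C, k * Real.sqrt n ≤ ∑ w, a σ w * spin (y w) → σ ∈ D) ∧
        (D.card : ℝ) < 10 ^ (-14 : ℤ) * C.card) ≤
      Real.exp (1 / 4 - 10 ^ (-14 : ℤ) / Real.sqrt (32 * v + 512 / n)) := by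
  classical
  have hn' : (0 : ℝ) < n := by exact_mod_cast hn
  have hcard : (0 : ℝ) < C.card := by exact_mod_cast hC.card_pos
  set h := 1 / Real.sqrt n with hh
  have hs : 0 < Real.sqrt n := Real.sqrt_pos.2 hn'
  have hh0 : 0 ≤ h := by positivity
  have hh2 : h ^ 2 = 1 / n := by rw [hh, div_pow, Real.sq_sqrt hn'.le, one_pow]
  set F : (Fin n → Bool) → ℝ := fun y =>
    (∑ σ ∈ C, smoothStep (h * ∑ w, a σ w * spin (y w) - k)) / C.card with hF
  have hgrad : ∀ y, ∑ i, (F y - F (flipAt i y)) ^ 2 ≤ 32 * v + 512 / n := fun y => by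
    set A : ι → ℝ := fun σ => (smoothStep (h * ∑ w, a σ w * spin (y w) - k + 2 * h) -
        smoothStep (h * ∑ w, a σ w * spin (y w) - k - 2 * h)) / 2 with hA
    have hAle : ∀ σ, |A σ| ≤ 4 * h := fun σ => by
      rw [hA]; simp only [abs_div, abs_two]
      have := abs_smoothStep_sub_le (h * ∑ w, a σ w * spin (y w) - k + 2 * h)
        (h * ∑ w, a σ w * spin (y w) - k - 2 * h)
      rw [show h * ∑ w, a σ w * spin (y w) - k + 2 * h -
        (h * ∑ w, a σ w * spin (y w) - k - 2 * h) = 4 * h by ring,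
        abs_of_nonneg (show 0 ≤ 4 * h by linarith)] at this
      linarith
    have hsum : ∑ i, (∑ σ ∈ C, a σ i * A σ) ^ 2 ≤ 16 * v * (C.card : ℝ) ^ 2 := by
      calc ∑ i, (∑ σ ∈ C, a σ i * A σ) ^ 2
          = ∑ σ ∈ C, ∑ τ ∈ C, A σ * A τ * ∑ i, a σ i * a τ i := by
            simp only [sq, Finset.sum_mul_sum]
            rw [Finset.sum_comm]
            refine Finset.sum_congr rfl fun σ _ => ?_
            rw [Finset.sum_comm]
            refine Finset.sum_congr rfl fun τ _ => ?_
            rw [Finset.mul_sum]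
            exact Finset.sum_congr rfl fun i _ => by ring
        _ ≤ ∑ σ ∈ C, ∑ τ ∈ C, (4 * h) * (4 * h) * |∑ w, a σ w * a τ w| := by
            refine Finset.sum_le_sum fun σ _ => Finset.sum_le_sum fun τ _ => ?_
            refine (le_abs_self _).trans ?_
            rw [abs_mul, abs_mul]
            gcongr
            · exact hAle σ
            · exact hAle τ
        _ = 16 * h ^ 2 * ∑ σ ∈ C, ∑ τ ∈ C, |∑ w, a σ w * a τ w| := by
            simp only [Finset.mul_sum]
            refine Finset.sum_congr rfl fun σ _ => Finset.sum_congr rfl fun τ _ => by ring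
        _ ≤ 16 * h ^ 2 * (v * n * (C.card : ℝ) ^ 2) := by gcongr
        _ = _ := by rw [hh2]; field_simp
    have hstep : ∀ i, (F y - F (flipAt i y)) ^ 2 ≤
        (2 * (∑ σ ∈ C, a σ i * A σ) ^ 2 + 2 * (C.card * (16 * h ^ 2)) ^ 2) / C.card ^ 2 :=
      fun i => by
        rw [hF]
        simp only
        rw [← sub_div, div_pow]
        gcongr
        exact sq_avg_sub_flip_le C a ha h hh0 k y i
    calc _ ≤ ∑ i, (2 * (∑ σ ∈ C, a σ i * A σ) ^ 2 + 2 * (C.card * (16 * h ^ 2)) ^ 2) /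
          (C.card : ℝ) ^ 2 := Finset.sum_le_sum fun i _ => hstep i
      _ = (2 * (∑ i, (∑ σ ∈ C, a σ i * A σ) ^ 2) + n * (2 * (C.card * (16 * h ^ 2)) ^ 2)) /
          (C.card : ℝ) ^ 2 := by
          rw [← Finset.sum_div, Finset.sum_add_distrib, ← Finset.mul_sum]
          simp
      _ ≤ (2 * (16 * v * (C.card : ℝ) ^ 2) + n * (2 * (C.card * (16 * h ^ 2)) ^ 2)) /
          (C.card : ℝ) ^ 2 := by gcongr
      _ = _ := by rw [hh2]; field_simp; ring
  have hmean : 10 ^ (-13 : ℤ) ≤ 𝔼 y, F y := by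
    have h1 : 𝔼 y, F y = (∑ σ ∈ C,
        𝔼 y : Fin n → Bool, smoothStep (∑ w, (h * a σ w) * spin (y w) - k)) / C.card := by
      rw [hF, ← Finset.expect_div, Finset.expect_sum_comm]
      congr 1
      refine Finset.sum_congr rfl fun σ _ => Finset.expect_congr rfl fun y _ => ?_
      rw [Finset.mul_sum]
      congr 2
      exact Finset.sum_congr rfl fun i _ => by ring
    rw [h1, le_div_iff₀ hcard, mul_comm, ← nsmul_eq_mul]
    refine Finset.card_nsmul_le_sum _ _ _ fun σ hσ => ?_
    have h2 : ∑ w, (h * a σ w) ^ 2 = (∑ w, a σ w ^ 2) / n := by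
      simp only [mul_pow, hh2]
      rw [← Finset.mul_sum]; ring
    refine expect_smoothStep_lower _ k hk ?_ ?_
    · rw [h2, div_le_one hn']
      calc ∑ w, a σ w ^ 2 ≤ ∑ _w : Fin n, (1 : ℝ) := Finset.sum_le_sum fun w _ => by
            rcases ha σ hσ w with h0 | h0 | h0 <;> rw [h0] <;> norm_num
        _ = n := by simp
    · rw [h2, le_div_iff₀ hn']; exact ha2 σ hσ
  have hV0 : 0 < 32 * v + 512 / n := by positivity
  refine le_trans (unifProb_mono fun y hy => ?_) (unifProb_le_expect_sub F _ _ hV0 hgrad)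
  obtain ⟨D, hD, hDc⟩ := hy
  have hD : ((C.filter fun σ => k * Real.sqrt n ≤ ∑ w, a σ w * spin (y w)).card : ℝ) <
      10 ^ (-14 : ℤ) * C.card := by
    refine lt_of_le_of_lt ?_ hDc
    exact_mod_cast Finset.card_le_card fun σ hσ =>
      hD σ (Finset.mem_filter.1 hσ).1 (Finset.mem_filter.1 hσ).2
  have hFle : F y ≤ 2 * 10 ^ (-14 : ℤ) := by
    rw [hF, div_le_iff₀ hcard]
    calc _ ≤ ∑ σ ∈ C, if k * Real.sqrt n ≤ ∑ w, a σ w * spin (y w) then (2 : ℝ) else 0 := by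
          refine Finset.sum_le_sum fun σ _ => ?_
          split_ifs with hg
          · exact smoothStep_le_two _
          · rw [smoothStep_of_nonpos]
            rw [hh, one_div, inv_mul_eq_div, sub_nonpos, div_le_iff₀ hs]
            exact (not_le.1 hg).le
      _ ≤ _ := by
          rw [← Finset.sum_filter, Finset.sum_const, nsmul_eq_mul]
          linarith
  norm_num at hmean hFle ⊢
  linarith

end OneStep

section Sequential

lemma expect_fin_cons {R : Type*} [Fintype R] {k : ℕ} (f : (Fin (k + 1) → R) → ℝ) :
    𝔼 x, f x = 𝔼 y : R, 𝔼 x : Fin k → R, f (Fin.cons y x) := by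
  rw [← Fintype.expect_equiv (Fin.consEquiv (fun _ : Fin (k + 1) => R))
    (fun p => f (Fin.cons p.1 p.2)) f (fun p => rfl)]
  rw [← Finset.univ_product_univ, Finset.expect_product]

/-- Exposing independent rows one at a time and keeping the good part of the family whenever it
is large, few rows are skipped. -/
lemma exists_sequential_filter {ι R : Type*} [Fintype R] [Nonempty R] (p q θ : ℝ) (hp : 0 < p)
    (hp1 : p ≤ 1) (hθ : 1 ≤ θ) : ∀ (k : ℕ) (good : Fin k → ι → R → Prop) (C : Finset ι),
    (∀ j, ∀ D ⊆ C, p ^ k * C.card ≤ D.card → unifProb (fun y : R =>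
      ∃ E : Finset ι, (∀ σ ∈ D, good j σ y → σ ∈ E) ∧ (E.card : ℝ) < p * D.card) ≤ q) →
    ∃ (J : (Fin k → R) → Finset (Fin k)) (F : (Fin k → R) → Finset ι),
      (∀ ys, F ys ⊆ C ∧ p ^ k * C.card ≤ (F ys).card ∧
        ∀ j, j ∉ J ys → ∀ σ ∈ F ys, good j σ (ys j)) ∧
      𝔼 ys, θ ^ (J ys).card ≤ (1 + θ * q) ^ k
  | 0, good, C, h => by
    refine ⟨fun _ => ∅, fun _ => C, fun ys => ⟨le_rfl, by simp, fun j => j.elim0⟩, by simp⟩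
  | k + 1, good, C, h => by
    classical
    have hrec : ∀ D ⊆ C, p * C.card ≤ D.card → _ := fun D hD hDc =>
      exists_sequential_filter p q θ hp hp1 hθ k (fun j => good j.succ) D
        (fun j D' hD' hD'c => h j.succ D' (hD'.trans hD) (by
          rw [pow_succ, mul_assoc]
          exact le_trans (by gcongr) hD'c))
    choose! J F hJF hexp using hrec
    let bad : R → Prop := fun y =>
      ∃ E : Finset ι, (∀ σ ∈ C, good 0 σ y → σ ∈ E) ∧ (E.card : ℝ) < p * C.card
    let D : R → Finset ι := fun y => if bad y then C else C.filter fun σ => good 0 σ y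
    have hC : p * C.card ≤ C.card := mul_le_of_le_one_left (Nat.cast_nonneg _) hp1
    have hDs : ∀ y, D y ⊆ C := fun y => by
      simp only [D]; split_ifs
      · exact le_rfl
      · exact Finset.filter_subset _ _
    have hDc : ∀ y, p * C.card ≤ (D y).card := fun y => by
      simp only [D]; split_ifs with hb
      · exact hC
      · simp only [bad] at hb
        push Not at hb
        exact hb _ fun σ hσ h => Finset.mem_filter.2 ⟨hσ, h⟩
    have hbad : unifProb bad ≤ q := h 0 C le_rfl (by
      have : p ^ (k + 1) ≤ 1 := pow_le_one₀ hp.le hp1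
      exact mul_le_of_le_one_left (Nat.cast_nonneg _) this)
    refine ⟨fun ys => (if bad (ys 0) then {0} else ∅) ∪
        (J (D (ys 0)) (Fin.tail ys)).map (Fin.succEmb k),
      fun ys => F (D (ys 0)) (Fin.tail ys), fun ys => ?_, ?_⟩
    · obtain ⟨h1, h2, h3⟩ := hJF (D (ys 0)) (hDs _) (hDc _) (Fin.tail ys)
      refine ⟨h1.trans (hDs _), ?_, fun j => ?_⟩
      · refine le_trans ?_ h2
        rw [pow_succ, mul_assoc]
        have := hDc (ys 0)
        gcongr
      · refine Fin.cases (fun hj σ hσ => ?_) (fun j hj σ hσ => ?_) j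
        · have hb : ¬ bad (ys 0) := fun hb => hj (by simp [hb])
          have := h1 hσ
          simp only [D, if_neg hb, Finset.mem_filter] at this
          exact this.2
        · exact h3 j (fun hj' => hj (Finset.mem_union_right _ (by simpa using hj'))) σ hσ
    · rw [expect_fin_cons]
      simp only [Fin.cons_zero, Fin.tail_cons]
      have hθ0 : 0 ≤ θ := by linarith
      calc _ ≤ 𝔼 y : R, 𝔼 x : Fin k → R, (1 + if bad y then θ else 0) *
            θ ^ (J (D y) x).card := by
            refine Finset.expect_le_expect fun y _ => Finset.expect_le_expect fun x _ => ?_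
            have hle : ((if bad y then {0} else ∅) ∪
                (J (D y) x).map (Fin.succEmb k)).card ≤
                (if bad y then 1 else 0) + (J (D y) x).card := by
              refine (Finset.card_union_le _ _).trans ?_
              rw [Finset.card_map]
              split_ifs <;> simp
            refine (pow_le_pow_right₀ hθ hle).trans ?_
            rw [pow_add]
            gcongr
            split_ifs <;> simp
        _ ≤ 𝔼 y : R, (1 + θ * if bad y then 1 else 0) * (1 + θ * q) ^ k := by
            refine Finset.expect_le_expect fun y _ => ?_
            rw [← Finset.mul_expect, mul_ite, mul_one, mul_zero]
            have := hexp (D y) (hDs y) (hDc y)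
            have : (0 : ℝ) ≤ 1 + if bad y then θ else 0 := by split_ifs <;> linarith
            gcongr
        _ = (1 + θ * unifProb bad) * (1 + θ * q) ^ k := by
            have : (𝔼 y : R, if bad y then (1 : ℝ) else 0) = unifProb bad :=
              Finset.expect_congr rfl fun y _ => by congr
            rw [← Finset.expect_mul, Finset.expect_add_distrib, ← Finset.mul_expect, this]
            simp
        _ ≤ _ := by
            have hq : 0 ≤ q := (unifProb_nonneg _).trans hbad
            rw [pow_succ']
            gcongr

lemma unifProb_sequential_le {ι R : Type*} [Fintype R] [Nonempty R] (p q : ℝ) (hp : 0 < p)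
    (hp1 : p ≤ 1) (hq : 0 < q) (hq1 : q ≤ 1) (k m : ℕ) (good : Fin k → ι → R → Prop) (C : Finset ι)
    (h : ∀ j, ∀ D ⊆ C, p ^ k * C.card ≤ D.card → unifProb (fun y : R =>
      ∃ E : Finset ι, (∀ σ ∈ D, good j σ y → σ ∈ E) ∧ (E.card : ℝ) < p * D.card) ≤ q) :
    unifProb (fun ys : Fin k → R => ¬ ∃ (J : Finset (Fin k)) (F : Finset ι), J.card ≤ m ∧ F ⊆ C ∧
      p ^ k * C.card ≤ F.card ∧ ∀ j, j ∉ J → ∀ σ ∈ F, good j σ (ys j)) ≤ 2 ^ k * q ^ (m + 1) := by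
  obtain ⟨J, F, h1, h2⟩ := exists_sequential_filter p q q⁻¹ hp hp1
    ((one_le_inv₀ hq).2 hq1) k good C h
  have hθ : 1 ≤ q⁻¹ := (one_le_inv₀ hq).2 hq1
  calc _ ≤ 𝔼 ys, q ^ (m + 1) * q⁻¹ ^ (J ys).card := by
        refine unifProb_le_expect (fun ys => by positivity) fun ys hys => ?_
        have hm : m + 1 ≤ (J ys).card := by
          by_contra hlt
          exact hys ⟨J ys, F ys, by omega, (h1 ys).1, (h1 ys).2.1, (h1 ys).2.2⟩
        calc (1 : ℝ) = q ^ (m + 1) * q⁻¹ ^ (m + 1) := by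
              rw [← mul_pow, mul_inv_cancel₀ hq.ne', one_pow]
          _ ≤ _ := by gcongr
    _ ≤ q ^ (m + 1) * (1 + q⁻¹ * q) ^ k := by
        rw [← Finset.mul_expect]; gcongr
    _ = _ := by rw [inv_mul_cancel₀ hq.ne']; norm_num; ring

end Sequential

section Resampling

/-- Exchanging part of a function with a function on a smaller index set. -/
noncomputable def exchangeEquiv {I J R : Type*} (o : I → J) (ho : Function.Injective o) :
    (J → R) × (I → R) ≃ (J → R) × (I → R) where
  toFun p := (Function.extend o p.2 p.1, p.1 ∘ o)
  invFun p := (Function.extend o p.2 p.1, p.1 ∘ o)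
  left_inv p := by
    refine Prod.ext ?_ ?_
    · funext j
      by_cases hj : ∃ i, o i = j
      · obtain ⟨i, rfl⟩ := hj
        simp [ho.extend_apply]
      · simp [Function.extend_apply' _ _ _ hj]
    · funext i
      simp [ho.extend_apply]
  right_inv p := by
    refine Prod.ext ?_ ?_
    · funext j
      by_cases hj : ∃ i, o i = j
      · obtain ⟨i, rfl⟩ := hj
        simp [ho.extend_apply]
      · simp [Function.extend_apply' _ _ _ hj]
    · funext i
      simp [ho.extend_apply]

variable {I J R : Type*} [Fintype I] [Fintype J] [Fintype R] [DecidableEq I] [DecidableEq J]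
  [Nonempty R]

lemma expect_extend (o : I → J) (ho : Function.Injective o) (f : (J → R) → ℝ) :
    𝔼 z : J → R, 𝔼 y : I → R, f (Function.extend o y z) = 𝔼 z, f z := by
  have h : 𝔼 p : (J → R) × (I → R), f (Function.extend o p.2 p.1)
      = 𝔼 p : (J → R) × (I → R), f p.1 :=
    Fintype.expect_equiv (exchangeEquiv o ho) _ _ fun p => rfl
  rw [← Finset.univ_product_univ, Finset.expect_product, Finset.expect_product] at h
  simpa using h

lemma expect_comp_injective (o : I → J) (ho : Function.Injective o) (f : (I → R) → ℝ) :
    𝔼 z : J → R, f (z ∘ o) = 𝔼 y, f y := by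
  have h : 𝔼 p : (J → R) × (I → R), f (p.1 ∘ o) = 𝔼 p : (J → R) × (I → R), f p.2 :=
    Fintype.expect_equiv (exchangeEquiv o ho) _ _ fun p => rfl
  rw [← Finset.univ_product_univ, Finset.expect_product, Finset.expect_product] at h
  simpa using h

end Resampling

section Signs

/-- The potential edges of a graph on `Fin n`, as increasing pairs. -/
abbrev EdgeIdx (n : ℕ) := {p : Fin n × Fin n // p.1 < p.2}

variable {n : ℕ}

/-- The symmetric `±1` matrix (with zero diagonal) of an edge configuration. -/
def edgeSign (x : EdgeIdx n → Bool) (v w : Fin n) : ℝ :=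
  if h : v < w then spin (x ⟨(v, w), h⟩) else if h : w < v then spin (x ⟨(w, v), h⟩) else 0

lemma edgeSign_comm (x : EdgeIdx n → Bool) (v w : Fin n) : edgeSign x v w = edgeSign x w v := by
  unfold edgeSign
  rcases lt_trichotomy v w with h | h | h
  · simp [h, h.not_gt]
  · subst h; simp
  · simp [h, h.not_gt]

/-- The (signed) contribution of the vertices of `U` to the friendliness of `v`. -/
noncomputable def rowOn (x : EdgeIdx n → Bool) (U : Finset (Fin n)) (σ : Fin n → Bool)
    (v : Fin n) : ℝ :=
  spin (σ v) * ∑ w ∈ U, edgeSign x v w * spin (σ w)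

lemma rowOn_add_compl (x : EdgeIdx n → Bool) (K : Finset (Fin n)) (σ : Fin n → Bool) (v : Fin n) :
    rowOn x K σ v + rowOn x Kᶜ σ v = rowOn x Finset.univ σ v := by
  rw [rowOn, rowOn, rowOn, ← mul_add, Finset.sum_add_sum_compl]

/-- The overlap of two sign vectors. -/
noncomputable def overlap (σ τ : Fin n → Bool) : ℝ := ∑ w, spin (σ w) * spin (τ w)

open Classical in
/-- The number of ordered pairs with overlap exceeding `d`. -/
noncomputable def badPairs (d : ℝ) (C : Finset (Fin n → Bool)) : ℕ :=
  ((C ×ˢ C).filter fun p => d < |overlap p.1 p.2|).card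

lemma badPairs_mono (d : ℝ) {C D : Finset (Fin n → Bool)} (h : D ⊆ C) :
    badPairs d D ≤ badPairs d C :=
  Finset.card_le_card (Finset.filter_subset_filter _ (Finset.product_subset_product h h))

open Classical in
/-- The sign vectors in `G` with prescribed values on `K` whose rows outside `K ∪ J` are at
least `T`, using only edges outside `K`. -/
noncomputable def outerFamily (x : EdgeIdx n → Bool) (G : Finset (Fin n → Bool))
    (K P J : Finset (Fin n)) (T : ℝ) : Finset (Fin n → Bool) :=
  G.filter fun σ => (∀ v ∈ K, (σ v = true ↔ v ∈ P)) ∧ ∀ v, v ∉ K → v ∉ J → T ≤ rowOn x Kᶜ σ v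

/-- Each edge between `K` and its complement is read from the row of its endpoint in `K`. -/
def orientTo (K : Finset (Fin n)) (e : EdgeIdx n) : Fin n × Fin n :=
  if e.1.2 ∈ K ∧ e.1.1 ∉ K then (e.1.2, e.1.1) else e.1

lemma orientTo_injective (K : Finset (Fin n)) : Function.Injective (orientTo K) := by
  rintro ⟨⟨a, b⟩, h⟩ ⟨⟨c, d⟩, h'⟩ heq
  simp only [orientTo] at heq
  simp only [Subtype.mk.injEq]
  split_ifs at heq with h1 h2 h2
  · simp only [Prod.mk.injEq] at heq ⊢; exact ⟨heq.2, heq.1⟩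
  · simp only [Prod.mk.injEq] at heq
    exact absurd (h'.trans (heq.1 ▸ heq.2 ▸ h)) (lt_irrefl _)
  · simp only [Prod.mk.injEq] at heq
    exact absurd (h.trans (heq.1 ▸ heq.2 ▸ h')) (lt_irrefl _)
  · exact heq

/-- The edge configuration read off a matrix of bits. -/
def ofRows (K : Finset (Fin n)) (M : Fin n → Fin n → Bool) : EdgeIdx n → Bool :=
  fun e => M (orientTo K e).1 (orientTo K e).2

lemma expect_ofRows (K : Finset (Fin n)) (f : (EdgeIdx n → Bool) → ℝ) :
    𝔼 M, f (ofRows K M) = 𝔼 x, f x := by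
  rw [← expect_comp_injective (orientTo K) (orientTo_injective K) f]
  exact Fintype.expect_equiv (Equiv.curry _ _ _).symm _ _ fun M => rfl

lemma edgeSign_ofRows_of_mem (K : Finset (Fin n)) (M : Fin n → Fin n → Bool) {v w : Fin n}
    (hv : v ∈ K) (hw : w ∉ K) : edgeSign (ofRows K M) v w = spin (M v w) := by
  have hne : v ≠ w := fun h => hw (h ▸ hv)
  unfold edgeSign ofRows orientTo
  rcases lt_or_gt_of_ne hne with h | h
  · simp [h, hw]
  · simp [h, h.not_gt, hv, hw]

lemma edgeSign_ofRows_congr (K : Finset (Fin n)) {M M' : Fin n → Fin n → Bool}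
    (hM : ∀ v, v ∉ K → M v = M' v) {v w : Fin n} (hv : v ∉ K) (hw : w ∉ K) :
    edgeSign (ofRows K M) v w = edgeSign (ofRows K M') v w := by
  unfold edgeSign ofRows orientTo
  simp [hv, hw, hM v hv, hM w hw]

lemma outerFamily_ofRows_congr (K : Finset (Fin n)) {M M' : Fin n → Fin n → Bool}
    (hM : ∀ v, v ∉ K → M v = M' v) (G : Finset (Fin n → Bool)) (P J : Finset (Fin n)) (T : ℝ) :
    outerFamily (ofRows K M) G K P J T = outerFamily (ofRows K M') G K P J T := by
  unfold outerFamily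
  refine Finset.filter_congr fun σ _ => ?_
  refine and_congr Iff.rfl (forall_congr' fun v => forall_congr' fun hv => ?_)
  have : rowOn (ofRows K M) Kᶜ σ v = rowOn (ofRows K M') Kᶜ σ v := by
    unfold rowOn
    congr 1
    exact Finset.sum_congr rfl fun w hw => by
      rw [edgeSign_ofRows_congr K hM hv (Finset.mem_compl.1 hw)]
  rw [this]

end Signs

section Extension

variable {n : ℕ}

lemma abs_sum_compl_le (K : Finset (Fin n)) (σ τ : Fin n → Bool) :
    |∑ w ∈ Kᶜ, spin (σ w) * spin (τ w)| ≤ |overlap σ τ| + K.card := by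
  have h : ∑ w ∈ Kᶜ, spin (σ w) * spin (τ w) = overlap σ τ - ∑ w ∈ K, spin (σ w) * spin (τ w) := by
    rw [overlap, ← Finset.sum_add_sum_compl K]; ring
  have h2 : |∑ w ∈ K, spin (σ w) * spin (τ w)| ≤ K.card := by
    refine (Finset.abs_sum_le_sum_abs _ _).trans (le_of_eq ?_)
    simp [abs_mul, abs_spin]
  rw [h]
  exact (abs_sub _ _).trans (by linarith)

lemma abs_sum_compl_le_card (K : Finset (Fin n)) (σ τ : Fin n → Bool) :
    |∑ w ∈ Kᶜ, spin (σ w) * spin (τ w)| ≤ n := by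
  refine (Finset.abs_sum_le_sum_abs _ _).trans ?_
  simp only [abs_mul, abs_spin, mul_one, Finset.sum_const, nsmul_eq_mul]
  exact_mod_cast (Finset.card_le_univ _).trans (by simp)

lemma sum_overlap_compl_le (K : Finset (Fin n)) (D : Finset (Fin n → Bool)) (d : ℝ) (hd : 0 ≤ d) :
    ∑ σ ∈ D, ∑ τ ∈ D, |∑ w ∈ Kᶜ, spin (σ w) * spin (τ w)| ≤
      (d + K.card) * (D.card : ℝ) ^ 2 + n * badPairs d D := by
  classical
  rw [← Finset.sum_product']
  have h : ∀ p ∈ D ×ˢ D, |∑ w ∈ Kᶜ, spin (p.1 w) * spin (p.2 w)| ≤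
      (d + K.card) + if d < |overlap p.1 p.2| then (n : ℝ) else 0 := by
    intro p _
    split_ifs with hp
    · have := abs_sum_compl_le_card K p.1 p.2
      have : (0 : ℝ) ≤ K.card := Nat.cast_nonneg _
      linarith
    · have := abs_sum_compl_le K p.1 p.2
      linarith
  refine (Finset.sum_le_sum h).trans (le_of_eq ?_)
  rw [Finset.sum_add_distrib, ← Finset.sum_filter]
  simp only [Finset.sum_const, Finset.card_product, nsmul_eq_mul, badPairs]
  push_cast
  have : (Finset.filter (fun p : (Fin n → Bool) × (Fin n → Bool) => d < |overlap p.1 p.2|)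
    (D ×ˢ D)).card = badPairs d D := by unfold badPairs; congr
  rw [this]
  ring

/-- The coefficients of a row of a vertex `v` restricted to the complement of `K`. -/
noncomputable def rowCoeff (K : Finset (Fin n)) (v : Fin n) (σ : Fin n → Bool) (w : Fin n) : ℝ :=
  if w ∈ K then 0 else spin (σ v) * spin (σ w)

lemma rowCoeff_mem (K : Finset (Fin n)) (v : Fin n) (σ : Fin n → Bool) (w : Fin n) :
    rowCoeff K v σ w = 0 ∨ rowCoeff K v σ w = 1 ∨ rowCoeff K v σ w = -1 := by
  unfold rowCoeff
  split_ifs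
  · simp
  · rcases spin_eq_or (σ v) with h | h <;> rcases spin_eq_or (σ w) with h' | h' <;> simp [h, h']

lemma sum_rowCoeff_sq (K : Finset (Fin n)) (v : Fin n) (σ : Fin n → Bool) :
    ∑ w, rowCoeff K v σ w ^ 2 = n - K.card := by
  rw [← Finset.sum_add_sum_compl K]
  have h1 : ∑ w ∈ K, rowCoeff K v σ w ^ 2 = 0 :=
    Finset.sum_eq_zero fun w hw => by simp [rowCoeff, hw]
  have h2 : ∑ w ∈ Kᶜ, rowCoeff K v σ w ^ 2 = ∑ w ∈ Kᶜ, 1 :=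
    Finset.sum_congr rfl fun w hw => by
      simp [rowCoeff, Finset.mem_compl.1 hw, mul_pow, spin_sq]
  rw [h1, h2, zero_add, Finset.sum_const, Finset.card_compl, Fintype.card_fin, nsmul_eq_mul,
    mul_one, Nat.cast_sub ((Finset.card_le_univ K).trans (by simp))]

lemma abs_sum_rowCoeff (K : Finset (Fin n)) (v : Fin n) (σ τ : Fin n → Bool) :
    |∑ w, rowCoeff K v σ w * rowCoeff K v τ w| = |∑ w ∈ Kᶜ, spin (σ w) * spin (τ w)| := by
  rw [← Finset.sum_add_sum_compl K]
  have h1 : ∑ w ∈ K, rowCoeff K v σ w * rowCoeff K v τ w = 0 :=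
    Finset.sum_eq_zero fun w hw => by simp [rowCoeff, hw]
  have h2 : ∑ w ∈ Kᶜ, rowCoeff K v σ w * rowCoeff K v τ w =
      (spin (σ v) * spin (τ v)) * ∑ w ∈ Kᶜ, spin (σ w) * spin (τ w) := by
    rw [Finset.mul_sum]
    exact Finset.sum_congr rfl fun w hw => by
      simp [rowCoeff, Finset.mem_compl.1 hw]; ring
  rw [h1, h2, zero_add, abs_mul, abs_mul, abs_spin, abs_spin, one_mul, one_mul]

lemma sum_rowCoeff_mul_spin (K : Finset (Fin n)) (M : Fin n → Fin n → Bool) {v : Fin n}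
    (hv : v ∈ K) (σ : Fin n → Bool) :
    ∑ w, rowCoeff K v σ w * spin (M v w) = rowOn (ofRows K M) Kᶜ σ v := by
  rw [← Finset.sum_add_sum_compl K, rowOn, Finset.mul_sum]
  rw [Finset.sum_eq_zero fun w hw => by simp [rowCoeff, hw], zero_add]
  refine Finset.sum_congr rfl fun w hw => ?_
  have hw := Finset.mem_compl.1 hw
  rw [edgeSign_ofRows_of_mem K M hv hw]
  simp [rowCoeff, hw]; ring

lemma unifProb_eq_of_expect {α β : Type*} [Fintype α] [Fintype β] {p : α → Prop} (g : β → α)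
    (h : ∀ f : α → ℝ, 𝔼 y, f (g y) = 𝔼 x, f x) : unifProb p = unifProb fun y => p (g y) :=
  (h _).symm

/-- `x` has a family of sign vectors of small bad ratio whose rows outside `K ∪ J` are large. -/
def HasFamily (x : EdgeIdx n → Bool) (G : Finset (Fin n → Bool)) (K P J : Finset (Fin n))
    (T d b : ℝ) : Prop :=
  ∃ B ⊆ outerFamily x G K P J T, B.Nonempty ∧ (badPairs d B : ℝ) ≤ b * (B.card : ℝ) ^ 2

/-- The family can be thinned such that most rows of `K` become large. -/
def HasThinning (x : EdgeIdx n → Bool) (G : Finset (Fin n → Bool)) (K P J : Finset (Fin n))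
    (T d b U : ℝ) : Prop :=
  ∃ K' ⊆ K, 4 * K'.card ≤ K.card ∧ ∃ C ⊆ outerFamily x G K P J T, C.Nonempty ∧
    (badPairs d C : ℝ) ≤ b * (C.card : ℝ) ^ 2 ∧
    ∀ v ∈ K, v ∉ K' → ∀ σ ∈ C, U ≤ rowOn x Kᶜ σ v

lemma unifProb_no_thinning_le (hn : 0 < n) (G : Finset (Fin n → Bool)) (K P J : Finset (Fin n))
    (T δ b κ q : ℝ) (hδ : 0 ≤ δ) (hκ : κ ≤ 0.8) (hK : (K.card : ℝ) ≤ 0.05 * n) (hb0 : 0 ≤ b)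
    (hb : b * ((10 ^ 14) ^ K.card) ^ 2 ≤ 1 / n) (hq0 : 0 < q) (hq1 : q ≤ 1)
    (hq : Real.exp (1 / 4 - 10 ^ (-14 : ℤ) /
      Real.sqrt (32 * (δ + K.card / n + 1 / n) + 512 / n)) ≤ q) :
    unifProb (fun x => HasFamily x G K P J T (δ * n) b ∧
      ¬ HasThinning x G K P J T (δ * n) (b * ((10 ^ 14) ^ K.card) ^ 2) (κ * Real.sqrt n)) ≤
      2 ^ K.card * q ^ (K.card / 4 + 1) := by
  classical
  have hn' : (0 : ℝ) < n := by exact_mod_cast hn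
  set e := K.orderEmbOfFin rfl with he
  have hemem : ∀ j, e j ∈ K := fun j => K.orderEmbOfFin_mem rfl j
  have hesurj : ∀ v ∈ K, ∃ j, e j = v := fun v hv => by
    have := (Finset.range_orderEmbOfFin K rfl).symm ▸ Finset.mem_coe.2 hv
    exact this
  rw [unifProb_eq_of_expect (ofRows K) (expect_ofRows K), unifProb, ← expect_extend e e.injective]
  have hrhs : (0 : ℝ) ≤ 2 ^ K.card * q ^ (K.card / 4 + 1) := by positivity
  refine Finset.expect_le Finset.univ_nonempty fun z _ => ?_
  change unifProb (fun ys : Fin K.card → Fin n → Bool => _) ≤ _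
  have hrow : ∀ ys : Fin K.card → Fin n → Bool, ∀ j, Function.extend e ys z (e j) = ys j :=
    fun ys j => e.injective.extend_apply _ _ _
  have hout : ∀ ys : Fin K.card → Fin n → Bool,
      outerFamily (ofRows K (Function.extend e ys z)) G K P J T =
      outerFamily (ofRows K z) G K P J T := fun ys =>
    outerFamily_ofRows_congr K (fun v hv => Function.extend_apply' _ _ _
      fun ⟨j, hj⟩ => hv (hj ▸ hemem j)) _ _ _ _
  by_cases hB : HasFamily (ofRows K z) G K P J T (δ * n) b
  swap
  · refine le_trans (le_of_eq ?_) hrhs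
    unfold unifProb
    refine (Finset.expect_congr rfl fun ys _ => ?_).trans (Finset.expect_const_zero _)
    rw [if_neg]
    rintro ⟨h, -⟩
    exact hB (by unfold HasFamily at h ⊢; rwa [hout] at h)
  obtain ⟨B, hBA, hBne, hBbad⟩ := hB
  have hBpos : (0 : ℝ) < B.card := by exact_mod_cast hBne.card_pos
  have hpow : ∀ D : Finset (Fin n → Bool),
      ((10 : ℝ) ^ (-14 : ℤ)) ^ K.card * B.card ≤ D.card →
      (B.card : ℝ) ≤ (10 ^ 14) ^ K.card * D.card := fun D hD => by
    have h1 : ((10 : ℝ) ^ 14) ^ K.card * ((10 : ℝ) ^ (-14 : ℤ)) ^ K.card = 1 := by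
      rw [← mul_pow]; norm_num
    calc (B.card : ℝ) = (10 ^ 14) ^ K.card * (((10 : ℝ) ^ (-14 : ℤ)) ^ K.card * B.card) := by
          rw [← mul_assoc, h1, one_mul]
      _ ≤ _ := by gcongr
  have hbadD : ∀ D ⊆ B, ((10 : ℝ) ^ (-14 : ℤ)) ^ K.card * B.card ≤ D.card →
      (badPairs (δ * n) D : ℝ) ≤ b * ((10 ^ 14) ^ K.card) ^ 2 * (D.card : ℝ) ^ 2 :=
    fun D hD hc => by
      have h1 : (badPairs (δ * n) D : ℝ) ≤ badPairs (δ * n) B := by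
        exact_mod_cast badPairs_mono _ hD
      calc (badPairs (δ * n) D : ℝ) ≤ b * (B.card : ℝ) ^ 2 := h1.trans hBbad
        _ ≤ b * ((10 ^ 14) ^ K.card * D.card) ^ 2 := by gcongr; exact hpow D hc
        _ = _ := by ring
  have key := unifProb_sequential_le (ι := Fin n → Bool) (R := Fin n → Bool)
    (10 ^ (-14 : ℤ)) q (by norm_num) (by norm_num) hq0 hq1 K.card (K.card / 4)
    (fun j σ y => κ * Real.sqrt n ≤ ∑ w, rowCoeff K (e j) σ w * spin (y w)) B ?_
  · refine le_trans (unifProb_mono fun ys => ?_) key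
    rintro ⟨-, h⟩ ⟨J', F, hJ', hF, hFc, hgood⟩
    refine h ⟨J'.map e.toEmbedding, ?_, ?_, F, ?_, ?_, hbadD F hF hFc, ?_⟩
    · intro v hv
      obtain ⟨j, -, rfl⟩ := Finset.mem_map.1 hv
      exact hemem j
    · rw [Finset.card_map]; omega
    · rw [hout]; exact hF.trans hBA
    · rw [← Finset.card_pos, ← Nat.cast_pos (α := ℝ)]
      exact lt_of_lt_of_le (by positivity) hFc
    · intro v hv hvK σ hσ
      obtain ⟨j, rfl⟩ := hesurj v hv
      have := hgood j (fun hj => hvK (Finset.mem_map_of_mem _ hj)) σ hσ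
      rwa [← sum_rowCoeff_mul_spin K _ (hemem j), hrow]
  · intro j D hD hDc
    have hDpos : (0 : ℝ) < D.card := lt_of_lt_of_le (by positivity) hDc
    have hDne : D.Nonempty := by
      rw [← Finset.card_pos]; exact_mod_cast hDpos
    refine le_trans (unifProb_few_good_le D hDne (rowCoeff K (e j)) hn
      (fun σ _ w => rowCoeff_mem _ _ _ _) (fun σ _ => ?_) κ (δ + K.card / n + 1 / n) hκ
      (by positivity) ?_) hq
    · rw [sum_rowCoeff_sq]; linarith
    · simp only [abs_sum_rowCoeff]
      refine (sum_overlap_compl_le K D (δ * n) (by positivity)).trans ?_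
      have h1 := hbadD D hD hDc
      have h2 : (n : ℝ) * badPairs (δ * n) D ≤ 1 * (D.card : ℝ) ^ 2 := by
        calc (n : ℝ) * badPairs (δ * n) D ≤
            n * (b * ((10 ^ 14) ^ K.card) ^ 2 * (D.card : ℝ) ^ 2) := by gcongr
          _ ≤ n * (1 / n * (D.card : ℝ) ^ 2) := by gcongr
          _ = _ := by field_simp
      have h3 : (δ + K.card / n + 1 / n) * n * (D.card : ℝ) ^ 2 =
          (δ * n + K.card) * (D.card : ℝ) ^ 2 + 1 * (D.card : ℝ) ^ 2 := by
        field_simp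
      rw [h3]; linarith

end Extension

section Counting

/-- The vertex sets of size at most `k`. -/
def smallSets (n k : ℕ) : Finset (Finset (Fin n)) := Finset.univ.filter fun S => S.card ≤ k

lemma mem_smallSets {n k : ℕ} {S : Finset (Fin n)} : S ∈ smallSets n k ↔ S.card ≤ k := by
  simp [smallSets]

lemma card_smallSets_le (n k : ℕ) : (smallSets n k).card ≤ (n + 1) ^ k := by
  rw [add_pow, Finset.card_eq_sum_card_fiberwise (f := Finset.card) (t := Finset.range (k + 1))
    fun S hS => by simpa [Nat.lt_succ_iff] using mem_smallSets.1 hS]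
  refine Finset.sum_le_sum fun i hi => ?_
  have h1 : ((smallSets n k).filter fun S => S.card = i).card ≤ n.choose i := by
    refine le_trans (Finset.card_le_card (t := Finset.powersetCard i Finset.univ) fun S hS => ?_)
      (le_of_eq ?_)
    · simpa [Finset.mem_powersetCard] using (Finset.mem_filter.1 hS).2
    · simp
  have h2 : 1 ≤ k.choose i := Nat.choose_pos (Nat.lt_succ_iff.1 (Finset.mem_range.1 hi))
  have h3 : n.choose i ≤ n ^ i := Nat.choose_le_pow n i
  simpa using h1.trans (h3.trans (Nat.le_mul_of_pos_right _ h2))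

lemma card_smallSets_le_real (n k : ℕ) : ((smallSets n k).card : ℝ) ≤ ((n : ℝ) + 1) ^ k := by
  exact_mod_cast card_smallSets_le n k

end Counting

section Discrepancy

variable {n : ℕ}

lemma sum_sum_eq_sum_edge (f : Fin n → Fin n → ℝ) :
    ∑ v, ∑ w, f v w = ∑ e : EdgeIdx n, (f e.1.1 e.1.2 + f e.1.2 e.1.1) + ∑ v, f v v := by
  have key : ∀ g : Fin n → Fin n → ℝ, ∑ v, ∑ w, (if v < w then g v w else 0) =
      ∑ e : EdgeIdx n, g e.1.1 e.1.2 := by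
    intro g
    rw [← Fintype.sum_prod_type' (f := fun v w => if v < w then g v w else 0), ← Finset.sum_filter]
    exact (Finset.sum_subtype _ (by simp) fun p : Fin n × Fin n => g p.1 p.2)
  have h1 : ∀ v w, f v w = (if v < w then f v w else 0) + (if w < v then f v w else 0) +
      if v = w then f v w else 0 := by
    intro v w
    rcases lt_trichotomy v w with h | h | h
    · simp [h, h.not_gt, h.ne]
    · subst h; simp
    · simp [h, h.not_gt, h.ne']
  rw [Finset.sum_congr rfl fun v _ => Finset.sum_congr rfl fun w _ => h1 v w]
  simp_rw [Finset.sum_add_distrib]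
  rw [key f, Finset.sum_comm (f := fun v w => if w < v then f v w else 0),
    key fun v w => f w v]
  simp

lemma edgeSign_of_lt (x : EdgeIdx n → Bool) (e : EdgeIdx n) :
    edgeSign x e.1.1 e.1.2 = spin (x e) := by
  simp [edgeSign, e.2]

lemma edgeSign_self (x : EdgeIdx n → Bool) (v : Fin n) : edgeSign x v v = 0 := by
  simp [edgeSign]

lemma sum_bilinear_edgeSign (x : EdgeIdx n → Bool) (a b : Fin n → ℝ) :
    ∑ v, a v * ∑ w, edgeSign x v w * b w =
      ∑ e : EdgeIdx n, (a e.1.1 * b e.1.2 + a e.1.2 * b e.1.1) * spin (x e) := by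
  simp_rw [Finset.mul_sum]
  rw [sum_sum_eq_sum_edge]
  simp only [edgeSign_self, zero_mul, mul_zero, Finset.sum_const_zero, add_zero]
  refine Finset.sum_congr rfl fun e _ => ?_
  rw [edgeSign_comm x e.1.2, edgeSign_of_lt]
  ring

lemma sum_sq_bilinear_le (a b : Fin n → ℝ) :
    ∑ e : EdgeIdx n, (a e.1.1 * b e.1.2 + a e.1.2 * b e.1.1) ^ 2 ≤
      2 * ((∑ v, a v ^ 2) * ∑ w, b w ^ 2) := by
  have h : (∑ v, a v ^ 2) * ∑ w, b w ^ 2 = ∑ v, ∑ w, a v ^ 2 * b w ^ 2 := Finset.sum_mul_sum _ _ _ _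
  rw [h, sum_sum_eq_sum_edge, mul_add, Finset.mul_sum]
  have h0 : 0 ≤ ∑ v, a v ^ 2 * b v ^ 2 := Finset.sum_nonneg fun v _ => by positivity
  have h1 : ∑ e : EdgeIdx n, (a e.1.1 * b e.1.2 + a e.1.2 * b e.1.1) ^ 2 ≤
      ∑ e : EdgeIdx n, 2 * (a e.1.1 ^ 2 * b e.1.2 ^ 2 + a e.1.2 ^ 2 * b e.1.1 ^ 2) :=
    Finset.sum_le_sum fun e _ => by
      nlinarith [sq_nonneg (a e.1.1 * b e.1.2 - a e.1.2 * b e.1.1)]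
  linarith

/-- A uniform bound on the upper tail of a bilinear form in the edge signs. -/
lemma unifProb_bilinear_ge_le (a b : Fin n → ℝ) (r W : ℝ) (hr : 0 ≤ r) (hW : 0 < W)
    (h : (∑ v, a v ^ 2) * ∑ w, b w ^ 2 ≤ W) :
    unifProb (fun x : EdgeIdx n → Bool => r ≤ ∑ v, a v * ∑ w, edgeSign x v w * b w) ≤
      Real.exp (-(r ^ 2 / (4 * W))) := by
  simp_rw [sum_bilinear_edgeSign]
  have hl : 0 ≤ r / (2 * W) := by positivity
  refine (unifProb_ge_le_exp _ (r / (2 * W)) r hl).trans ?_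
  simp_rw [Finset.mul_sum, ← mul_assoc]
  refine (mul_le_mul_of_nonneg_left (expect_exp_linear_le _) (Real.exp_nonneg _)).trans ?_
  rw [← Real.exp_add]
  refine Real.exp_le_exp.2 ?_
  simp_rw [mul_pow _ _ 2, ← Finset.mul_sum]
  have h1 := (sum_sq_bilinear_le a b).trans (mul_le_mul_of_nonneg_left h zero_le_two)
  have h2 : (r / (2 * W)) ^ 2 * ∑ e : EdgeIdx n, (a e.1.1 * b e.1.2 + a e.1.2 * b e.1.1) ^ 2 ≤
      (r / (2 * W)) ^ 2 * (2 * W) := by gcongr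
  have h3 : -(r / (2 * W) * r) + (r / (2 * W)) ^ 2 * (2 * W) / 2 = -(r ^ 2 / (4 * W)) := by
    field_simp; ring
  linarith

/-- The sign pattern of a set of vertices. -/
noncomputable def patternSign (P : Finset (Fin n)) (w : Fin n) : ℝ := spin (decide (w ∈ P))

open Classical in
/-- The vertices whose signed number of neighbours in `K` is atypical. -/
noncomputable def atypical (x : EdgeIdx n → Bool) (K P : Finset (Fin n)) (d : ℝ) :
    Finset (Fin n) :=
  Finset.univ.filter fun v => d < |∑ w ∈ K, edgeSign x v w * patternSign P w|

/-- All small sets have few atypical vertices. -/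
def SpreadOut (x : EdgeIdx n → Bool) (k : ℕ) (d : ℝ) : Prop :=
  ∀ K P : Finset (Fin n), K.Nonempty → K.card ≤ k → P ⊆ K → 4 * (atypical x K P d).card ≤ K.card

lemma unifProb_many_atypical_le (K P : Finset (Fin n)) (hK : K.Nonempty) (d : ℝ) (hd : 0 ≤ d) :
    unifProb (fun x : EdgeIdx n → Bool => ¬ 4 * (atypical x K P d).card ≤ K.card) ≤
      ((n : ℝ) + 1) ^ K.card * ((n + 1) ^ K.card * Real.exp (-(d ^ 2 / 16))) := by
  classical
  set k := K.card with hk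
  have hkpos : 0 < k := hK.card_pos
  set I := smallSets n k with hI
  have hb : ∀ J ∈ I, ∀ S ∈ I, unifProb (fun x : EdgeIdx n → Bool => J.card = k / 4 + 1 ∧
      (J.card : ℝ) * d ≤ ∑ v, (if v ∈ J then patternSign S v else 0) *
        ∑ w, edgeSign x v w * (if w ∈ K then patternSign P w else 0)) ≤
      Real.exp (-(d ^ 2 / 16)) := by
    intro J _ S _
    by_cases hJ : J.card = k / 4 + 1
    swap
    · simpa [hJ, unifProb] using Real.exp_nonneg _
    have hJpos : (0 : ℝ) < J.card := by rw [hJ]; positivity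
    have hkp : (0 : ℝ) < k := by exact_mod_cast hkpos
    have hJk : (k : ℝ) ≤ 4 * J.card := by exact_mod_cast (by omega : k ≤ 4 * J.card)
    refine (unifProb_mono fun x hx => hx.2).trans ((unifProb_bilinear_ge_le _ _ _
      (J.card * k : ℝ) (by positivity) (by positivity) (le_of_eq ?_)).trans ?_)
    · simp [ite_pow, patternSign, spin_sq, hk]
    · refine Real.exp_le_exp.2 (neg_le_neg ?_)
      rw [div_le_div_iff₀ (by norm_num) (by positivity)]
      have : d ^ 2 * J.card * k ≤ d ^ 2 * J.card * (4 * J.card) := by gcongr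
      nlinarith
  calc unifProb (fun x : EdgeIdx n → Bool => ¬ 4 * (atypical x K P d).card ≤ k)
      ≤ unifProb (fun x : EdgeIdx n → Bool => ∃ J ∈ I, ∃ S ∈ I, J.card = k / 4 + 1 ∧
      (J.card : ℝ) * d ≤ ∑ v, (if v ∈ J then patternSign S v else 0) *
        ∑ w, edgeSign x v w * (if w ∈ K then patternSign P w else 0)) := by
        refine unifProb_mono fun x hx => ?_
        obtain ⟨J, hJ, hJc⟩ := Finset.exists_subset_card_eq
          (by omega : k / 4 + 1 ≤ (atypical x K P d).card)
        have hJk : J.card ≤ k := by omega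
        refine ⟨J, mem_smallSets.2 hJk, J.filter fun v =>
          0 ≤ ∑ w ∈ K, edgeSign x v w * patternSign P w,
          mem_smallSets.2 ((Finset.card_filter_le _ _).trans hJk), hJc, ?_⟩
        simp only [mul_ite, mul_zero, ite_mul, zero_mul, Finset.sum_ite_mem, Finset.univ_inter]
        rw [← nsmul_eq_mul, ← Finset.sum_const]
        refine Finset.sum_le_sum fun v hv => ?_
        have h1 := (Finset.mem_filter.1 (hJ hv)).2.le
        unfold patternSign at h1 ⊢
        by_cases h0 : 0 ≤ ∑ w ∈ K, edgeSign x v w * spin (decide (w ∈ P))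
        · rw [abs_of_nonneg h0] at h1
          simpa [hv, h0] using h1
        · rw [abs_of_neg (not_le.1 h0)] at h1
          simpa [hv, h0] using h1
    _ ≤ ∑ J ∈ I, ∑ S ∈ I, unifProb (fun x : EdgeIdx n → Bool => J.card = k / 4 + 1 ∧
      (J.card : ℝ) * d ≤ ∑ v, (if v ∈ J then patternSign S v else 0) *
        ∑ w, edgeSign x v w * (if w ∈ K then patternSign P w else 0)) :=
      (unifProb_exists_le I _).trans (Finset.sum_le_sum fun J _ => unifProb_exists_le I _)
    _ ≤ ∑ J ∈ I, ∑ S ∈ I, Real.exp (-(d ^ 2 / 16)) :=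
      Finset.sum_le_sum fun J hJ => Finset.sum_le_sum fun S hS => hb J hJ S hS
    _ ≤ _ := by
      rw [Finset.sum_const, Finset.sum_const, nsmul_eq_mul, nsmul_eq_mul]
      have := card_smallSets_le_real n k
      gcongr

lemma unifProb_not_spreadOut_le (k : ℕ) (d : ℝ) (hd : 0 ≤ d) :
    unifProb (fun x : EdgeIdx n → Bool => ¬ SpreadOut x k d) ≤
      ((n : ℝ) + 1) ^ (4 * k) * Real.exp (-(d ^ 2 / 16)) := by
  classical
  have h1 : (1 : ℝ) ≤ n + 1 := by linarith [(Nat.cast_nonneg n : (0 : ℝ) ≤ n)]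
  calc unifProb (fun x : EdgeIdx n → Bool => ¬ SpreadOut x k d)
      ≤ unifProb (fun x : EdgeIdx n → Bool => ∃ K ∈ (smallSets n k).filter Finset.Nonempty,
          ∃ P ∈ smallSets n k, ¬ 4 * (atypical x K P d).card ≤ K.card) := by
        refine unifProb_mono fun x hx => ?_
        unfold SpreadOut at hx
        push Not at hx
        obtain ⟨K, P, hK, hKk, hP, h⟩ := hx
        exact ⟨K, Finset.mem_filter.2 ⟨mem_smallSets.2 hKk, hK⟩, P,
          mem_smallSets.2 ((Finset.card_le_card hP).trans hKk), not_le.2 h⟩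
    _ ≤ ∑ K ∈ (smallSets n k).filter Finset.Nonempty, ∑ P ∈ smallSets n k,
          unifProb (fun x : EdgeIdx n → Bool => ¬ 4 * (atypical x K P d).card ≤ K.card) :=
      (unifProb_exists_le _ _).trans (Finset.sum_le_sum fun J _ => unifProb_exists_le _ _)
    _ ≤ ∑ K ∈ (smallSets n k).filter Finset.Nonempty, ∑ P ∈ smallSets n k,
          ((n : ℝ) + 1) ^ k * ((n + 1) ^ k * Real.exp (-(d ^ 2 / 16))) := by
      refine Finset.sum_le_sum fun K hK => Finset.sum_le_sum fun P _ => ?_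
      obtain ⟨hK, hKne⟩ := Finset.mem_filter.1 hK
      have hKk := mem_smallSets.1 hK
      refine (unifProb_many_atypical_le K P hKne d hd).trans ?_
      gcongr
    _ ≤ ((n : ℝ) + 1) ^ k * (((n : ℝ) + 1) ^ k *
          (((n : ℝ) + 1) ^ k * ((n + 1) ^ k * Real.exp (-(d ^ 2 / 16))))) := by
      rw [Finset.sum_const, Finset.sum_const, nsmul_eq_mul, nsmul_eq_mul]
      have h2 := card_smallSets_le_real n k
      have h3 : (((smallSets n k).filter Finset.Nonempty).card : ℝ) ≤ (n + 1) ^ k :=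
        le_trans (by exact_mod_cast Finset.card_filter_le _ _) h2
      gcongr
    _ = _ := by rw [show 4 * k = k + k + k + k by ring, pow_add, pow_add, pow_add]; ring

end Discrepancy

section Iteration

variable {n : ℕ}

/-- The admissible bad ratio of a family with `k` uncontrolled rows. -/
noncomputable def badRatio (n k : ℕ) : ℝ := ((4 * 10 ^ 28 : ℝ) ^ (2 * k))⁻¹ / n

lemma badRatio_nonneg (n k : ℕ) : 0 ≤ badRatio n k := by unfold badRatio; positivity

lemma four_pow_mul_badRatio (n k : ℕ) :
    4 ^ k * badRatio n k * ((10 ^ 14) ^ k) ^ 2 = ((4 * 10 ^ 28 : ℝ) ^ k)⁻¹ / n := by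
  unfold badRatio
  have h : (4 : ℝ) ^ k * ((10 ^ 14) ^ k) ^ 2 = (4 * 10 ^ 28) ^ k := by
    rw [mul_pow, ← pow_mul, ← pow_mul, ← pow_mul]; congr 2; ring
  rw [two_mul, pow_add, ← h]
  field_simp

lemma four_pow_mul_badRatio_le (n : ℕ) {k k' : ℕ} (h : 2 * k' ≤ k) :
    4 ^ k * badRatio n k * ((10 ^ 14) ^ k) ^ 2 ≤ badRatio n k' := by
  rw [four_pow_mul_badRatio, badRatio]
  gcongr
  norm_num

/-- Every small set of rows can be handled by thinning a good enough family. -/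
def Extendable (x : EdgeIdx n → Bool) (G : Finset (Fin n → Bool)) (k₀ : ℕ) (T : ℕ → ℝ)
    (d U : ℝ) : Prop :=
  ∀ K P J : Finset (Fin n), K.Nonempty → K.card ≤ k₀ → P ⊆ K → J.card ≤ K.card →
    HasFamily x G K P J (T K.card) d (4 ^ K.card * badRatio n K.card) →
    HasThinning x G K P J (T K.card) d
      (4 ^ K.card * badRatio n K.card * ((10 ^ 14) ^ K.card) ^ 2) U

lemma sum_nonempty_pow_card_le (hn : 0 < n) (s : Finset (Finset (Fin n)))
    (hs : ∀ K ∈ s, K.Nonempty) :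
    ∑ K ∈ s, (1 / ((n : ℝ) + 1) ^ 2) ^ K.card ≤ 2 / ((n : ℝ) + 1) := by
  classical
  have hn' : (1 : ℝ) ≤ n := by exact_mod_cast hn
  set y : ℝ := 1 / ((n : ℝ) + 1) ^ 2 with hy
  have hy0 : 0 ≤ y := by positivity
  have h1 : ∑ K : Finset (Fin n), y ^ K.card = (y + 1) ^ n := by
    have := Fintype.sum_pow_mul_eq_add_pow (Fin n) y 1
    simpa using this
  have h2 : ∑ K ∈ s, y ^ K.card + 1 ≤ ∑ K : Finset (Fin n), y ^ K.card := by
    have h3 : (∅ : Finset (Fin n)) ∉ s := fun h => by simpa using hs _ h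
    have h4 : ∑ K ∈ insert ∅ s, y ^ K.card ≤ ∑ K : Finset (Fin n), y ^ K.card :=
      Finset.sum_le_sum_of_subset_of_nonneg (Finset.subset_univ _) fun _ _ _ => by positivity
    rw [Finset.sum_insert h3] at h4
    simp only [Finset.card_empty, pow_zero] at h4
    linarith
  have h5 : (y + 1) ^ n ≤ Real.exp (n * y) := by
    rw [Real.exp_nat_mul]
    gcongr
    exact Real.add_one_le_exp y
  have h6 : (n : ℝ) * y ≤ 1 / (n + 1) := by
    rw [hy, mul_one_div, div_le_div_iff₀ (by positivity) (by positivity)]; nlinarith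
  have h7 : 1 / ((n : ℝ) + 1) ≤ 1 / 2 := by
    apply one_div_le_one_div_of_le <;> linarith
  have h8 : Real.exp (n * y) ≤ 1 + 2 * (n * y) := by
    have h9 := Real.exp_bound_div_one_sub_of_interval (x := n * y) (by positivity) (by linarith)
    refine h9.trans ?_
    have h10 : 0 ≤ n * y := by positivity
    have h11 : n * y ≤ 1 / 2 := by linarith
    rw [div_le_iff₀ (by linarith)]
    nlinarith
  have : 2 / ((n : ℝ) + 1) = 2 * (1 / (n + 1)) := by ring
  linarith

lemma unifProb_not_extendable_le (hn : 0 < n) (G : Finset (Fin n → Bool)) (k₀ : ℕ) (T : ℕ → ℝ)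
    (δ κ : ℝ) (hδ : 0 ≤ δ) (hκ : κ ≤ 0.8) (hk₀ : (k₀ : ℝ) ≤ 0.05 * n)
    (hq : Real.exp (1 / 4 - 10 ^ (-14 : ℤ) /
      Real.sqrt (32 * (δ + k₀ / n + 1 / n) + 512 / n)) ≤ ((1 / ((n : ℝ) + 1)) ^ 5) ^ 4) :
    unifProb (fun x => ¬ Extendable x G k₀ T (δ * n) (κ * Real.sqrt n)) ≤ 2 / ((n : ℝ) + 1) := by
  classical
  have hn' : (1 : ℝ) ≤ n := by exact_mod_cast hn
  set z : ℝ := 1 / ((n : ℝ) + 1) with hz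
  have hz0 : 0 < z := by positivity
  have hz1 : z ≤ 1 / 2 := by
    apply one_div_le_one_div_of_le <;> linarith
  have hz2 : ((n : ℝ) + 1) * z = 1 := by rw [hz]; field_simp
  calc unifProb (fun x => ¬ Extendable x G k₀ T (δ * n) (κ * Real.sqrt n))
      ≤ unifProb (fun x => ∃ K ∈ (smallSets n k₀).filter Finset.Nonempty,
          ∃ P ∈ smallSets n K.card, ∃ J ∈ smallSets n K.card,
          HasFamily x G K P J (T K.card) (δ * n) (4 ^ K.card * badRatio n K.card) ∧
          ¬ HasThinning x G K P J (T K.card) (δ * n)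
      (4 ^ K.card * badRatio n K.card * ((10 ^ 14) ^ K.card) ^ 2) (κ * Real.sqrt n)) := by
        refine unifProb_mono fun x hx => ?_
        unfold Extendable at hx
        push Not at hx
        obtain ⟨K, P, J, hK, hKk, hP, hJ, h, h'⟩ := hx
        exact ⟨K, Finset.mem_filter.2 ⟨mem_smallSets.2 hKk, hK⟩, P,
          mem_smallSets.2 (Finset.card_le_card hP), J, mem_smallSets.2 hJ, h, h'⟩
    _ ≤ ∑ K ∈ (smallSets n k₀).filter Finset.Nonempty, ∑ P ∈ smallSets n K.card,
          ∑ J ∈ smallSets n K.card, unifProb (fun x =>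
          HasFamily x G K P J (T K.card) (δ * n) (4 ^ K.card * badRatio n K.card) ∧
          ¬ HasThinning x G K P J (T K.card) (δ * n)
      (4 ^ K.card * badRatio n K.card * ((10 ^ 14) ^ K.card) ^ 2) (κ * Real.sqrt n)) :=
      (unifProb_exists_le _ _).trans (Finset.sum_le_sum fun K _ => (unifProb_exists_le _ _).trans
        (Finset.sum_le_sum fun P _ => unifProb_exists_le _ _))
    _ ≤ ∑ K ∈ (smallSets n k₀).filter Finset.Nonempty, ∑ P ∈ smallSets n K.card,
          ∑ J ∈ smallSets n K.card, 2 ^ K.card * (z ^ 5) ^ K.card := by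
      refine Finset.sum_le_sum fun K hK => Finset.sum_le_sum fun P _ =>
        Finset.sum_le_sum fun J _ => ?_
      obtain ⟨hK, hKne⟩ := Finset.mem_filter.1 hK
      have hKk : (K.card : ℝ) ≤ k₀ := by exact_mod_cast mem_smallSets.1 hK
      have hKpos : (0 : ℝ) < K.card := by exact_mod_cast hKne.card_pos
      have hz5 : (z ^ 5) ≤ 1 := pow_le_one₀ hz0.le (by linarith)
      refine (unifProb_no_thinning_le hn G K P J (T K.card) δ _ κ ((z ^ 5) ^ 4) hδ hκ
        (hKk.trans hk₀) (mul_nonneg (by positivity) (badRatio_nonneg _ _)) ?_ (by positivity)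
        (pow_le_one₀ (by positivity) hz5) (le_trans ?_ hq)).trans ?_
      · rw [four_pow_mul_badRatio]
        gcongr
        exact inv_le_one_of_one_le₀ (one_le_pow₀ (by norm_num))
      · gcongr
      · rw [← pow_mul]
        refine mul_le_mul_of_nonneg_left ?_ (by positivity)
        exact pow_le_pow_of_le_one (by positivity) hz5 (by omega)
    _ ≤ ∑ K ∈ (smallSets n k₀).filter Finset.Nonempty, (z ^ 2) ^ K.card := by
      refine Finset.sum_le_sum fun K _ => ?_
      rw [Finset.sum_const, Finset.sum_const, nsmul_eq_mul, nsmul_eq_mul]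
      have h2 := card_smallSets_le_real n K.card
      calc ((smallSets n K.card).card : ℝ) * ((smallSets n K.card).card *
            (2 ^ K.card * (z ^ 5) ^ K.card))
          ≤ ((n : ℝ) + 1) ^ K.card * (((n : ℝ) + 1) ^ K.card *
            (((n : ℝ) + 1) ^ K.card * (z ^ 5) ^ K.card)) := by
            gcongr; linarith
        _ = (z ^ 2 * (((n : ℝ) + 1) * z) ^ 3) ^ K.card := by
            rw [← mul_pow, ← mul_pow, ← mul_pow]; congr 1; ring
        _ = _ := by rw [hz2]; simp
    _ ≤ _ := by
      have := sum_nonempty_pow_card_le hn ((smallSets n k₀).filter Finset.Nonempty)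
        fun K hK => (Finset.mem_filter.1 hK).2
      simpa [hz] using this

lemma rowOn_eq_of_pattern (x : EdgeIdx n → Bool) {K P : Finset (Fin n)} {σ : Fin n → Bool}
    (h : ∀ w ∈ K, (σ w = true ↔ w ∈ P)) (v : Fin n) :
    rowOn x K σ v = spin (σ v) * ∑ w ∈ K, edgeSign x v w * patternSign P w := by
  unfold rowOn
  congr 1
  refine Finset.sum_congr rfl fun w hw => ?_
  have := h w hw
  unfold patternSign
  by_cases hP : w ∈ P
  · simp [hP, this.2 hP]
  · have : σ w = false := by simpa [hP] using this
    simp [hP, this]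

lemma abs_rowOn_le_of_pattern (x : EdgeIdx n → Bool) {K P : Finset (Fin n)} {σ : Fin n → Bool}
    (h : ∀ w ∈ K, (σ w = true ↔ w ∈ P)) {d : ℝ} {v : Fin n} (hv : v ∉ atypical x K P d) :
    |rowOn x K σ v| ≤ d := by
  rw [rowOn_eq_of_pattern x h, abs_mul, abs_spin, one_mul]
  simpa [atypical] using hv

/-- Many members of a family share the same pattern on `K`. -/
lemma exists_popular_pattern (A : Finset (Fin n → Bool)) (hA : A.Nonempty) (K : Finset (Fin n)) :
    ∃ P ⊆ K, ∃ B ⊆ A, B.Nonempty ∧ A.card ≤ 2 ^ K.card * B.card ∧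
      ∀ σ ∈ B, ∀ w ∈ K, (σ w = true ↔ w ∈ P) := by
  classical
  set f : (Fin n → Bool) → Finset (Fin n) := fun σ => K.filter fun w => σ w = true with hf
  have hmaps : ∀ σ ∈ A, f σ ∈ K.powerset := fun σ _ =>
    Finset.mem_powerset.2 (Finset.filter_subset _ _)
  obtain ⟨P, hP, hPmax⟩ := Finset.exists_max_image K.powerset
    (fun P => (A.filter fun σ => f σ = P).card) ⟨∅, by simp⟩
  have hcard : A.card ≤ 2 ^ K.card * (A.filter fun σ => f σ = P).card := by
    rw [Finset.card_eq_sum_card_fiberwise hmaps, ← Finset.card_powerset, ← smul_eq_mul]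
    exact Finset.sum_le_card_nsmul _ _ _ hPmax
  refine ⟨P, Finset.mem_powerset.1 hP, A.filter fun σ => f σ = P, Finset.filter_subset _ _, ?_,
    hcard, fun σ hσ w hw => ?_⟩
  · rw [← Finset.card_pos]
    by_contra h0
    rw [Nat.eq_zero_of_not_pos h0] at hcard
    exact absurd hA.card_pos (by omega)
  · have h := (Finset.mem_filter.1 hσ).2
    rw [← h, hf]
    simp [hw]

theorem exists_good_of_extendable (x : EdgeIdx n → Bool) (G : Finset (Fin n → Bool)) (k₀ : ℕ)
    (t d δ U : ℝ) (hd : 0 ≤ d) (hU : t + 2 * d * Nat.size k₀ ≤ U) (hspread : SpreadOut x k₀ d)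
    (hext : Extendable x G k₀ (fun k => t + 2 * d * Nat.size k - d) δ U) (k : ℕ) :
    ∀ (K : Finset (Fin n)) (A : Finset (Fin n → Bool)), K.card = k → k ≤ k₀ → A ⊆ G → A.Nonempty →
      (badPairs δ A : ℝ) ≤ badRatio n k * (A.card : ℝ) ^ 2 →
      (∀ σ ∈ A, ∀ v, v ∉ K → t + 2 * d * Nat.size k ≤ rowOn x Finset.univ σ v) →
      ∃ σ ∈ G, ∀ v, t ≤ rowOn x Finset.univ σ v := by
  classical
  induction k using Nat.strong_induction_on with
  | _ k ih =>
    intro K A hK hk hAG hA hbad hrow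
    rcases Nat.eq_zero_or_pos k with rfl | hkpos
    · obtain ⟨σ, hσ⟩ := hA
      refine ⟨σ, hAG hσ, fun v => ?_⟩
      have hKe : K = ∅ := Finset.card_eq_zero.1 hK
      simpa using hrow σ hσ v (by simp [hKe])
    have hKne : K.Nonempty := Finset.card_pos.1 (hK ▸ hkpos)
    obtain ⟨P, hPK, B, hBA, hB, hcard, hpat⟩ := exists_popular_pattern A hA K
    set J := atypical x K P d with hJ
    have hJc : 4 * J.card ≤ K.card := hspread K P hKne (hK ▸ hk) hPK
    have hfam : HasFamily x G K P J (t + 2 * d * Nat.size K.card - d) δ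
        (4 ^ K.card * badRatio n K.card) := by
      refine ⟨B, fun σ hσ => ?_, hB, ?_⟩
      · refine Finset.mem_filter.2 ⟨hAG (hBA hσ), fun v hv => hpat σ hσ v hv, fun v hvK hvJ => ?_⟩
        have h1 := hrow σ (hBA hσ) v hvK
        have h2 := (abs_le.1 (abs_rowOn_le_of_pattern x (hpat σ hσ) hvJ)).2
        rw [← rowOn_add_compl x K] at h1
        rw [hK]
        linarith
      · have h1 : (badPairs δ B : ℝ) ≤ badPairs δ A := by exact_mod_cast badPairs_mono _ hBA
        have h2 : (A.card : ℝ) ≤ 2 ^ K.card * B.card := by exact_mod_cast hcard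
        calc (badPairs δ B : ℝ) ≤ badRatio n k * (A.card : ℝ) ^ 2 := h1.trans hbad
          _ ≤ badRatio n k * (2 ^ K.card * B.card) ^ 2 := by
            gcongr; exact badRatio_nonneg _ _
          _ = _ := by rw [hK, mul_pow, ← pow_mul, mul_comm k 2, pow_mul]; norm_num; ring
    obtain ⟨K', hK'K, hK'c, C, hC, hCne, hCbad, hCrow⟩ :=
      hext K P J hKne (hK ▸ hk) hPK (by omega) hfam
    have hunion : 2 * (K' ∪ J).card ≤ k := by
      have := Finset.card_union_le K' J; omega
    have hsize : Nat.size (K' ∪ J).card + 1 ≤ Nat.size k := by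
      rw [Nat.succ_le_iff, Nat.lt_size]
      have h1 : 2 ^ (Nat.size (K' ∪ J).card) ≤ 2 * (K' ∪ J).card ∨ (K' ∪ J).card = 0 := by
        rcases Nat.eq_zero_or_pos (K' ∪ J).card with h | h
        · exact Or.inr h
        · left
          have h2 : 0 < Nat.size (K' ∪ J).card := Nat.size_pos.2 h
          have h3 := (Nat.lt_size (m := Nat.size (K' ∪ J).card - 1)
            (n := (K' ∪ J).card)).1 (by omega)
          calc 2 ^ (Nat.size (K' ∪ J).card) = 2 * 2 ^ (Nat.size (K' ∪ J).card - 1) := by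
                rw [← pow_succ']; congr 1; omega
            _ ≤ _ := by omega
      rcases h1 with h1 | h1
      · omega
      · rw [h1]; simpa [Nat.one_le_iff_ne_zero] using hkpos.ne'
    have hsize' : (Nat.size (K' ∪ J).card : ℝ) + 1 ≤ Nat.size k := by exact_mod_cast hsize
    have hsize₀ : (Nat.size k : ℝ) ≤ Nat.size k₀ := by exact_mod_cast Nat.size_le_size hk
    have hthr : t + 2 * d * Nat.size (K' ∪ J).card ≤ t + 2 * d * Nat.size k - 2 * d := by
      nlinarith
    have hthr₀ : t + 2 * d * Nat.size k ≤ U := by nlinarith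
    refine ih (K' ∪ J).card (by omega) (K' ∪ J) C rfl (by omega)
      (hC.trans (Finset.filter_subset _ _)) hCne (hCbad.trans ?_) fun σ hσ v hv => ?_
    · gcongr
      exact four_pow_mul_badRatio_le n (by omega)
    · have hv1 : v ∉ K' := fun h => hv (Finset.mem_union_left _ h)
      have hv2 : v ∉ J := fun h => hv (Finset.mem_union_right _ h)
      obtain ⟨-, hσK, hσrow⟩ := Finset.mem_filter.1 (hC hσ)
      have h2 := (abs_le.1 (abs_rowOn_le_of_pattern x hσK hv2)).1
      rw [← rowOn_add_compl x K]
      by_cases hvK : v ∈ K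
      · have := hCrow v hvK hv1 σ hσ
        linarith
      · have := hσrow v hvK hv2
        rw [hK] at this
        linarith

end Iteration

section Boost

variable {n : ℕ}

lemma sum_abs_edgeSign_sub (x y : EdgeIdx n → Bool) :
    ∑ v, ∑ w, |edgeSign x v w - edgeSign y v w| = 4 * hammingDist x y := by
  classical
  rw [sum_sum_eq_sum_edge]
  simp only [edgeSign_self, sub_self, abs_zero, Finset.sum_const_zero, add_zero]
  have h : ∀ e : EdgeIdx n, |edgeSign x e.1.1 e.1.2 - edgeSign y e.1.1 e.1.2| +
      |edgeSign x e.1.2 e.1.1 - edgeSign y e.1.2 e.1.1| = if x e ≠ y e then 4 else 0 := by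
    intro e
    rw [edgeSign_comm x e.1.2, edgeSign_comm y e.1.2, edgeSign_of_lt, edgeSign_of_lt]
    cases x e <;> cases y e <;> norm_num
  rw [Finset.sum_congr rfl fun e _ => h e, ← Finset.sum_filter, Finset.sum_const, hammingDist,
    nsmul_eq_mul, mul_comm]

lemma rowOn_univ_ge_sub (x y : EdgeIdx n → Bool) (σ : Fin n → Bool) (v : Fin n) :
    rowOn y Finset.univ σ v - ∑ w, |edgeSign x v w - edgeSign y v w| ≤
      rowOn x Finset.univ σ v := by
  have h : rowOn y Finset.univ σ v - rowOn x Finset.univ σ v ≤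
      ∑ w, |edgeSign x v w - edgeSign y v w| := by
    unfold rowOn
    rw [← mul_sub, ← Finset.sum_sub_distrib, Finset.mul_sum]
    refine Finset.sum_le_sum fun w _ => ?_
    rw [← sub_mul]
    refine (le_abs_self _).trans (le_of_eq ?_)
    rw [abs_mul, abs_mul, abs_spin, abs_spin, one_mul, mul_one, abs_sub_comm]
  linarith

lemma card_edgeIdx_le (n : ℕ) : (Fintype.card (EdgeIdx n) : ℝ) ≤ (n : ℝ) ^ 2 := by
  have h : Fintype.card (EdgeIdx n) ≤ Fintype.card (Fin n × Fin n) :=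
    Fintype.card_le_of_injective _ Subtype.val_injective
  rw [Fintype.card_prod, Fintype.card_fin] at h
  rw [sq]; exact_mod_cast h

/-- A family of sign vectors of small bad ratio all of whose rows are large. -/
def HasGoodFamily (x : EdgeIdx n → Bool) (G : Finset (Fin n → Bool)) (d b U : ℝ) : Prop :=
  ∃ A ⊆ G, A.Nonempty ∧ (badPairs d A : ℝ) ≤ b * (A.card : ℝ) ^ 2 ∧
    ∀ σ ∈ A, ∀ v, U ≤ rowOn x Finset.univ σ v

theorem exists_good_of_hammingDist (x y : EdgeIdx n → Bool) (G : Finset (Fin n → Bool)) (k₀ : ℕ)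
    (t d δ U b : ℝ) (hd : 0 < d) (hU : t + 2 * d * Nat.size k₀ + d ≤ U)
    (hspread : SpreadOut x k₀ d) (hb : b ≤ badRatio n k₀)
    (hext : Extendable x G k₀ (fun k => t + 2 * d * Nat.size k - d) δ U)
    (hy : HasGoodFamily y G δ b U) (hxy : 4 * (hammingDist x y : ℝ) ≤ k₀ * d) :
    ∃ σ ∈ G, ∀ v, t ≤ rowOn x Finset.univ σ v := by
  classical
  obtain ⟨A, hAG, hA, hbad, hrow⟩ := hy
  set K : Finset (Fin n) := Finset.univ.filter fun v =>
    d < ∑ w, |edgeSign x v w - edgeSign y v w| with hK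
  have hcard : (K.card : ℝ) * d ≤ k₀ * d := by
    refine le_trans ?_ hxy
    rw [← sum_abs_edgeSign_sub, ← nsmul_eq_mul, ← Finset.sum_const]
    refine (Finset.sum_le_sum fun v hv => (Finset.mem_filter.1 hv).2.le).trans ?_
    exact Finset.sum_le_sum_of_subset_of_nonneg (Finset.subset_univ _)
      fun v _ _ => Finset.sum_nonneg fun w _ => abs_nonneg _
  have hk : K.card ≤ k₀ := by exact_mod_cast le_of_mul_le_mul_right hcard hd
  have hsize : (Nat.size K.card : ℝ) ≤ Nat.size k₀ := by exact_mod_cast Nat.size_le_size hk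
  refine exists_good_of_extendable x G k₀ t d δ U hd.le (by linarith) hspread hext K.card K A rfl hk
    hAG hA (hbad.trans ?_) fun σ hσ v hv => ?_
  · gcongr
    refine hb.trans ?_
    unfold badRatio
    gcongr
    norm_num
  · have h1 := hrow σ hσ v
    have h2 := rowOn_univ_ge_sub x y σ v
    have h3 : ∑ w, |edgeSign x v w - edgeSign y v w| ≤ d := by simpa [hK] using hv
    nlinarith

/-- A family of small bad ratio existing with probability `exp (-s)` yields, with high
probability, a sign vector with slightly smaller rows. -/
theorem unifProb_not_exists_good_le (hn : 1 < n) (G : Finset (Fin n → Bool)) (k₀ : ℕ)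
    (t d δ κ b s : ℝ) (hδ : 0 ≤ δ) (hκ : κ ≤ 0.8) (hd : 0 < d) (hs : 0 < s)
    (hU : t + 2 * d * Nat.size k₀ + d ≤ κ * Real.sqrt n) (hb : b ≤ badRatio n k₀)
    (hk₀ : (k₀ : ℝ) ≤ 0.05 * n)
    (hq : Real.exp (1 / 4 - 10 ^ (-14 : ℤ) /
      Real.sqrt (32 * (δ + k₀ / n + 1 / n) + 512 / n)) ≤ ((1 / ((n : ℝ) + 1)) ^ 5) ^ 4)
    (hD : 12 * (Real.sqrt s * n) ≤ k₀ * d)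
    (hp : Real.exp (-s) ≤ unifProb fun x => HasGoodFamily x G (δ * n) b (κ * Real.sqrt n)) :
    unifProb (fun x : EdgeIdx n → Bool => ¬ ∃ σ ∈ G, ∀ v, t ≤ rowOn x Finset.univ σ v) ≤
      Real.exp (-s) + (((n : ℝ) + 1) ^ (4 * k₀) * Real.exp (-(d ^ 2 / 16)) + 2 / ((n : ℝ) + 1)) := by
  classical
  have : Nonempty (EdgeIdx n) :=
    ⟨⟨(⟨0, by omega⟩, ⟨1, hn⟩), by simp [Fin.lt_def]⟩⟩
  have h1 := unifProb_hamming _ s hs hp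
  have h2 := unifProb_not_spreadOut_le (n := n) k₀ d hd.le
  have h3 := unifProb_not_extendable_le (by omega) G k₀ (fun k => t + 2 * d * Nat.size k - d)
    δ κ hδ hκ hk₀ hq
  refine le_trans (unifProb_mono fun x hx => ?_) ((unifProb_or_le _ _).trans
    (add_le_add h1 ((unifProb_or_le _ _).trans (add_le_add h2 h3))))
  by_contra hcon
  push Not at hcon
  obtain ⟨⟨y, hy, hxy⟩, hspread, hext⟩ := hcon
  refine hx (exists_good_of_hammingDist x y G k₀ t d (δ * n) _ b hd hU hspread hb hext hy ?_)
  have h4 : Real.sqrt (s * Fintype.card (EdgeIdx n)) ≤ Real.sqrt s * n := by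
    rw [Real.sqrt_mul hs.le]
    gcongr
    exact Real.sqrt_le_iff.2 ⟨by positivity, card_edgeIdx_le n⟩
  linarith

end Boost

section Gauge

variable {n : ℕ}

lemma spin_beq (b c : Bool) : spin (b == c) = spin b * spin c := by
  cases b <;> cases c <;> norm_num

/-- Multiplying the edge signs by `σ v * σ w`. -/
def gaugeFlip (σ : Fin n → Bool) (x : EdgeIdx n → Bool) : EdgeIdx n → Bool :=
  fun e => x e == (σ e.1.1 == σ e.1.2)

lemma gaugeFlip_gaugeFlip (σ : Fin n → Bool) (x : EdgeIdx n → Bool) : gaugeFlip σ (gaugeFlip σ x) = x := by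
  funext e
  unfold gaugeFlip
  cases x e <;> cases σ e.1.1 <;> cases σ e.1.2 <;> rfl

/-- The map `gaugeFlip` as an involutive permutation. -/
def gaugeFlipEquiv (σ : Fin n → Bool) : (EdgeIdx n → Bool) ≃ (EdgeIdx n → Bool) :=
  ⟨gaugeFlip σ, gaugeFlip σ, gaugeFlip_gaugeFlip σ, gaugeFlip_gaugeFlip σ⟩

lemma edgeSign_gaugeFlip (σ : Fin n → Bool) (x : EdgeIdx n → Bool) (v w : Fin n) :
    edgeSign (gaugeFlip σ x) v w = spin (σ v) * spin (σ w) * edgeSign x v w := by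
  unfold edgeSign gaugeFlip
  split_ifs
  · simp only [spin_beq]; ring
  · simp only [spin_beq]; ring
  · simp

lemma rowOn_gaugeFlip (σ ρ : Fin n → Bool) (x : EdgeIdx n → Bool) (v : Fin n) :
    rowOn (gaugeFlip σ x) Finset.univ ρ v = rowOn x Finset.univ (fun w => σ w == ρ w) v := by
  unfold rowOn
  simp only [edgeSign_gaugeFlip, spin_beq, Finset.mul_sum]
  exact Finset.sum_congr rfl fun w _ => by ring

end Gauge

section Moments

variable {n : ℕ}

/-- All rows of `σ` are at least `U`. -/
def GoodFor (x : EdgeIdx n → Bool) (U : ℝ) (σ : Fin n → Bool) : Prop :=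
  ∀ v, U ≤ rowOn x Finset.univ σ v

/-- The probability that two sign vectors with ratio `ρ` both have large rows. -/
noncomputable def pairProb (n : ℕ) (U : ℝ) (ρ : Fin n → Bool) : ℝ :=
  unifProb fun x : EdgeIdx n → Bool => GoodFor x U (fun _ => true) ∧ GoodFor x U ρ

/-- The probability that a given sign vector has large rows. -/
noncomputable def singleProb (n : ℕ) (U : ℝ) : ℝ :=
  unifProb fun x : EdgeIdx n → Bool => GoodFor x U fun _ => true

lemma unifProb_goodFor_pair (U : ℝ) (σ τ : Fin n → Bool) :
    unifProb (fun x : EdgeIdx n → Bool => GoodFor x U σ ∧ GoodFor x U τ) =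
      pairProb n U fun w => σ w == τ w := by
  unfold pairProb
  rw [← unifProb_equiv (gaugeFlipEquiv σ)]
  congr 1
  funext x
  have h : ∀ ρ, GoodFor (gaugeFlip σ x) U ρ ↔ GoodFor x U fun w => σ w == ρ w := fun ρ => by
    unfold GoodFor; simp only [rowOn_gaugeFlip]
  change (GoodFor (gaugeFlip σ x) U σ ∧ GoodFor (gaugeFlip σ x) U τ) = _
  rw [h, h]
  congr 2
  funext w; cases σ w <;> rfl

lemma unifProb_goodFor (U : ℝ) (σ : Fin n → Bool) :
    unifProb (fun x : EdgeIdx n → Bool => GoodFor x U σ) = singleProb n U := by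
  have h := unifProb_goodFor_pair U σ σ
  simp only [and_self, beq_self_eq_true] at h
  rw [h, pairProb, singleProb]
  simp only [and_self]

lemma pairProb_le_singleProb (U : ℝ) (ρ : Fin n → Bool) : pairProb n U ρ ≤ singleProb n U :=
  unifProb_mono fun _ h => h.1

open Classical in
/-- The sign vectors of `G` with large rows. -/
noncomputable def solutions (x : EdgeIdx n → Bool) (G : Finset (Fin n → Bool)) (U : ℝ) :
    Finset (Fin n → Bool) := G.filter (GoodFor x U)

lemma card_solutions (x : EdgeIdx n → Bool) (G : Finset (Fin n → Bool)) (U : ℝ) [DecidablePred (GoodFor x U)] :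
    ((solutions x G U).card : ℝ) = ∑ σ ∈ G, if GoodFor x U σ then (1 : ℝ) else 0 := by
  rw [Finset.sum_boole]
  unfold solutions
  congr

lemma expect_card_solutions (G : Finset (Fin n → Bool)) (U : ℝ) :
    𝔼 x : EdgeIdx n → Bool, ((solutions x G U).card : ℝ) = G.card * singleProb n U := by
  classical
  simp_rw [card_solutions]
  rw [Finset.expect_sum_comm]
  rw [Finset.sum_congr rfl fun σ _ => show _ = singleProb n U from ?_]
  · rw [Finset.sum_const, nsmul_eq_mul]
  · rw [← unifProb_goodFor U σ]
    unfold unifProb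
    congr

lemma sum_pair_le (G : Finset (Fin n → Bool)) (U : ℝ) (S : (Fin n → Bool) → Prop)
    [DecidablePred S] :
    ∑ σ ∈ G, ∑ τ ∈ G, (if S (fun w => σ w == τ w) then
      unifProb (fun x : EdgeIdx n → Bool => GoodFor x U σ ∧ GoodFor x U τ) else 0) ≤
      G.card * ∑ ρ with S ρ, pairProb n U ρ := by
  rw [← nsmul_eq_mul, ← Finset.sum_const]
  refine Finset.sum_le_sum fun σ _ => ?_
  simp_rw [unifProb_goodFor_pair]
  have hinj : Function.Injective fun (τ : Fin n → Bool) (w : Fin n) => (σ w == τ w) := by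
    intro τ τ' h
    funext w
    have hw : (σ w == τ w) = (σ w == τ' w) := congrFun h w
    revert hw
    cases σ w <;> cases τ w <;> cases τ' w <;> decide
  rw [Finset.sum_filter]
  rw [← Finset.sum_image (f := fun ρ => if S ρ then pairProb n U ρ else 0) hinj.injOn]
  refine Finset.sum_le_sum_of_subset_of_nonneg (Finset.subset_univ _) fun ρ _ _ => ?_
  split_ifs
  · exact unifProb_nonneg _
  · exact le_rfl

lemma overlap_eq (σ τ : Fin n → Bool) : overlap σ τ = ∑ w, spin (σ w == τ w) := by
  simp [overlap, spin_beq]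

lemma expect_card_solutions_sq_le (G : Finset (Fin n → Bool)) (U : ℝ) :
    𝔼 x : EdgeIdx n → Bool, ((solutions x G U).card : ℝ) ^ 2 ≤
      G.card * ∑ ρ, pairProb n U ρ := by
  classical
  have h : ∀ x : EdgeIdx n → Bool, ((solutions x G U).card : ℝ) ^ 2 =
      ∑ σ ∈ G, ∑ τ ∈ G, if GoodFor x U σ ∧ GoodFor x U τ then (1 : ℝ) else 0 := by
    intro x
    rw [sq, card_solutions, Finset.sum_mul_sum]
    refine Finset.sum_congr rfl fun σ _ => Finset.sum_congr rfl fun τ _ => ?_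
    by_cases h1 : GoodFor x U σ <;> by_cases h2 : GoodFor x U τ <;> simp [h1, h2]
  simp_rw [h]
  rw [Finset.expect_sum_comm]
  simp_rw [Finset.expect_sum_comm (s := Finset.univ)]
  refine (le_of_eq ?_).trans ((sum_pair_le G U fun _ => True).trans (le_of_eq ?_))
  · refine Finset.sum_congr rfl fun σ _ => Finset.sum_congr rfl fun τ _ => ?_
    rw [if_pos trivial]
    unfold unifProb
    exact Finset.expect_congr rfl fun x _ => by congr
  · rw [Finset.filter_true]

lemma expect_badPairs_solutions_le (G : Finset (Fin n → Bool)) (U d : ℝ)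
    [DecidablePred fun ρ : Fin n → Bool => d < |∑ w, spin (ρ w)|] :
    𝔼 x : EdgeIdx n → Bool, (badPairs d (solutions x G U) : ℝ) ≤
      G.card * ∑ ρ : Fin n → Bool with d < |∑ w, spin (ρ w)|, pairProb n U ρ := by
  classical
  have h : ∀ x : EdgeIdx n → Bool, (badPairs d (solutions x G U) : ℝ) =
      ∑ σ ∈ G, ∑ τ ∈ G, if d < |∑ w, spin (σ w == τ w)| then
        (if GoodFor x U σ ∧ GoodFor x U τ then (1 : ℝ) else 0) else 0 := by
    intro x
    unfold badPairs solutions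
    rw [← Finset.filter_product, Finset.filter_filter, ← Finset.sum_product', ← Finset.sum_boole]
    refine Finset.sum_congr rfl fun p _ => ?_
    rw [overlap_eq]
    by_cases h1 : GoodFor x U p.1 <;> by_cases h2 : GoodFor x U p.2 <;> simp [h1, h2]
  simp_rw [h]
  rw [Finset.expect_sum_comm]
  simp_rw [Finset.expect_sum_comm (s := Finset.univ)]
  have := sum_pair_le G U fun ρ => d < |∑ w, spin (ρ w)|
  refine le_trans (le_of_eq ?_) this
  refine Finset.sum_congr rfl fun σ _ => Finset.sum_congr rfl fun τ _ => ?_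
  split_ifs
  · unfold unifProb
    exact Finset.expect_congr rfl fun x _ => by congr
  · simp

/-- The Paley–Zygmund inequality for the uniform measure. -/
lemma paley_zygmund {α : Type*} [Fintype α] [Nonempty α] (X : α → ℝ)
    (hE : 0 < 𝔼 x, X x) (r : ℝ) (hr : 0 < r) (h2 : 𝔼 x, X x ^ 2 ≤ r * (𝔼 x, X x) ^ 2) :
    1 / (4 * r) ≤ unifProb fun x => (𝔼 y, X y) / 2 ≤ X x := by
  classical
  set m := 𝔼 x, X x with hm
  set p := unifProb fun x => m / 2 ≤ X x with hp
  have h1 : ∀ x, X x ≤ m / 2 + (1 / (4 * r * m)) * X x ^ 2 +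
      (r * m) * if m / 2 ≤ X x then 1 else 0 := by
    intro x
    have h0 : 0 ≤ 1 / (4 * r * m) * X x ^ 2 := by positivity
    split_ifs with h
    · have : 0 ≤ (1 / (4 * r * m)) * (X x - 2 * r * m) ^ 2 := by positivity
      have h3 : (1 / (4 * r * m)) * (X x - 2 * r * m) ^ 2 =
        (1 / (4 * r * m)) * X x ^ 2 - X x + r * m := by field_simp; ring
      linarith
    · push Not at h; linarith
  have h4 := Finset.expect_le_expect fun x (_ : x ∈ Finset.univ) => h1 x
  rw [Finset.expect_add_distrib, Finset.expect_add_distrib, ← Finset.mul_expect,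
    ← Finset.mul_expect, Fintype.expect_const] at h4
  have h5 : (𝔼 x, if m / 2 ≤ X x then (1 : ℝ) else 0) = p := by
    rw [hp]; unfold unifProb; congr
  rw [h5, ← hm] at h4
  have h6 : 1 / (4 * r * m) * 𝔼 x, X x ^ 2 ≤ 1 / (4 * r * m) * (r * m ^ 2) := by gcongr
  have h7 : 1 / (4 * r * m) * (r * m ^ 2) = m / 4 := by field_simp
  have h8 : m / 4 ≤ r * m * p := by linarith
  rw [div_le_iff₀ (by positivity)]
  nlinarith

lemma unifProb_markov {α : Type*} [Fintype α] (Y : α → ℝ) (hY : ∀ x, 0 ≤ Y x) (c : ℝ)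
    (hc : 0 < c) : unifProb (fun x => c ≤ Y x) ≤ (𝔼 x, Y x) / c := by
  rw [Finset.expect_div]
  refine unifProb_le_expect (fun x => div_nonneg (hY x) hc.le) fun x hx => ?_
  rwa [le_div_iff₀ hc, one_mul]

theorem unifProb_hasGoodFamily_ge (G : Finset (Fin n → Bool)) (hG : G.Nonempty) (U d b r q : ℝ)
    [DecidablePred fun ρ : Fin n → Bool => d < |∑ w, spin (ρ w)|]
    (hπ : 0 < singleProb n U) (hr : 0 < r) (hb : 0 < b)
    (h2 : ∑ ρ, pairProb n U ρ ≤ r * (G.card * singleProb n U ^ 2))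
    (hbad : ∑ ρ : Fin n → Bool with d < |∑ w, spin (ρ w)|, pairProb n U ρ ≤
      q * (G.card * singleProb n U ^ 2)) :
    1 / (4 * r) - 4 * q / b ≤ unifProb fun x => HasGoodFamily x G d b U := by
  classical
  have hGpos : (0 : ℝ) < G.card := by exact_mod_cast hG.card_pos
  obtain ⟨m, hm⟩ : ∃ m, m = 𝔼 x : EdgeIdx n → Bool, ((solutions x G U).card : ℝ) := ⟨_, rfl⟩
  have hmeq : m = G.card * singleProb n U := hm.trans (expect_card_solutions G U)
  have hmpos : 0 < m := by rw [hmeq]; positivity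
  have hpz := paley_zygmund (fun x : EdgeIdx n → Bool => ((solutions x G U).card : ℝ))
    (hm ▸ hmpos) r hr (by
      refine (expect_card_solutions_sq_le G U).trans ?_
      rw [← hm, hmeq]
      calc (G.card : ℝ) * ∑ ρ, pairProb n U ρ ≤ G.card * (r * (G.card * singleProb n U ^ 2)) := by
            gcongr
        _ = _ := by ring)
  have hmk := unifProb_markov (fun x : EdgeIdx n → Bool => (badPairs d (solutions x G U) : ℝ))
    (fun x => Nat.cast_nonneg _) (b * (m / 2) ^ 2) (by positivity)
  have hq : (𝔼 x : EdgeIdx n → Bool, (badPairs d (solutions x G U) : ℝ)) / (b * (m / 2) ^ 2) ≤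
      4 * q / b := by
    rw [div_le_div_iff₀ (by positivity) hb]
    have : 𝔼 x : EdgeIdx n → Bool, (badPairs d (solutions x G U) : ℝ) ≤ q * m ^ 2 := by
      refine (expect_badPairs_solutions_le G U d).trans ?_
      rw [hmeq]
      calc _ ≤ (G.card : ℝ) * (q * (G.card * singleProb n U ^ 2)) := by gcongr
        _ = _ := by ring
    nlinarith
  have hle : unifProb (fun x : EdgeIdx n → Bool => m / 2 ≤ ((solutions x G U).card : ℝ)) ≤
      unifProb (fun x => HasGoodFamily x G d b U) +
      unifProb fun x : EdgeIdx n → Bool =>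
        b * (m / 2) ^ 2 ≤ (badPairs d (solutions x G U) : ℝ) := by
    refine (unifProb_mono fun x hx => ?_).trans (unifProb_or_le _ _)
    by_cases hc : b * (m / 2) ^ 2 ≤ (badPairs d (solutions x G U) : ℝ)
    · exact Or.inr hc
    · left
      refine ⟨solutions x G U, Finset.filter_subset _ _, ?_, ?_, fun σ hσ =>
        (Finset.mem_filter.1 hσ).2⟩
      · rw [← Finset.card_pos, ← Nat.cast_pos (α := ℝ)]; linarith
      · refine (not_le.1 hc).le.trans ?_
        gcongr
  rw [← hm] at hpz
  linarith

end Moments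

section Correlation

variable {E ι : Type*} [Fintype E] [DecidableEq E]

lemma expect_mul_le_of_monotone {f g : (E → Bool) → ℝ} (hf₀ : 0 ≤ f) (hg₀ : 0 ≤ g)
    (hf : Monotone f) (hg : Monotone g) :
    (𝔼 x, f x) * 𝔼 x, g x ≤ 𝔼 x, f x * g x := by
  have h := fkg (α := E → Bool) (β := ℝ) (μ := fun _ => 1) (f := f) (g := g)
    (fun _ => zero_le_one) hf₀ hg₀ hf hg fun _ _ => le_rfl
  simp only [one_mul, Finset.sum_const, Finset.card_univ, nsmul_eq_mul, mul_one] at h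
  simp only [Fintype.expect_eq_sum_div_card]
  have hc : (0 : ℝ) < Fintype.card (E → Bool) := by exact_mod_cast Fintype.card_pos
  rw [div_mul_div_comm, div_le_div_iff₀ (by positivity) hc]
  nlinarith

/-- For increasing functions, adding a constant to each factor of a product changes the mean
by a controlled factor. -/
lemma expect_prod_add_le (s : Finset ι) (A : ι → (E → Bool) → ℝ) (hA₀ : ∀ i, 0 ≤ A i)
    (hA : ∀ i, Monotone (A i)) {c e : ℝ} (hc : 0 < c) (he : 0 ≤ e)
    (hcA : ∀ i, c ≤ 𝔼 x, A i x) (g : (E → Bool) → ℝ) (hg₀ : 0 ≤ g) (hg : Monotone g) :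
    𝔼 x, (∏ i ∈ s, (A i x + e)) * g x ≤
      (1 + e / c) ^ s.card * 𝔼 x, (∏ i ∈ s, A i x) * g x := by
  classical
  induction s using Finset.induction_on generalizing g with
  | empty => simp
  | insert i s hi ih =>
    have h1 := ih (fun x => (A i x + e) * g x)
      (fun x => mul_nonneg (add_nonneg (hA₀ i x) he) (hg₀ x))
      (fun x y hxy => mul_le_mul (by simpa using hA i hxy) (hg hxy) (hg₀ x)
        (add_nonneg (hA₀ i y) he))
    set G : (E → Bool) → ℝ := fun x => (∏ j ∈ s, A j x) * g x with hG
    have hG₀ : 0 ≤ G := fun x => mul_nonneg (Finset.prod_nonneg fun j _ => hA₀ j x) (hg₀ x)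
    have hGm : Monotone G := fun x y hxy => mul_le_mul
      (Finset.prod_le_prod (fun j _ => hA₀ j x) fun j _ => hA j hxy) (hg hxy) (hg₀ x)
      (Finset.prod_nonneg fun j _ => hA₀ j y)
    have h2 := expect_mul_le_of_monotone (hA₀ i) hG₀ (hA i) hGm
    have h3 : c * 𝔼 x, G x ≤ 𝔼 x, A i x * G x :=
      (mul_le_mul_of_nonneg_right (hcA i) (Finset.expect_nonneg fun x _ => hG₀ x)).trans h2
    have h4 : 𝔼 x, (∏ j ∈ s, A j x) * ((A i x + e) * g x) =
        𝔼 x, A i x * G x + e * 𝔼 x, G x := by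
      rw [Finset.mul_expect, ← Finset.expect_add_distrib]
      exact Finset.expect_congr rfl fun x _ => by simp only [hG]; ring
    have h5 : e * 𝔼 x, G x ≤ e / c * 𝔼 x, A i x * G x := by
      rw [div_mul_eq_mul_div, le_div_iff₀ hc]
      nlinarith
    calc 𝔼 x, (∏ j ∈ insert i s, (A j x + e)) * g x
        = 𝔼 x, (∏ j ∈ s, (A j x + e)) * ((A i x + e) * g x) :=
          Finset.expect_congr rfl fun x _ => by rw [Finset.prod_insert hi]; ring
      _ ≤ (1 + e / c) ^ s.card * 𝔼 x, (∏ j ∈ s, A j x) * ((A i x + e) * g x) := h1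
      _ ≤ (1 + e / c) ^ s.card * ((1 + e / c) * 𝔼 x, A i x * G x) := by
          rw [h4]; gcongr; linarith
      _ = (1 + e / c) ^ (insert i s).card * 𝔼 x, (∏ j ∈ insert i s, A j x) * g x := by
          rw [Finset.card_insert_of_notMem hi, pow_succ, mul_assoc]
          congr 2
          exact Finset.expect_congr rfl fun x _ => by rw [Finset.prod_insert hi]; ring

end Correlation

section RowCoef

variable {n : ℕ}

/-- The coefficient of the edge `e` in the row of `σ` at `v`. -/
noncomputable def rowCoef (σ : Fin n → Bool) (v : Fin n) (e : EdgeIdx n) : ℝ :=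
  spin (σ e.1.1) * spin (σ e.1.2) * ((if e.1.1 = v then 1 else 0) + if e.1.2 = v then 1 else 0)

lemma rowOn_eq_sum_rowCoef (x : EdgeIdx n → Bool) (σ : Fin n → Bool) (v : Fin n) :
    rowOn x Finset.univ σ v = ∑ e, rowCoef σ v e * spin (x e) := by
  have h := sum_bilinear_edgeSign x (fun w => if w = v then spin (σ v) else 0)
    fun w => spin (σ w)
  simp only [ite_mul, zero_mul, Finset.sum_ite_eq', Finset.mem_univ, if_true] at h
  unfold rowOn
  rw [h]
  refine Finset.sum_congr rfl fun e _ => ?_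
  have := e.2.ne
  unfold rowCoef
  by_cases h1 : e.1.1 = v
  · have h2 : e.1.2 ≠ v := fun h2 => this (h1.trans h2.symm)
    simp only [h1, h2, if_true, if_false]; ring
  · by_cases h2 : e.1.2 = v
    · simp only [h1, h2, if_true, if_false]; ring
    · simp only [h1, h2, if_false]; ring

lemma sum_edge_indicator (f : Fin n → Fin n → ℝ) (hf : ∀ a b, f a b = f b a) (v : Fin n) :
    ∑ e : EdgeIdx n, f e.1.1 e.1.2 * ((if e.1.1 = v then 1 else 0) + if e.1.2 = v then 1 else 0) =
      ∑ w, f v w - f v v := by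
  have h := sum_sum_eq_sum_edge fun a b => if a = v then f a b else 0
  have h1 : ∑ a, ∑ b, (if a = v then f a b else 0) = ∑ w, f v w := by
    rw [Finset.sum_comm]
    exact Finset.sum_congr rfl fun b _ => by simp
  rw [h1] at h
  simp only [Finset.sum_ite_eq', Finset.mem_univ, if_true] at h
  rw [h, add_sub_cancel_right]
  refine Finset.sum_congr rfl fun e _ => ?_
  rw [hf e.1.2 e.1.1]
  split_ifs <;> ring

lemma sum_rowCoef_mul (σ τ : Fin n → Bool) (v w : Fin n) :
    ∑ e, rowCoef σ v e * rowCoef τ w e =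
      (if v = w then spin (σ v) * spin (τ v) * ∑ u, spin (σ u) * spin (τ u) else 0) +
        spin (σ v) * spin (σ w) * (spin (τ v) * spin (τ w)) - if v = w then 2 else 0 := by
  have h := sum_edge_indicator (fun a b => spin (σ a) * spin (σ b) * (spin (τ a) * spin (τ b)) *
    ((if a = w then 1 else 0) + if b = w then 1 else 0)) (fun a b => by ring) v
  have h0 : ∑ e, rowCoef σ v e * rowCoef τ w e = _ := (Finset.sum_congr rfl fun e _ => by
    unfold rowCoef; ring).trans h
  rw [h0]
  by_cases hv : v = w
  · subst hv
    simp only [if_true]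
    have : ∀ b, spin (σ v) * spin (σ b) * (spin (τ v) * spin (τ b)) *
        (1 + if b = v then (1 : ℝ) else 0) = spin (σ v) * spin (τ v) * (spin (σ b) * spin (τ b)) +
          if b = v then 1 else 0 := by
      intro b
      split_ifs with hb
      · subst hb
        linear_combination spin (τ b) ^ 2 * spin_sq (σ b) + spin_sq (τ b)
      · ring
    simp_rw [this]
    rw [Finset.sum_add_distrib, ← Finset.mul_sum]
    simp only [Finset.sum_ite_eq', Finset.mem_univ, if_true]
    linear_combination (-3) * spin (τ v) ^ 2 * spin_sq (σ v) - 3 * spin_sq (τ v)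
  · simp [hv]

lemma singleProb_ge_of_prod (hn : 20 ≤ n) (κ e : ℝ) (hκ : κ ≤ 0.8) (he : 0 ≤ e) (φ : ℝ → ℝ)
    (hφ₀ : ∀ r, 0 ≤ φ r) (hφ : ∀ r, φ r ≤ (if κ * Real.sqrt n ≤ r then 1 else 0) + e) :
    𝔼 x : EdgeIdx n → Bool, ∏ v, φ (rowOn x Finset.univ (fun _ => true) v) ≤
      Real.exp (10 ^ 14 * e * n) * singleProb n (κ * Real.sqrt n) := by
  have hn0 : (0 : ℝ) < n := by positivity
  have hs : 0 < Real.sqrt n := Real.sqrt_pos.2 hn0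
  have hsq : Real.sqrt n ^ 2 = n := Real.sq_sqrt hn0.le
  set A : Fin n → (EdgeIdx n → Bool) → ℝ := fun v x =>
    if κ * Real.sqrt n ≤ rowOn x Finset.univ (fun _ => true) v then 1 else 0 with hA
  have hA₀ : ∀ v, 0 ≤ A v := fun v x => by simp only [hA, Pi.zero_apply]; split_ifs <;> norm_num
  have hAm : ∀ v, Monotone (A v) := by
    intro v x y hxy
    have hr : rowOn x Finset.univ (fun _ => true) v ≤ rowOn y Finset.univ (fun _ => true) v := by
      rw [rowOn_eq_sum_rowCoef, rowOn_eq_sum_rowCoef]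
      refine Finset.sum_le_sum fun i _ => mul_le_mul_of_nonneg_left ?_ ?_
      · have := hxy i
        revert this
        cases x i <;> cases y i <;> simp
      · unfold rowCoef
        split_ifs <;> norm_num
    simp only [hA]
    split_ifs with h1 h2
    · exact le_rfl
    · exact absurd (h1.trans hr) h2
    · norm_num
    · exact le_rfl
  have hcA : ∀ v, (10 : ℝ) ^ (-14 : ℤ) ≤ 𝔼 x, A v x := by
    intro v
    have hsum : ∑ i : EdgeIdx n, (rowCoef (fun _ => true) v i / Real.sqrt n) ^ 2 = (n - 1) / n := by
      simp_rw [div_pow, hsq]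
      rw [← Finset.sum_div]
      congr 1
      simp_rw [sq]
      rw [sum_rowCoef_mul]
      simp; ring
    have h20 : (20 : ℝ) ≤ n := by exact_mod_cast hn
    have h := expect_smoothStep_lower (fun i : EdgeIdx n =>
      rowCoef (fun _ => true) v i / Real.sqrt n) κ hκ
      (by rw [hsum, div_le_one hn0]; linarith)
      (by rw [hsum, le_div_iff₀ hn0]; linarith)
    have h2 : 𝔼 y : EdgeIdx n → Bool, smoothStep (∑ i : EdgeIdx n,
        rowCoef (fun _ => true) v i / Real.sqrt n * spin (y i) - κ) ≤ 2 * 𝔼 x, A v x := by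
      rw [Finset.mul_expect]
      refine Finset.expect_le_expect fun x _ => ?_
      have e1 : ∑ i : EdgeIdx n, rowCoef (fun _ => true) v i / Real.sqrt n * spin (x i) =
          rowOn x Finset.univ (fun _ => true) v / Real.sqrt n := by
        rw [rowOn_eq_sum_rowCoef, Finset.sum_div]
        exact Finset.sum_congr rfl fun i _ => by ring
      rw [e1]
      simp only [hA]
      split_ifs with h1
      · simpa using smoothStep_le_two _
      · rw [smoothStep_of_nonpos, mul_zero]
        rw [sub_nonpos, div_le_iff₀ hs]
        exact (not_le.1 h1).le
    norm_num at h ⊢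
    linarith
  have hmain := expect_prod_add_le Finset.univ A hA₀ hAm (c := 10 ^ (-14 : ℤ)) (by positivity) he
    hcA (fun _ => 1) (fun _ => zero_le_one) monotone_const
  simp only [mul_one, Finset.card_univ, Fintype.card_fin] at hmain
  calc _ ≤ 𝔼 x, ∏ v, (A v x + e) := Finset.expect_le_expect fun x _ =>
        Finset.prod_le_prod (fun v _ => hφ₀ _) fun v _ => hφ _
    _ ≤ _ := hmain
    _ ≤ _ := by
      have h1 : 𝔼 x, ∏ v, A v x = singleProb n (κ * Real.sqrt n) := by
        unfold singleProb unifProb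
        refine Finset.expect_congr rfl fun x _ => ?_
        by_cases h : GoodFor x (κ * Real.sqrt n) fun _ => true
        · rw [if_pos h]
          exact Finset.prod_eq_one fun v _ => if_pos (h v)
        · rw [if_neg h]
          unfold GoodFor at h
          push Not at h
          obtain ⟨v, hv⟩ := h
          exact Finset.prod_eq_zero (Finset.mem_univ v) (if_neg (not_le.2 hv))
      rw [h1]
      refine mul_le_mul_of_nonneg_right ?_ (unifProb_nonneg _)
      have h2 : 1 + e / 10 ^ (-14 : ℤ) ≤ Real.exp (10 ^ 14 * e) := by
        have := Real.add_one_le_exp (10 ^ 14 * e)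
        norm_num at this ⊢; linarith
      calc _ ≤ Real.exp (10 ^ 14 * e) ^ n := by gcongr
        _ = _ := by rw [← Real.exp_nat_mul]; congr 1; ring

end RowCoef

section Tame

/-- A positive function whose first three derivatives are controlled by itself. -/
def Tame (A : ℝ) (F : ℝ → ℝ) : Prop :=
  ∃ F₁ F₂ F₃ : ℝ → ℝ, ∀ z, 0 < F z ∧ HasDerivAt F (F₁ z) z ∧ HasDerivAt F₁ (F₂ z) z ∧
    HasDerivAt F₂ (F₃ z) z ∧ |F₁ z| ≤ A * F z ∧ |F₂ z| ≤ A ^ 2 * F z ∧ |F₃ z| ≤ A ^ 3 * F z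

lemma tame_const {c : ℝ} (hc : 0 < c) : Tame 0 fun _ => c :=
  ⟨fun _ => 0, fun _ => 0, fun _ => 0, fun z => ⟨hc, hasDerivAt_const _ _, hasDerivAt_const _ _,
    hasDerivAt_const _ _, by simp, by simp, by simp⟩⟩

lemma Tame.pos {A : ℝ} {F : ℝ → ℝ} (h : Tame A F) (z : ℝ) : 0 < F z := by
  obtain ⟨_, _, _, h⟩ := h
  exact (h z).1

lemma Tame.continuous {A : ℝ} {F : ℝ → ℝ} (h : Tame A F) : Continuous F := by
  obtain ⟨F₁, _, _, h⟩ := h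
  exact continuous_iff_continuousAt.2 fun z => (h z).2.1.continuousAt

lemma Tame.mul {A B : ℝ} {F G : ℝ → ℝ} (hF : Tame A F)
    (hG : Tame B G) : Tame (A + B) fun z => F z * G z := by
  obtain ⟨F₁, F₂, F₃, hF⟩ := hF
  obtain ⟨G₁, G₂, G₃, hG⟩ := hG
  refine ⟨fun z => F₁ z * G z + F z * G₁ z,
    fun z => (F₂ z * G z + F₁ z * G₁ z) + (F₁ z * G₁ z + F z * G₂ z),
    fun z => ((F₃ z * G z + F₂ z * G₁ z) + (F₂ z * G₁ z + F₁ z * G₂ z)) +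
      ((F₂ z * G₁ z + F₁ z * G₂ z) + (F₁ z * G₂ z + F z * G₃ z)), fun z => ?_⟩
  obtain ⟨f0, d1, d2, d3, f1, f2, f3⟩ := hF z
  obtain ⟨g0, e1, e2, e3, g1, g2, g3⟩ := hG z
  have key : ∀ {a b p q : ℝ}, |a| ≤ p * F z → |b| ≤ q * G z → |a * b| ≤ p * q * (F z * G z) := by
    intro a b p q ha hb
    rw [abs_mul]
    calc |a| * |b| ≤ (p * F z) * (q * G z) := mul_le_mul ha hb (abs_nonneg _)
          ((abs_nonneg _).trans ha)
      _ = _ := by ring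
  have f0' : |F z| ≤ 1 * F z := by rw [abs_of_pos f0, one_mul]
  have g0' : |G z| ≤ 1 * G z := by rw [abs_of_pos g0, one_mul]
  refine ⟨mul_pos f0 g0, d1.fun_mul e1, (d2.fun_mul e1).fun_add (d1.fun_mul e2),
    ((d3.fun_mul e1).fun_add (d2.fun_mul e2)).fun_add ((d2.fun_mul e2).fun_add (d1.fun_mul e3)),
    ?_, ?_, ?_⟩
  · have h1 := key f1 g0'
    have h2 := key f0' g1
    have := abs_add_le (F₁ z * G z) (F z * G₁ z)
    nlinarith
  · have h1 := key f2 g0'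
    have h2 := key f1 g1
    have h3 := key f0' g2
    rw [abs_le] at h1 h2 h3 ⊢
    constructor <;> nlinarith
  · have h1 := key f3 g0'
    have h2 := key f2 g1
    have h3 := key f1 g2
    have h4 := key f0' g3
    rw [abs_le] at h1 h2 h3 h4 ⊢
    constructor <;> nlinarith

lemma tame_prod {ι : Type*} (s : Finset ι) (A : ι → ℝ) (F : ι → ℝ → ℝ)
    (h : ∀ i, Tame (A i) (F i)) : Tame (∑ i ∈ s, A i) fun z => ∏ i ∈ s, F i z := by
  classical
  induction s using Finset.induction_on with
  | empty => simpa using tame_const one_pos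
  | insert i s hi ih =>
    simp only [Finset.sum_insert hi, Finset.prod_insert hi]
    exact (h i).mul ih

lemma tame_sigmoid (a b : ℝ) : Tame |b| fun z => Real.sigmoid (a + b * z) := by
  have hd : ∀ z, HasDerivAt (fun z => Real.sigmoid (a + b * z))
      (b * (Real.sigmoid (a + b * z) * (1 - Real.sigmoid (a + b * z)))) z := fun z => by
    have h1 : HasDerivAt (fun z => a + b * z) b z := by
      simpa using ((hasDerivAt_id z).const_mul b).const_add a
    exact (HasDerivAt.comp (h₂ := Real.sigmoid) z (Real.hasDerivAt_sigmoid (a + b * z)) h1).congr_deriv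
      (mul_comm _ _)
  set p : ℝ → ℝ := fun z => Real.sigmoid (a + b * z) with hp
  refine ⟨fun z => b * (p z * (1 - p z)), fun z => b ^ 2 * (p z * ((1 - p z) * (1 - 2 * p z))),
    fun z => b ^ 3 * (p z * ((1 - p z) * (1 - 6 * p z + 6 * p z ^ 2))), fun z => ?_⟩
  have h0 : 0 < p z := Real.sigmoid_pos _
  have h1 : p z < 1 := Real.sigmoid_lt_one _
  have key : ∀ (k : ℕ) (q : ℝ), |q| ≤ 1 → |b ^ k * (p z * q)| ≤ |b| ^ k * p z := by
    intro k q hq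
    rw [abs_mul, abs_mul, abs_pow, abs_of_pos h0]
    have := mul_le_mul_of_nonneg_left hq h0.le
    gcongr
    linarith
  refine ⟨h0, hd z, ?_, ?_, ?_, ?_, ?_⟩
  · have h := ((hd z).fun_mul ((hd z).const_sub 1)).const_mul b
    exact h.congr_deriv (by ring)
  · have h := ((hd z).fun_mul (((hd z).const_sub 1).fun_mul
      (((hd z).const_mul 2).const_sub 1))).const_mul (b ^ 2)
    exact h.congr_deriv (by simp only [hp]; ring)
  · simpa using key 1 (1 - p z) (by rw [abs_le]; constructor <;> linarith)
  · exact key 2 _ (by rw [abs_le]; constructor <;> nlinarith)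
  · refine key 3 _ (by
      rw [abs_mul, abs_of_nonneg (by linarith : 0 ≤ 1 - p z)]
      have : |1 - 6 * p z + 6 * p z ^ 2| ≤ 1 := by rw [abs_le]; constructor <;> nlinarith [sq_nonneg (p z - 1 / 2)]
      have h3 := abs_nonneg (1 - 6 * p z + 6 * p z ^ 2)
      nlinarith)

variable {A : ℝ} {F : ℝ → ℝ}

lemma Tame.bounds (h : Tame A F) (z : ℝ) :
    F 0 * Real.exp (-(A * |z|)) ≤ F z ∧ F z ≤ F 0 * Real.exp (A * |z|) := by
  obtain ⟨F₁, F₂, F₃, h⟩ := h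
  have hl : ∀ x ∈ Set.univ, HasDerivWithinAt (fun x => Real.log (F x)) (F₁ x / F x) Set.univ x :=
    fun x _ => ((h x).2.1.log (h x).1.ne').hasDerivWithinAt
  have hb := convex_univ.norm_image_sub_le_of_norm_hasDerivWithin_le (C := A) hl (fun x _ => by
    rw [Real.norm_eq_abs, abs_div, abs_of_pos (h x).1, div_le_iff₀ (h x).1]
    exact (h x).2.2.2.2.1) (Set.mem_univ 0) (Set.mem_univ z)
  rw [Real.norm_eq_abs, Real.norm_eq_abs, sub_zero, abs_le] at hb
  have e1 := Real.exp_log (h z).1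
  have e0 := Real.exp_log (h 0).1
  constructor
  · rw [← e1, ← e0, ← Real.exp_add]
    exact Real.exp_le_exp.2 (by linarith)
  · rw [← e1, ← e0, ← Real.exp_add]
    exact Real.exp_le_exp.2 (by linarith)

/-- Integrating a pointwise derivative bound on a centred interval. -/
lemma abs_le_of_hasDerivAt_le {H H' : ℝ → ℝ} {z C : ℝ} (hd : ∀ y, HasDerivAt H (H' y) y)
    (h0 : H 0 = 0) (hC : ∀ y, |y| ≤ |z| → |H' y| ≤ C) : ∀ y, |y| ≤ |z| → |H y| ≤ C * |z| := by
  intro y hy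
  have hC0 : 0 ≤ C := (abs_nonneg _).trans (hC y hy)
  have hb := (convex_closedBall (0 : ℝ) |z|).norm_image_sub_le_of_norm_hasDerivWithin_le (C := C)
    (f := H) (f' := H') (fun x _ => (hd x).hasDerivWithinAt) (fun x hx => hC x (by simpa using hx))
    (x := 0) (y := y) (by simp) (by simpa using hy)
  rw [h0, sub_zero, sub_zero, Real.norm_eq_abs, Real.norm_eq_abs] at hb
  exact hb.trans (by gcongr)

lemma Tame.taylor (hA : 0 ≤ A) (h : Tame A F) : ∃ a b : ℝ, ∀ z,
    |F z - (F 0 + a * z + b * (z ^ 2 / 2))| ≤ A ^ 3 * F 0 * (Real.exp (A * |z|) * |z| ^ 3) := by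
  have hbd := h.bounds
  obtain ⟨F₁, F₂, F₃, h⟩ := h
  refine ⟨F₁ 0, F₂ 0, fun z => ?_⟩
  have h3 : ∀ y, |y| ≤ |z| → |F₃ y| ≤ A ^ 3 * F 0 * Real.exp (A * |z|) := by
    intro y hy
    refine (h y).2.2.2.2.2.2.trans ?_
    rw [mul_assoc]
    refine mul_le_mul_of_nonneg_left ((hbd y).2.trans ?_) (by positivity)
    have := (h 0).1
    gcongr
  have h2 := abs_le_of_hasDerivAt_le (H := fun y => F₂ y - F₂ 0) (z := z)
    (fun y => (h y).2.2.2.1.sub_const _) (sub_self _) h3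
  have h1 := abs_le_of_hasDerivAt_le (H := fun y => F₁ y - (F₁ 0 + F₂ 0 * y)) (z := z)
    (fun y => (h y).2.2.1.fun_sub ((((hasDerivAt_id y).const_mul (F₂ 0)).const_add (F₁ 0)).congr_deriv
      (mul_one _))) (by simp) h2
  have h0 := abs_le_of_hasDerivAt_le (H := fun y => F y - (F 0 + F₁ 0 * y + F₂ 0 * (y ^ 2 / 2)))
    (z := z) (fun y => (h y).2.1.fun_sub ((((hasDerivAt_id y).const_mul (F₁ 0)).const_add (F 0)).fun_add
      (((hasDerivAt_pow 2 y).div_const 2).const_mul (F₂ 0)) |>.congr_deriv (by simp)))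
      (by simp) h1 z le_rfl
  refine h0.trans (le_of_eq (by ring))

lemma integrable_id_stdGaussian : Integrable (fun z : ℝ => z) (gaussianReal 0 1) :=
  (memLp_id_gaussianReal 1).integrable le_rfl

lemma integrable_sq_stdGaussian : Integrable (fun z : ℝ => z ^ 2) (gaussianReal 0 1) :=
  (memLp_id_gaussianReal 2).integrable_sq

lemma integral_sq_stdGaussian : ∫ z : ℝ, z ^ 2 ∂gaussianReal 0 1 = 1 := by
  have h := variance_fun_id_gaussianReal (μ := 0) (v := 1)
  rw [variance_of_integral_eq_zero (by fun_prop) (by simp)] at h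
  simpa using h

lemma integral_exp_mul_stdGaussian (c : ℝ) :
    ∫ z : ℝ, Real.exp (c * z) ∂gaussianReal 0 1 = Real.exp (c ^ 2 / 2) := by
  have h := congrFun (mgf_fun_id_gaussianReal (μ := 0) (v := 1)) c
  simpa [mgf] using h

lemma Tame.integrable (h : Tame A F) : Integrable F (gaussianReal 0 1) := by
  refine Integrable.mono' (((integrable_exp_mul_gaussianReal A).add
    (integrable_exp_mul_gaussianReal (-A))).const_mul (F 0)) h.continuous.aestronglyMeasurable
    (Filter.Eventually.of_forall fun z => ?_)
  rw [Real.norm_eq_abs, abs_of_pos (h.pos z)]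
  refine (h.bounds z).2.trans (mul_le_mul_of_nonneg_left ?_ (h.pos 0).le)
  simp only [Pi.add_apply]
  rcases abs_cases z with ⟨hz, _⟩ | ⟨hz, _⟩ <;> rw [hz]
  · have := Real.exp_pos (-A * z); linarith
  · have := Real.exp_pos (A * z)
    rw [show A * -z = -A * z by ring]; linarith

lemma Tame.zero_le_integral (hA : 0 ≤ A) (h : Tame A F) :
    F 0 ≤ Real.exp A * ∫ z, F z ∂gaussianReal 0 1 := by
  have h1 : ∀ z, F 0 * Real.exp (-A) * (1 - A / 2 * (z ^ 2 - 1)) ≤ F z := by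
    intro z
    refine le_trans ?_ (h.bounds z).1
    rw [mul_assoc]
    refine mul_le_mul_of_nonneg_left ?_ (h.pos 0).le
    have h2 := Real.add_one_le_exp (-(A / 2 * (z ^ 2 - 1)))
    calc Real.exp (-A) * (1 - A / 2 * (z ^ 2 - 1))
        ≤ Real.exp (-A) * Real.exp (-(A / 2 * (z ^ 2 - 1))) := by gcongr; linarith
      _ ≤ Real.exp (-(A * |z|)) := by
        rw [← Real.exp_add]
        refine Real.exp_le_exp.2 ?_
        nlinarith [mul_nonneg hA (sq_nonneg (|z| - 1)), sq_abs z]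
  have hs1 : Integrable (fun z : ℝ => z ^ 2 - 1) (gaussianReal 0 1) :=
    integrable_sq_stdGaussian.sub (integrable_const 1)
  have hs : Integrable (fun z : ℝ => A / 2 * (z ^ 2 - 1)) (gaussianReal 0 1) := hs1.const_mul _
  have hi : Integrable (fun z : ℝ => F 0 * Real.exp (-A) * (1 - A / 2 * (z ^ 2 - 1)))
      (gaussianReal 0 1) :=
    ((integrable_const 1).sub hs).const_mul _
  have h3 := integral_mono hi (h.integrable) h1
  rw [integral_const_mul, integral_sub (integrable_const 1) hs, integral_const_mul,
    integral_sub integrable_sq_stdGaussian (integrable_const 1), integral_sq_stdGaussian] at h3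
  simp only [integral_const, probReal_univ, smul_eq_mul, mul_one, sub_self, mul_zero,
    sub_zero] at h3
  calc F 0 = Real.exp A * (F 0 * Real.exp (-A)) := by
        rw [mul_left_comm, ← Real.exp_add]; simp
    _ ≤ _ := by gcongr

lemma Tame.integral_sub_le (hA : 0 ≤ A) (hA1 : A ≤ 1) (h : Tame A F) :
    |∫ z, F z ∂gaussianReal 0 1 - (F 1 + F (-1)) / 2| ≤ 100 * A ^ 3 * F 0 := by
  obtain ⟨a, b, hT⟩ := h.taylor hA
  have h0 := h.pos 0
  have hE : Real.exp 2 ≤ 7.39 := by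
    have := Real.exp_one_lt_d9
    rw [show (2 : ℝ) = 1 + 1 by norm_num, Real.exp_add]
    nlinarith [Real.exp_pos 1]
  set Q : ℝ → ℝ := fun z => F 0 + a * z + b * (z ^ 2 / 2) with hQ
  set R : ℝ → ℝ := fun z => 6 * (A ^ 3 * F 0) * (Real.exp (2 * z) + Real.exp (-2 * z)) with hR
  have hle : ∀ z, |F z - Q z| ≤ R z := by
    intro z
    refine (hT z).trans ?_
    have h1 : Real.exp (A * |z|) * |z| ^ 3 ≤ 6 * Real.exp (2 * |z|) := by
      have h2 : |z| ^ 3 / 6 ≤ Real.exp |z| := by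
        simpa [Nat.factorial] using Real.pow_div_factorial_le_exp |z| (abs_nonneg z) 3
      have h3 : Real.exp (A * |z|) ≤ Real.exp |z| :=
        Real.exp_le_exp.2 (by nlinarith [abs_nonneg z])
      calc _ ≤ Real.exp |z| * (6 * Real.exp |z|) := by
            gcongr; linarith
        _ = _ := by rw [two_mul, Real.exp_add]; ring
    have h4 : Real.exp (2 * |z|) ≤ Real.exp (2 * z) + Real.exp (-2 * z) := by
      rcases abs_cases z with ⟨hz, _⟩ | ⟨hz, _⟩ <;> rw [hz]
      · have := Real.exp_pos (-2 * z); linarith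
      · have := Real.exp_pos (2 * z)
        rw [show 2 * -z = -2 * z by ring]; linarith
    calc _ ≤ A ^ 3 * F 0 * (6 * (Real.exp (2 * z) + Real.exp (-2 * z))) := by
          refine mul_le_mul_of_nonneg_left ?_ (by positivity)
          linarith
      _ = R z := by simp only [hR]; ring
  have hRi : Integrable R (gaussianReal 0 1) := ((integrable_exp_mul_gaussianReal 2).add
    (integrable_exp_mul_gaussianReal (-2))).const_mul _
  have hQ1 : Integrable (fun z : ℝ => F 0 + a * z) (gaussianReal 0 1) :=
    (integrable_const _).add (integrable_id_stdGaussian.const_mul a)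
  have hQ2 : Integrable (fun z : ℝ => b * (z ^ 2 / 2)) (gaussianReal 0 1) :=
    (integrable_sq_stdGaussian.div_const 2).const_mul b
  have hQi : Integrable Q (gaussianReal 0 1) := hQ1.add hQ2
  have hQint : ∫ z, Q z ∂gaussianReal 0 1 = F 0 + b / 2 := by
    simp only [hQ]
    rw [integral_add hQ1 hQ2, integral_add (integrable_const _)
      (integrable_id_stdGaussian.const_mul a), integral_const_mul, integral_const_mul,
      integral_div, integral_sq_stdGaussian, integral_id_gaussianReal]
    simp
    ring
  have hRint : ∫ z, R z ∂gaussianReal 0 1 = 12 * (A ^ 3 * F 0) * Real.exp 2 := by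
    simp only [hR]
    rw [integral_const_mul, integral_add (integrable_exp_mul_gaussianReal 2)
      (integrable_exp_mul_gaussianReal (-2)), integral_exp_mul_stdGaussian,
      integral_exp_mul_stdGaussian]
    norm_num
    ring
  have h1 : |∫ z, F z ∂gaussianReal 0 1 - (F 0 + b / 2)| ≤ 12 * (A ^ 3 * F 0) * Real.exp 2 := by
    rw [← hQint, ← integral_sub (h.integrable) hQi, ← hRint]
    exact (abs_integral_le_integral_abs).trans
      (integral_mono ((h.integrable).sub hQi).abs hRi hle)
  have hA3 : 0 ≤ A ^ 3 * F 0 := by positivity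
  have h2 : |F 1 - (F 0 + a + b / 2)| ≤ A ^ 3 * F 0 * 3 := by
    have := hT 1
    simp only [mul_one, one_pow, abs_one, mul_one] at this
    rw [show b * (1 / 2) = b / 2 by ring] at this
    refine this.trans (mul_le_mul_of_nonneg_left ?_ hA3)
    have := Real.exp_one_lt_d9
    have := Real.exp_le_exp.2 hA1
    linarith
  have h3 : |F (-1) - (F 0 - a + b / 2)| ≤ A ^ 3 * F 0 * 3 := by
    have := hT (-1)
    simp only [abs_neg, mul_neg, mul_one, one_pow, abs_one, mul_one, even_two, Even.neg_pow] at this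
    rw [show b * (1 / 2) = b / 2 by ring, ← sub_eq_add_neg] at this
    refine this.trans (mul_le_mul_of_nonneg_left ?_ hA3)
    have := Real.exp_one_lt_d9
    have := Real.exp_le_exp.2 hA1
    linarith
  rw [abs_le] at h1 h2 h3 ⊢
  constructor <;> nlinarith

lemma Tame.compare (hA : 0 ≤ A) (hA1 : A ≤ 1) (h : Tame A F) :
    (F 1 + F (-1)) / 2 ≤ Real.exp (300 * A ^ 3) * ∫ z, F z ∂gaussianReal 0 1 ∧
    ∫ z, F z ∂gaussianReal 0 1 ≤ Real.exp (300 * A ^ 3) * ((F 1 + F (-1)) / 2) := by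
  have h1 := h.integral_sub_le hA hA1
  have h2 := h.zero_le_integral hA
  have h0 := h.pos 0
  have hb1 := (h.bounds 1).1
  have hb2 := (h.bounds (-1)).1
  simp only [abs_one, abs_neg, mul_one] at hb1 hb2
  have he : Real.exp A ≤ 3 := by
    have := Real.exp_one_lt_d9
    have := Real.exp_le_exp.2 hA1
    linarith
  have hinv : Real.exp A * Real.exp (-A) = 1 := by rw [← Real.exp_add]; simp
  have hD : F 0 ≤ 3 * ((F 1 + F (-1)) / 2) := by
    have : F 0 * Real.exp (-A) ≤ (F 1 + F (-1)) / 2 := by linarith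
    calc F 0 = Real.exp A * (F 0 * Real.exp (-A)) := by rw [mul_left_comm, hinv, mul_one]
      _ ≤ 3 * (F 0 * Real.exp (-A)) := by gcongr
      _ ≤ _ := by gcongr
  have hI : F 0 ≤ 3 * ∫ z, F z ∂gaussianReal 0 1 := by
    have : 0 ≤ ∫ z, F z ∂gaussianReal 0 1 := integral_nonneg fun z => (h.pos z).le
    nlinarith
  have hA3 : 0 ≤ A ^ 3 := by positivity
  have hexp := Real.add_one_le_exp (300 * A ^ 3)
  have hF : 100 * A ^ 3 * F 0 ≤ 300 * A ^ 3 * ∫ z, F z ∂gaussianReal 0 1 := by nlinarith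
  have hF' : 100 * A ^ 3 * F 0 ≤ 300 * A ^ 3 * ((F 1 + F (-1)) / 2) := by nlinarith
  rw [abs_le] at h1
  have := h.pos 1
  have := h.pos (-1)
  constructor
  · calc _ ≤ (300 * A ^ 3 + 1) * ∫ z, F z ∂gaussianReal 0 1 := by linarith
      _ ≤ _ := by gcongr; linarith
  · calc _ ≤ (300 * A ^ 3 + 1) * ((F 1 + F (-1)) / 2) := by linarith
      _ ≤ _ := by gcongr

end Tame

section Compare

lemma ofReal_integral_of_mem_unit {α : Type*} [MeasurableSpace α] (m : Measure α)
    [IsProbabilityMeasure m] {g : α → ℝ} (hg : Measurable g) (hg0 : ∀ x, 0 ≤ g x)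
    (hg1 : ∀ x, g x ≤ 1) : ENNReal.ofReal (∫ x, g x ∂m) = ∫⁻ x, ENNReal.ofReal (g x) ∂m := by
  refine ofReal_integral_eq_lintegral_ofReal ?_ (Filter.Eventually.of_forall hg0)
  refine Integrable.of_bound hg.aestronglyMeasurable 1 (Filter.Eventually.of_forall fun x => ?_)
  rw [Real.norm_eq_abs, abs_of_nonneg (hg0 x)]
  exact hg1 x

variable {ι : Type*}

lemma lmarginal_le_mul_lmarginal [DecidableEq ι] {μ ν : ι → Measure ℝ} [∀ i, IsProbabilityMeasure (μ i)]
    [∀ i, IsProbabilityMeasure (ν i)] (η : ι → ENNReal) (s : Finset ι) :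
    ∀ {f : (ι → ℝ) → ENNReal}, Measurable f →
    (∀ i x, ∫⁻ z, f (Function.update x i z) ∂μ i ≤ η i * ∫⁻ z, f (Function.update x i z) ∂ν i) →
    ∀ x, lmarginal μ s f x ≤ (∏ i ∈ s, η i) * lmarginal ν s f x := by
  have hup : ∀ i, Measurable fun p : (ι → ℝ) × ℝ => Function.update p.1 i p.2 := fun i => by
    refine measurable_pi_lambda _ fun j => ?_
    by_cases h : j = i
    · subst h; simpa using measurable_snd
    · simp only [Function.update_of_ne h]; fun_prop
  induction s using Finset.induction_on with
  | empty => intro f hf h x; simp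
  | insert i s hi ih =>
    intro f hf h x
    have hfi : Measurable fun x => ∫⁻ z, f (Function.update x i z) ∂ν i :=
      (hf.comp (hup i)).lintegral_prod_right'
    have hfm : Measurable fun x => ∫⁻ z, f (Function.update x i z) ∂μ i :=
      (hf.comp (hup i)).lintegral_prod_right'
    rw [lmarginal_insert' _ hf hi, lmarginal_insert _ hf hi, Finset.prod_insert hi]
    calc lmarginal μ s (fun x => ∫⁻ z, f (Function.update x i z) ∂μ i) x
        ≤ lmarginal μ s (fun x => η i * ∫⁻ z, f (Function.update x i z) ∂ν i) x :=
          lmarginal_mono (fun x => h i x) x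
      _ = η i * ∫⁻ z, lmarginal μ s f (Function.update x i z) ∂ν i := by
          rw [show ∫⁻ z, lmarginal μ s f (Function.update x i z) ∂ν i =
            lmarginal μ s (fun x => ∫⁻ z, f (Function.update x i z) ∂ν i) x from ?_]
          · unfold lmarginal
            exact lintegral_const_mul (η i) (hfi.comp measurable_updateFinset)
          · set m := Function.update μ i (ν i) with hm
            have hmi : ∀ j, IsProbabilityMeasure (m j) := fun j => by
              by_cases hj : j = i
              · subst hj; rw [hm, Function.update_self]; infer_instance
              · rw [hm, Function.update_of_ne hj]; infer_instance
            have hms : ∀ g, lmarginal m s g = lmarginal μ s g := fun g => by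
              unfold lmarginal
              have : (fun j : s => m j) = fun j : s => μ j := funext fun j => by
                have hj : (j : ι) ≠ i := fun h => hi (h ▸ j.2)
                rw [hm, Function.update_of_ne hj]
              rw [this]
            have h1 := lmarginal_insert (μ := m) _ hf hi x
            have h2 := congrFun (lmarginal_insert' (μ := m) _ hf hi) x
            have hmm : m i = ν i := by rw [hm, Function.update_self]
            simp only [hms, hmm] at h1 h2
            rw [← h1, h2]
      _ ≤ η i * ∫⁻ z, (∏ i ∈ s, η i) * lmarginal ν s f (Function.update x i z) ∂ν i := by
          gcongr
          exact ih hf h _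
      _ = _ := by
          have h3 : ∫⁻ z, (∏ i ∈ s, η i) * lmarginal ν s f (Function.update x i z) ∂ν i = _ :=
            lintegral_const_mul _ ((hf.lmarginal ν).comp (measurable_update x))
          rw [h3, mul_assoc]

variable [Fintype ι]

lemma integral_pi_le_mul [DecidableEq ι] {μ ν : ι → Measure ℝ} [∀ i, IsProbabilityMeasure (μ i)]
    [∀ i, IsProbabilityMeasure (ν i)] (e : ι → ℝ) {f : (ι → ℝ) → ℝ} (hf : Continuous f)
    (h0 : ∀ x, 0 ≤ f x) (h1 : ∀ x, f x ≤ 1)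
    (h : ∀ i x, ∫ z, f (Function.update x i z) ∂μ i ≤
      Real.exp (e i) * ∫ z, f (Function.update x i z) ∂ν i) :
    ∫ x, f x ∂Measure.pi μ ≤ Real.exp (∑ i, e i) * ∫ x, f x ∂Measure.pi ν := by
  have hfu : ∀ i x, Continuous fun z => f (Function.update x i z) := fun i x =>
    hf.comp (continuous_const.update i continuous_id)
  have key := lmarginal_le_mul_lmarginal (μ := μ) (ν := ν) (fun i => ENNReal.ofReal (Real.exp (e i)))
    Finset.univ (f := fun x => ENNReal.ofReal (f x)) (by fun_prop) (fun i x => by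
      rw [← ofReal_integral_of_mem_unit _ (hfu i x).measurable (fun _ => h0 _) fun _ => h1 _,
        ← ofReal_integral_of_mem_unit _ (hfu i x).measurable (fun _ => h0 _) fun _ => h1 _, ← ENNReal.ofReal_mul (by positivity)]
      exact ENNReal.ofReal_le_ofReal (h i x)) 0
  rw [lmarginal_univ, lmarginal_univ, ← ENNReal.ofReal_prod_of_nonneg (fun _ _ => by positivity)]
    at key
  beta_reduce at key
  rw [← ofReal_integral_of_mem_unit _ hf.measurable h0 h1,
    ← ofReal_integral_of_mem_unit _ hf.measurable h0 h1, ← ENNReal.ofReal_mul (by positivity),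
    ENNReal.ofReal_le_ofReal_iff (mul_nonneg (by positivity) (integral_nonneg h0)),
    ← Real.exp_sum] at key
  exact key

/-- The law of `w` times a random sign. -/
noncomputable def signLaw (w : ℝ) : Measure ℝ :=
  (2⁻¹ : ENNReal) • ∑ b : Bool, Measure.dirac (w * spin b)

instance (w : ℝ) : IsProbabilityMeasure (signLaw w) := ⟨by
  simp only [signLaw, Measure.smul_apply, Fintype.sum_bool, Measure.add_apply, measure_univ,
    smul_eq_mul]
  rw [one_add_one_eq_two, ENNReal.inv_mul_cancel (by simp) (by simp)]⟩

lemma integral_signLaw (w : ℝ) (f : ℝ → ℝ) :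
    ∫ z, f z ∂signLaw w = (f w + f (-w)) / 2 := by
  rw [signLaw, integral_smul_measure, integral_finsetSum_measure (fun _ _ => integrable_dirac (by simp))]
  simp
  ring

lemma integral_pi_signLaw [DecidableEq ι] (w : ι → ℝ) (f : (ι → ℝ) → ℝ) :
    ∫ z, f z ∂Measure.pi (fun i => signLaw (w i)) = 𝔼 x : ι → Bool, f fun i => w i * spin (x i) := by
  have h : Measure.pi (fun i => signLaw (w i)) = (2⁻¹ ^ Fintype.card ι : ENNReal) •
      ∑ x : ι → Bool, Measure.dirac fun i => w i * spin (x i) := by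
    refine Measure.pi_eq fun s hs => ?_
    simp only [signLaw, Measure.smul_apply, Measure.finsetSum_apply, smul_eq_mul,
      Finset.prod_mul_distrib, Finset.prod_const, Finset.card_univ]
    congr 1
    rw [Finset.prod_univ_sum, Fintype.piFinset_univ]
    refine Finset.sum_congr rfl fun x _ => ?_
    rw [Measure.dirac_apply' _ (MeasurableSet.univ_pi hs)]
    simp only [Measure.dirac_apply' _ (hs _)]
    by_cases hx : ∀ i, w i * spin (x i) ∈ s i
    · rw [Set.indicator_of_mem (Set.mem_univ_pi.2 hx), Finset.prod_eq_one fun i _ => by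
        rw [Set.indicator_of_mem (hx i), Pi.one_apply], Pi.one_apply]
    · obtain ⟨i, hi⟩ := not_forall.1 hx
      rw [Set.indicator_of_notMem fun h => hx (Set.mem_univ_pi.1 h),
        Finset.prod_eq_zero (Finset.mem_univ i) (Set.indicator_of_notMem hi _)]
  rw [h, integral_smul_measure, integral_finsetSum_measure (fun _ _ => integrable_dirac (by simp)),
    Finset.expect_eq_sum_div_card]
  simp [div_eq_inv_mul]

variable {R : Type*} [Fintype R]

lemma tame_prod_sigmoid_update [DecidableEq ι] (a : R → ℝ) (c : R → ι → ℝ) (i : ι) (x : ι → ℝ) :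
    Tame (∑ r, |c r i|)
      fun z => ∏ r, Real.sigmoid (a r + ∑ j, c r j * Function.update x i z j) := by
  have h := tame_prod Finset.univ (fun r => |c r i|)
    (fun r z => Real.sigmoid ((a r + ∑ j ∈ Finset.univ.erase i, c r j * x j) + c r i * z))
    fun r => tame_sigmoid _ _
  convert h using 4 with z r
  rw [← Finset.add_sum_erase _ _ (Finset.mem_univ i), Function.update_self,
    Finset.sum_congr rfl fun j hj => by rw [Function.update_of_ne (Finset.ne_of_mem_erase hj)]]
  ring

lemma continuous_prod_sigmoid (a : R → ℝ) (c : R → ι → ℝ) :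
    Continuous fun z : ι → ℝ => ∏ r, Real.sigmoid (a r + ∑ j, c r j * z j) :=
  continuous_finsetProd _ fun r _ => continuous_sigmoid.comp (by fun_prop)

lemma prod_sigmoid_nonneg (b : R → ℝ) : 0 ≤ ∏ r, Real.sigmoid (b r) :=
  Finset.prod_nonneg fun _ _ => (Real.sigmoid_pos _).le

lemma prod_sigmoid_le_one (b : R → ℝ) : ∏ r, Real.sigmoid (b r) ≤ 1 :=
  Finset.prod_le_one (fun _ _ => (Real.sigmoid_pos _).le) fun _ _ => (Real.sigmoid_lt_one _).le

theorem expect_prod_sigmoid_le [DecidableEq ι] (a : R → ℝ) (c : R → ι → ℝ) (w : ι → ℝ)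
    (hw : ∀ i, w i = 0 ∨ w i = 1 ∧ ∑ r, |c r i| ≤ 1) :
    𝔼 x : ι → Bool, ∏ r, Real.sigmoid (a r + ∑ i, c r i * (w i * spin (x i))) ≤
      Real.exp (∑ i, if w i = 0 then ∑ r, |c r i| else 300 * (∑ r, |c r i|) ^ 3) *
        ∫ z, ∏ r, Real.sigmoid (a r + ∑ i, c r i * z i) ∂Measure.pi fun _ : ι => gaussianReal 0 1 := by
  rw [← integral_pi_signLaw w fun z => ∏ r, Real.sigmoid (a r + ∑ i, c r i * z i)]
  refine integral_pi_le_mul _ (continuous_prod_sigmoid a c) (fun x => prod_sigmoid_nonneg _)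
    (fun x => prod_sigmoid_le_one _) fun i x => ?_
  have hA : 0 ≤ ∑ r, |c r i| := Finset.sum_nonneg fun _ _ => abs_nonneg _
  have ht := tame_prod_sigmoid_update a c i x
  rw [integral_signLaw]
  rcases hw i with h | ⟨h, h1⟩
  · rw [if_pos h, h, neg_zero, add_self_div_two]
    exact ht.zero_le_integral hA
  · rw [if_neg (by rw [h]; exact one_ne_zero), h]
    exact (ht.compare hA h1).1

theorem integral_prod_sigmoid_le [DecidableEq ι] (a : R → ℝ) (c : R → ι → ℝ)
    (hc : ∀ i, ∑ r, |c r i| ≤ 1) :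
    ∫ z, ∏ r, Real.sigmoid (a r + ∑ i, c r i * z i) ∂(Measure.pi fun _ : ι => gaussianReal 0 1) ≤
      Real.exp (∑ i, 300 * (∑ r, |c r i|) ^ 3) *
        𝔼 x : ι → Bool, ∏ r, Real.sigmoid (a r + ∑ i, c r i * spin (x i)) := by
  have h2 := integral_pi_signLaw (fun _ => 1) fun z : ι → ℝ =>
    ∏ r, Real.sigmoid (a r + ∑ i, c r i * z i)
  simp only [one_mul] at h2
  rw [← h2]
  refine integral_pi_le_mul _ (continuous_prod_sigmoid a c) (fun x => prod_sigmoid_nonneg _)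
    (fun x => prod_sigmoid_le_one _) fun i x => ?_
  rw [integral_signLaw]
  exact ((tame_prod_sigmoid_update a c i x).compare
    (Finset.sum_nonneg fun _ _ => abs_nonneg _) (hc i)).2

end Compare

section GaussianLaw

variable {R ι κ : Type*} [Fintype R] [Fintype ι] [Fintype κ]

/-- The standard Gaussian measure on a finite product of lines. -/
noncomputable abbrev stdPi (ι : Type*) [Fintype ι] : Measure (ι → ℝ) :=
  Measure.pi fun _ : ι => gaussianReal 0 1

lemma charFun_map_linear_stdPi (c : R → ι → ℝ) (t : EuclideanSpace ℝ R) :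
    charFun ((stdPi ι).map fun z => WithLp.toLp 2 fun r => ∑ i, c r i * z i) t =
      Complex.exp (-((∑ r, ∑ s, t r * t s * ∑ i, c r i * c s i : ℝ) : ℂ) / 2) := by
  set u : EuclideanSpace ℝ ι := WithLp.toLp 2 fun i => ∑ r, t r * c r i with hu
  have h1 := charFun_stdGaussian (E := EuclideanSpace ℝ ι) u
  rw [← map_pi_eq_stdGaussian, charFun_apply, integral_map (by fun_prop) (by fun_prop)] at h1
  rw [charFun_apply, integral_map (Measurable.aemeasurable (by fun_prop)) (by fun_prop)]
  have h2 : ∀ z : ι → ℝ, inner ℝ (WithLp.toLp 2 fun r => ∑ i, c r i * z i) t =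
      inner ℝ (WithLp.toLp 2 z) u := fun z => by
    simp only [PiLp.inner_apply, hu, RCLike.inner_apply, conj_trivial, Finset.mul_sum, Finset.sum_mul]
    rw [Finset.sum_comm]
    exact Finset.sum_congr rfl fun i _ => Finset.sum_congr rfl fun r _ => by ring
  simp only [h2]
  rw [h1, ← Complex.ofReal_pow, EuclideanSpace.real_norm_sq_eq]
  congr 4
  simp_rw [hu, sq, Finset.sum_mul_sum]
  simp only [Finset.mul_sum]
  rw [Finset.sum_comm]
  refine Finset.sum_congr rfl fun r _ => ?_
  rw [Finset.sum_comm]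
  exact Finset.sum_congr rfl fun i _ => Finset.sum_congr rfl fun r _ => by ring

/-- The law of a Gaussian vector is determined by its Gram matrix. -/
theorem integral_linear_stdPi_congr (c : R → ι → ℝ) (c' : R → κ → ℝ)
    (h : ∀ r s, ∑ i, c r i * c s i = ∑ j, c' r j * c' s j) {f : (R → ℝ) → ℝ} (hf : Measurable f) :
    ∫ z, f (fun r => ∑ i, c r i * z i) ∂stdPi ι = ∫ z, f (fun r => ∑ j, c' r j * z j) ∂stdPi κ := by
  have hmap : ((stdPi ι).map fun z => WithLp.toLp 2 fun r => ∑ i, c r i * z i) =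
      (stdPi κ).map fun z => WithLp.toLp 2 fun r => ∑ j, c' r j * z j := by
    have h1 : IsProbabilityMeasure
        ((stdPi ι).map fun z => WithLp.toLp 2 fun r => ∑ i, c r i * z i) :=
      Measure.isProbabilityMeasure_map (Measurable.aemeasurable (by fun_prop))
    have h2 : IsProbabilityMeasure
        ((stdPi κ).map fun z => WithLp.toLp 2 fun r => ∑ j, c' r j * z j) :=
      Measure.isProbabilityMeasure_map (Measurable.aemeasurable (by fun_prop))
    refine Measure.ext_of_charFun (E := EuclideanSpace ℝ R) (funext fun t => ?_)
    simp only [charFun_map_linear_stdPi, h]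
  have e1 := integral_map (μ := stdPi ι) (φ := fun z => WithLp.toLp 2 fun r => ∑ i, c r i * z i)
    (Measurable.aemeasurable (by fun_prop)) (f := fun y : EuclideanSpace ℝ R => f (WithLp.ofLp y))
    (Measurable.aestronglyMeasurable (by fun_prop))
  have e2 := integral_map (μ := stdPi κ) (φ := fun z => WithLp.toLp 2 fun r => ∑ i, c' r i * z i)
    (Measurable.aemeasurable (by fun_prop)) (f := fun y : EuclideanSpace ℝ R => f (WithLp.ofLp y))
    (Measurable.aestronglyMeasurable (by fun_prop))
  rw [← hmap, e1] at e2
  exact e2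

end GaussianLaw

section Anderson

/-- Among intervals of a given length, the centred one has the largest Gaussian measure. -/
lemma gaussianReal_Icc_le (x m : ℝ) :
    gaussianReal 0 1 (Set.Icc (x - m) (x + m)) ≤ gaussianReal 0 1 (Set.Icc (-m) m) := by
  set I := Set.Icc (x - m) (x + m)
  set J := Set.Icc (-m) m
  have hI : MeasurableSet I := measurableSet_Icc
  have hJ : MeasurableSet J := measurableSet_Icc
  have hpdf : ∀ {y z : ℝ}, |y| ≤ |z| → gaussianPDF 0 1 z ≤ gaussianPDF 0 1 y := by
    intro y z h
    refine ENNReal.ofReal_le_ofReal ?_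
    simp only [gaussianPDFReal, sub_zero]
    have := sq_le_sq.2 h
    gcongr
  have hvol : volume (I \ J) = volume (J \ I) := by
    have h1 := measure_inter_add_sdiff (μ := (volume : Measure ℝ)) I hJ
    have h2 := measure_inter_add_sdiff (μ := (volume : Measure ℝ)) J hI
    have h3 : volume I = volume J := by simp only [I, J, Real.volume_Icc]; ring_nf
    rw [Set.inter_comm, ← h2.trans h3.symm] at h1
    exact (ENNReal.add_right_inj (ne_top_of_le_ne_top (by simp [J] : volume J ≠ ⊤)
      (measure_mono Set.inter_subset_left))).1 h1
  have hle : gaussianReal 0 1 (I \ J) ≤ gaussianReal 0 1 (J \ I) := by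
    rw [gaussianReal_apply _ one_ne_zero, gaussianReal_apply _ one_ne_zero]
    calc ∫⁻ z in I \ J, gaussianPDF 0 1 z ≤ ∫⁻ _ in I \ J, gaussianPDF 0 1 m :=
          setLIntegral_mono measurable_const fun z hz => hpdf (by
            have h := hz.1.1.trans hz.1.2
            have h' := hz.2
            simp only [J, Set.mem_Icc, ← abs_le, not_le] at h'
            rw [abs_of_nonneg (by linarith [hz.1.1, hz.1.2] : 0 ≤ m)]
            exact h'.le)
      _ = ∫⁻ _ in J \ I, gaussianPDF 0 1 m := by
          rw [setLIntegral_const, setLIntegral_const, hvol]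
      _ ≤ ∫⁻ z in J \ I, gaussianPDF 0 1 z :=
          setLIntegral_mono (measurable_gaussianPDF 0 1) fun z hz =>
            hpdf ((abs_le.2 hz.1).trans (le_abs_self m))
  rw [← measure_inter_add_sdiff I hJ, ← measure_inter_add_sdiff J hI, Set.inter_comm]
  gcongr

lemma gauss2_shift_le (T a b c : ℝ) (hb : 0 < b) :
    gauss2 {p : ℝ × ℝ | T ≤ a * p.1 + b * p.2 + c ∧ T ≤ a * p.1 - b * p.2 - c} ≤
      gauss2 {p : ℝ × ℝ | T ≤ a * p.1 + b * p.2 ∧ T ≤ a * p.1 - b * p.2} := by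
  have hm : ∀ c : ℝ, MeasurableSet
      {p : ℝ × ℝ | T ≤ a * p.1 + b * p.2 + c ∧ T ≤ a * p.1 - b * p.2 - c} := fun c =>
    MeasurableSet.inter (s₁ := {p : ℝ × ℝ | T ≤ a * p.1 + b * p.2 + c})
      (s₂ := {p : ℝ × ℝ | T ≤ a * p.1 - b * p.2 - c})
      (measurableSet_le (by fun_prop) (by fun_prop)) (measurableSet_le (by fun_prop) (by fun_prop))
  have hs : ∀ c g : ℝ, Prod.mk g ⁻¹' {p : ℝ × ℝ | T ≤ a * p.1 + b * p.2 + c ∧ T ≤ a * p.1 - b * p.2 - c}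
      = Set.Icc (-c / b - (a * g - T) / b) (-c / b + (a * g - T) / b) := by
    intro c g
    ext h
    simp only [Set.mem_preimage, Set.mem_ofPred_eq, Set.mem_Icc]
    rw [div_sub_div_same, ← add_div, div_le_iff₀ hb, le_div_iff₀ hb]
    constructor <;> rintro ⟨h1, h2⟩ <;> constructor <;> linarith
  have h0 := hm 0
  have hs0 := hs 0
  simp only [add_zero, sub_zero, neg_zero, zero_div, zero_sub, zero_add] at h0 hs0
  rw [gauss2, Measure.prod_apply (hm c), Measure.prod_apply h0]
  refine lintegral_mono fun g => ?_
  rw [hs, hs0]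
  exact gaussianReal_Icc_le _ _

end Anderson

section SplitPi

variable {α β : Type*} [Fintype α] [Fintype β]

lemma integral_stdPi_sum (f : (α ⊕ β → ℝ) → ℝ) (hf : Integrable f (stdPi (α ⊕ β))) :
    ∫ z, f z ∂stdPi (α ⊕ β) = ∫ y, ∫ x, f (Sum.elim x y) ∂stdPi α ∂stdPi β := by
  have hmp := measurePreserving_sumPiEquivProdPi_symm (fun _ : α ⊕ β => gaussianReal 0 1)
  have h1 := hmp.integral_comp' f
  have h2 := (hmp.integrable_comp_emb
    (MeasurableEquiv.sumPiEquivProdPi fun _ : α ⊕ β => ℝ).symm.measurableEmbedding).2 hf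
  rw [← h1]
  exact integral_prod_symm _ h2

lemma integral_stdPi_unit (f : (Unit → ℝ) → ℝ) :
    ∫ z, f z ∂stdPi Unit = ∫ x, f (fun _ => x) ∂gaussianReal 0 1 := by
  have h := (measurePreserving_funUnique (gaussianReal 0 1) Unit).symm
  exact (h.integral_comp' f).symm

end SplitPi

section SigmoidStep

variable {l T r τ : ℝ}

lemma one_le_mul_sigmoid (hl : 0 ≤ l) (hr : T + τ ≤ r) :
    1 ≤ Real.exp (Real.exp (-(l * τ))) * Real.sigmoid (l * (r - T)) := by
  rw [Real.sigmoid_def, ← div_eq_mul_inv, one_le_div (by positivity)]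
  have h1 := Real.add_one_le_exp (Real.exp (-(l * τ)))
  have h2 : Real.exp (-(l * (r - T))) ≤ Real.exp (-(l * τ)) := by
    refine Real.exp_le_exp.2 (neg_le_neg (mul_le_mul_of_nonneg_left ?_ hl))
    linarith
  linarith

lemma sigmoid_le_step (hl : 0 ≤ l) :
    Real.sigmoid (l * (r - T)) ≤ (if T - τ ≤ r then 1 else 0) + Real.exp (-(l * τ)) := by
  split_ifs with h
  · exact (Real.sigmoid_lt_one _).le.trans (by linarith [Real.exp_pos (-(l * τ))])
  · rw [zero_add, Real.sigmoid_def]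
    have h2 : (1 + Real.exp (-(l * (r - T))))⁻¹ ≤ (Real.exp (-(l * (r - T))))⁻¹ :=
      inv_anti₀ (Real.exp_pos _) (by linarith)
    rw [← Real.exp_neg, neg_neg] at h2
    refine h2.trans (Real.exp_le_exp.2 ?_)
    rw [← mul_neg]
    exact mul_le_mul_of_nonneg_left (by linarith) hl

end SigmoidStep

section PairModel

variable {n : ℕ}

/-- Coefficients of the two rows at `v`, on the edges and on auxiliary Gaussian coordinates. -/
noncomputable def pairCoef (ρ : Fin n → Bool) (r : Fin n × Bool) :
    EdgeIdx n ⊕ (Fin n ⊕ Unit) → ℝ :=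
  Sum.elim (rowCoef (fun w => r.2 || ρ w) r.1)
    (Sum.elim (fun u => if r.1 = u then Real.sqrt 2 else 0)
      fun _ => spin r.2 * spin (ρ r.1) / Real.sqrt 2)

/-- The number of vertices on the same side as `v`, in terms of the overlap. -/
noncomputable def classSize (ρ : Fin n → Bool) (v : Fin n) : ℝ :=
  (n + spin (ρ v) * ∑ w, spin (ρ w)) / 2

/-- Coefficients of a conditionally independent model with the same covariance. -/
noncomputable def modelCoef (ρ : Fin n → Bool) (r : Fin n × Bool) :
    (Fin n ⊕ Fin n) ⊕ ((Unit ⊕ Unit) ⊕ Unit) → ℝ :=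
  Sum.elim
    (Sum.elim (fun u => if r.1 = u then Real.sqrt (classSize ρ r.1) else 0)
      fun u => if r.1 = u then spin r.2 * Real.sqrt (n - classSize ρ r.1) else 0)
    (Sum.elim (Sum.elim (fun _ => if ρ r.1 then 1 else 0) fun _ => if ρ r.1 then 0 else 1)
      fun _ => spin r.2 / Real.sqrt 2)

lemma abs_sum_spin_le (ρ : Fin n → Bool) : |∑ w, spin (ρ w)| ≤ n := by
  refine (Finset.abs_sum_le_sum_abs _ _).trans ?_
  simp [abs_spin]

lemma classSize_mem (ρ : Fin n → Bool) (v : Fin n) : 0 ≤ classSize ρ v ∧ classSize ρ v ≤ n := by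
  have h := abs_le.1 (abs_sum_spin_le ρ)
  unfold classSize
  rcases spin_eq_or (ρ v) with h1 | h1 <;> rw [h1] <;> constructor <;> linarith

lemma pairCoef_gram (ρ : Fin n → Bool) (r s : Fin n × Bool) :
    ∑ i, pairCoef ρ r i * pairCoef ρ s i = ∑ i, modelCoef ρ r i * modelCoef ρ s i := by
  obtain ⟨v, b⟩ := r
  obtain ⟨w, c⟩ := s
  have h2 : Real.sqrt 2 * Real.sqrt 2 = 2 := Real.mul_self_sqrt (by norm_num)
  have h2' : ∀ a b : ℝ, a / Real.sqrt 2 * (b / Real.sqrt 2) = a * b / 2 := fun a b => by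
    rw [div_mul_div_comm, h2]
  have hm := classSize_mem ρ w
  have m1 := Real.mul_self_sqrt hm.1
  have m2 := Real.mul_self_sqrt (sub_nonneg.2 hm.2)
  have hsum : ∀ x y : ℝ, ∑ u, (if v = u then x else 0) * (if w = u then y else 0) =
      if v = w then x * y else 0 := fun x y => by
    simp
  simp only [Fintype.sum_sum_type, pairCoef, modelCoef, Sum.elim_inl, Sum.elim_inr,
    sum_rowCoef_mul, hsum, h2', h2, Finset.univ_unique, Finset.sum_singleton]
  have hs := spin_mul_self
  by_cases hvw : v = w
  · subst hvw
    simp only [if_true, m1]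
    rw [show spin b * Real.sqrt (n - classSize ρ v) * (spin c * Real.sqrt (n - classSize ρ v)) =
      spin b * spin c * (Real.sqrt (n - classSize ρ v) * Real.sqrt (n - classSize ρ v)) by ring, m2]
    unfold classSize
    have hn : ∑ w, spin (ρ w) * spin (ρ w) = n := by simp [hs]
    cases b <;> cases c <;> cases hv : ρ v <;> simp [hs] <;> ring
  · simp only [hvw, if_false]
    cases b <;> cases c <;> cases ρ v <;> cases ρ w <;> norm_num

lemma sum_abs_rowCoef_le (σ : Fin n → Bool) (e : EdgeIdx n) : ∑ v, |rowCoef σ v e| ≤ 2 := by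
  have h : ∀ v, |rowCoef σ v e| ≤ (if e.1.1 = v then 1 else 0) + if e.1.2 = v then 1 else 0 :=
    fun v => by
      unfold rowCoef
      rw [abs_mul, abs_mul, abs_spin, abs_spin, one_mul, one_mul]
      refine le_of_eq (abs_of_nonneg ?_)
      positivity
  refine (Finset.sum_le_sum fun v _ => h v).trans ?_
  rw [Finset.sum_add_distrib]
  simp only [Finset.sum_ite_eq, Finset.mem_univ, if_true]
  norm_num

lemma pairProb_le_integral_model (ρ : Fin n → Bool) {l U T τ : ℝ} (hl : 0 ≤ l) (hl4 : 4 * l ≤ 1)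
    (hT : T + τ = U) :
    pairProb n U ρ ≤ Real.exp (2 * n * Real.exp (-(l * τ)) + (300 * n ^ 2 * (4 * l) ^ 3 + 5 * l * n)) *
      ∫ z, ∏ r, Real.sigmoid (-(l * T) + l * ∑ i, modelCoef ρ r i * z i)
        ∂stdPi ((Fin n ⊕ Fin n) ⊕ ((Unit ⊕ Unit) ⊕ Unit)) := by
  set a : Fin n × Bool → ℝ := fun _ => -(l * T)
  set c : Fin n × Bool → EdgeIdx n ⊕ (Fin n ⊕ Unit) → ℝ := fun r i => l * pairCoef ρ r i with hc
  set w : EdgeIdx n ⊕ (Fin n ⊕ Unit) → ℝ := Sum.elim (fun _ => 1) fun _ => 0 with hw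
  set q : (Fin n × Bool → ℝ) → ℝ := fun y => ∏ r, Real.sigmoid (-(l * T) + l * y r) with hq
  have hlaw : ∫ z, ∏ r, Real.sigmoid (a r + ∑ i, c r i * z i) ∂stdPi (EdgeIdx n ⊕ (Fin n ⊕ Unit)) =
      ∫ z, ∏ r, Real.sigmoid (-(l * T) + l * ∑ i, modelCoef ρ r i * z i)
        ∂stdPi ((Fin n ⊕ Fin n) ⊕ ((Unit ⊕ Unit) ⊕ Unit)) := by
    have h := integral_linear_stdPi_congr (pairCoef ρ) (modelCoef ρ) (pairCoef_gram ρ) (f := q)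
      (Continuous.measurable (continuous_finsetProd _ fun r _ =>
        continuous_sigmoid.comp (by fun_prop)))
    simpa only [hq, hc, Finset.mul_sum, mul_assoc] using h
  have hrow : ∀ x : EdgeIdx n → Bool, ∀ r : Fin n × Bool,
      ∑ i, c r i * (w i * spin (Sum.elim x (fun _ => true) i)) =
        l * rowOn x Finset.univ (fun w => r.2 || ρ w) r.1 := fun x r => by
    rw [rowOn_eq_sum_rowCoef, Fintype.sum_sum_type, Finset.mul_sum]
    simp [hc, hw, pairCoef, mul_assoc]
  have hpt : pairProb n U ρ ≤ Real.exp (2 * n * Real.exp (-(l * τ))) *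
      𝔼 x : EdgeIdx n ⊕ (Fin n ⊕ Unit) → Bool,
        ∏ r, Real.sigmoid (a r + ∑ i, c r i * (w i * spin (x i))) := by
    have h1 := expect_comp_injective (J := EdgeIdx n ⊕ (Fin n ⊕ Unit)) (R := Bool) Sum.inl
      Sum.inl_injective fun x : EdgeIdx n → Bool =>
        ∏ r : Fin n × Bool, Real.sigmoid (-(l * T) + l * rowOn x Finset.univ (fun w => r.2 || ρ w) r.1)
    have h2 : ∀ x : EdgeIdx n ⊕ (Fin n ⊕ Unit) → Bool, ∀ r,
        ∑ i, c r i * (w i * spin (x i)) =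
          l * rowOn (x ∘ Sum.inl) Finset.univ (fun w => r.2 || ρ w) r.1 := fun x r => by
      rw [← hrow]
      refine Finset.sum_congr rfl fun i _ => ?_
      cases i <;> simp [hw]
    simp only [h2]
    rw [h1, Finset.mul_expect]
    refine unifProb_le_expect (fun x => mul_nonneg (Real.exp_pos _).le (prod_sigmoid_nonneg _)) ?_
    rintro x ⟨hx1, hx2⟩
    have h3 : Real.exp (2 * n * Real.exp (-(l * τ))) =
        ∏ _r : Fin n × Bool, Real.exp (Real.exp (-(l * τ))) := by
      rw [Finset.prod_const, ← Real.exp_nat_mul]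
      simp [mul_comm]
    rw [h3, ← Finset.prod_mul_distrib]
    refine Finset.one_le_prod fun r _ => ?_
    rw [show -(l * T) + l * rowOn x Finset.univ (fun w => r.2 || ρ w) r.1 =
      l * (rowOn x Finset.univ (fun w => r.2 || ρ w) r.1 - T) by ring]
    refine one_le_mul_sigmoid hl ?_
    rw [hT]
    obtain ⟨v, b⟩ := r
    cases b
    · simpa using hx2 v
    · simpa using hx1 v
  have habs : ∀ i, ∑ r, |c r i| = l * ∑ r, |pairCoef ρ r i| := fun i => by
    simp [hc, abs_mul, abs_of_nonneg hl, Finset.mul_sum]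
  have hA : ∀ e, ∑ r, |pairCoef ρ r (Sum.inl e)| ≤ 4 := fun e => by
    rw [Fintype.sum_prod_type_right]
    have h1 := sum_abs_rowCoef_le (fun w => true || ρ w) e
    have h2 := sum_abs_rowCoef_le (fun w => false || ρ w) e
    simp only [Fintype.sum_bool, pairCoef, Sum.elim_inl]
    linarith
  have hsq : 0 < Real.sqrt 2 := by positivity
  have hsq2 : Real.sqrt 2 * Real.sqrt 2 = 2 := Real.mul_self_sqrt (by norm_num)
  have hsq3 : Real.sqrt 2 ≤ 1.5 := by nlinarith
  have hB : ∀ u, ∑ r, |pairCoef ρ r (Sum.inr (Sum.inl u))| ≤ 3 := fun u => by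
    rw [Fintype.sum_prod_type]
    simp only [pairCoef, Sum.elim_inl, Sum.elim_inr, Fintype.sum_bool, apply_ite abs, abs_zero,
      abs_of_pos hsq, Finset.sum_add_distrib, Finset.sum_ite_eq', Finset.mem_univ, if_true]
    linarith
  have hC : ∑ r, |pairCoef ρ r (Sum.inr (Sum.inr ()))| ≤ 2 * n := by
    rw [Fintype.sum_prod_type]
    simp only [pairCoef, Sum.elim_inr, abs_div, abs_mul, abs_spin,
      abs_of_pos hsq, Finset.sum_const, Finset.card_univ, Fintype.card_fin, nsmul_eq_mul, Fintype.card_bool, Nat.cast_ofNat]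
    have h1 : (1 : ℝ) * 1 / Real.sqrt 2 ≤ 1 := by
      rw [one_mul, div_le_one hsq]; nlinarith
    nlinarith [Nat.cast_nonneg (α := ℝ) n]
  have hcomp := expect_prod_sigmoid_le a c w (by
    rintro (e | i)
    · refine Or.inr ⟨rfl, ?_⟩
      rw [habs]
      nlinarith [hA e]
    · exact Or.inl rfl)
  rw [hlaw] at hcomp
  have hexp : (∑ i, if w i = 0 then ∑ r, |c r i| else 300 * (∑ r, |c r i|) ^ 3) ≤
      300 * n ^ 2 * (4 * l) ^ 3 + 5 * l * n := by
    rw [Fintype.sum_sum_type, Fintype.sum_sum_type]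
    simp only [hw, Sum.elim_inl, Sum.elim_inr, one_ne_zero, if_false, if_true, habs,
      Finset.univ_unique, Finset.sum_singleton]
    have e1 : ∑ e, 300 * (l * ∑ r, |pairCoef ρ r (Sum.inl e)|) ^ 3 ≤ 300 * n ^ 2 * (4 * l) ^ 3 := by
      calc _ ≤ ∑ _e : EdgeIdx n, 300 * (4 * l) ^ 3 := Finset.sum_le_sum fun e _ => by
            have h := pow_le_pow_left₀ (mul_nonneg hl (Finset.sum_nonneg fun r _ => abs_nonneg _))
              ((mul_le_mul_of_nonneg_left (hA e) hl).trans_eq (mul_comm l 4)) 3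
            exact mul_le_mul_of_nonneg_left h (by norm_num)
        _ = Fintype.card (EdgeIdx n) * (300 * (4 * l) ^ 3) := by simp
        _ ≤ (n : ℝ) ^ 2 * (300 * (4 * l) ^ 3) := by
            gcongr
            exact card_edgeIdx_le n
        _ = _ := by ring
    have e2 : ∑ u, l * ∑ r, |pairCoef ρ r (Sum.inr (Sum.inl u))| ≤ 3 * l * n := by
      calc _ ≤ ∑ _u : Fin n, l * 3 := Finset.sum_le_sum fun u _ => by gcongr; exact hB u
        _ = _ := by simp; ring
    have e3 : l * ∑ r, |pairCoef ρ r (Sum.inr (Sum.inr ()))| ≤ 2 * l * n := by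
      calc _ ≤ l * (2 * n) := by gcongr
        _ = _ := by ring
    have e3' : l * ∑ r, |pairCoef ρ r (Sum.inr (Sum.inr default))| ≤ 2 * l * n := e3
    linarith
  rw [Real.exp_add, mul_assoc]
  refine hpt.trans (mul_le_mul_of_nonneg_left (hcomp.trans ?_) (Real.exp_pos _).le)
  exact mul_le_mul_of_nonneg_right (Real.exp_le_exp.2 hexp)
    (integral_nonneg fun _ => prod_sigmoid_nonneg _)

end PairModel

section PairUpper

lemma measurableSet_wedge (T a b : ℝ) :
    MeasurableSet {p : ℝ × ℝ | T ≤ a * p.1 + b * p.2 ∧ T ≤ a * p.1 - b * p.2} :=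
  MeasurableSet.inter (s₁ := {p : ℝ × ℝ | T ≤ a * p.1 + b * p.2})
    (s₂ := {p : ℝ × ℝ | T ≤ a * p.1 - b * p.2})
    (measurableSet_le (by fun_prop) (by fun_prop)) (measurableSet_le (by fun_prop) (by fun_prop))

instance : IsProbabilityMeasure gauss2 := by unfold gauss2; infer_instance

lemma fB_nonneg (γ β α : ℝ) : 0 ≤ fB γ β α := ENNReal.toReal_nonneg

lemma fB_le_one (γ β α : ℝ) : fB γ β α ≤ 1 :=
  ENNReal.toReal_le_of_le_ofReal zero_le_one (by simpa using prob_le_one)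

lemma fB_antitone (γ β : ℝ) : Antitone (fB γ β) := fun a b h => by
  refine ENNReal.toReal_mono (measure_ne_top _ _) (measure_mono fun p hp => ?_)
  exact ⟨by linarith [hp.1], by linarith [hp.2]⟩

/-- Two sigmoid factors at one vertex, integrated over the two private Gaussian coordinates. -/
lemma integral_sigmoid_mul_le {l T τ A s c m : ℝ} (hl : 0 ≤ l) (hτ : 0 ≤ τ) (hm : 0 < m) :
    ∫ y, ∫ x, Real.sigmoid (l * (A + Real.sqrt c * x + (Real.sqrt m * y + s) - T)) *
        Real.sigmoid (l * (A + Real.sqrt c * x - (Real.sqrt m * y + s) - T))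
        ∂gaussianReal 0 1 ∂gaussianReal 0 1 ≤
      (gauss2 {p : ℝ × ℝ | T - τ - A ≤ Real.sqrt c * p.1 + Real.sqrt m * p.2 ∧
        T - τ - A ≤ Real.sqrt c * p.1 - Real.sqrt m * p.2}).toReal + 3 * Real.exp (-(l * τ)) := by
  set e := Real.exp (-(l * τ))
  have he : e ≤ 1 := Real.exp_le_one_iff.2 (neg_nonpos.2 (mul_nonneg hl hτ))
  have he0 : 0 < e := Real.exp_pos _
  set S := {p : ℝ × ℝ | T - τ - A ≤ Real.sqrt c * p.1 + Real.sqrt m * p.2 + s ∧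
    T - τ - A ≤ Real.sqrt c * p.1 - Real.sqrt m * p.2 - s} with hS
  have hSm : MeasurableSet S :=
    MeasurableSet.inter (s₁ := {p : ℝ × ℝ | T - τ - A ≤ Real.sqrt c * p.1 + Real.sqrt m * p.2 + s})
      (s₂ := {p : ℝ × ℝ | T - τ - A ≤ Real.sqrt c * p.1 - Real.sqrt m * p.2 - s})
      (measurableSet_le (by fun_prop) (by fun_prop)) (measurableSet_le (by fun_prop) (by fun_prop))
  set F : ℝ × ℝ → ℝ := fun p =>
    Real.sigmoid (l * (A + Real.sqrt c * p.1 + (Real.sqrt m * p.2 + s) - T)) *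
      Real.sigmoid (l * (A + Real.sqrt c * p.1 - (Real.sqrt m * p.2 + s) - T)) with hF
  have hF0 : ∀ p, 0 ≤ F p := fun p => mul_nonneg (Real.sigmoid_nonneg _) (Real.sigmoid_nonneg _)
  have hFc : Continuous F :=
    (continuous_sigmoid.comp (by fun_prop)).mul (continuous_sigmoid.comp (by fun_prop))
  have hFi : Integrable F gauss2 := by
    refine Integrable.of_bound hFc.aestronglyMeasurable 1 (ae_of_all _ fun p => ?_)
    rw [Real.norm_of_nonneg (hF0 p)]
    exact mul_le_one₀ (Real.sigmoid_lt_one _).le (Real.sigmoid_nonneg _) (Real.sigmoid_lt_one _).le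
  have hle : ∀ p, F p ≤ S.indicator (fun _ => 1) p + 3 * e := by
    intro p
    have h1 := sigmoid_le_step (T := T) (τ := τ) hl
      (r := A + Real.sqrt c * p.1 + (Real.sqrt m * p.2 + s))
    have h2 := sigmoid_le_step (T := T) (τ := τ) hl
      (r := A + Real.sqrt c * p.1 - (Real.sqrt m * p.2 + s))
    have h := mul_le_mul h1 h2 (Real.sigmoid_nonneg _) ((Real.sigmoid_nonneg _).trans h1)
    refine h.trans ?_
    simp only [Set.indicator_apply, hS, Set.mem_ofPred_eq]
    split_ifs with a b c d e' f
    · nlinarith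
    · exact absurd ⟨by linarith, by linarith⟩ c
    · nlinarith
    · nlinarith
    · nlinarith
    · nlinarith
    · nlinarith
    · nlinarith
  have hmean : ∫ p, F p ∂gauss2 ≤ (gauss2 S).toReal + 3 * e := by
    have hi : Integrable (S.indicator fun _ => (1 : ℝ)) gauss2 :=
      (integrable_const 1).indicator hSm
    calc _ ≤ ∫ p, (S.indicator (fun _ => 1) p + 3 * e) ∂gauss2 :=
          integral_mono hFi (hi.add (integrable_const _)) hle
      _ = _ := by
          rw [integral_add hi (integrable_const _), integral_indicator_const _ hSm]
          simp [Measure.real]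
  have hswap : ∫ p, F p ∂gauss2 = ∫ y, ∫ x, F (x, y) ∂gaussianReal 0 1 ∂gaussianReal 0 1 :=
    integral_prod_symm F hFi
  rw [← hswap]
  refine hmean.trans (add_le_add_left (ENNReal.toReal_mono (measure_ne_top _ _) ?_) _)
  exact gauss2_shift_le (T - τ - A) _ _ s (Real.sqrt_pos.2 hm)

lemma gauss2_scale {β N S γ α : ℝ} (hN : 0 < N) (hS : S = Real.sqrt (2 * N) * (γ + α)) :
    (gauss2 {p : ℝ × ℝ | S ≤ Real.sqrt (β * N) * p.1 + Real.sqrt ((1 - β) * N) * p.2 ∧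
        S ≤ Real.sqrt (β * N) * p.1 - Real.sqrt ((1 - β) * N) * p.2}).toReal = fB γ β α := by
  have h2 : 0 < Real.sqrt (2 * N) := Real.sqrt_pos.2 (by linarith)
  have hs : ∀ b : ℝ, Real.sqrt (b * N) = Real.sqrt (2 * N) * Real.sqrt (b / 2) := fun b => by
    rw [← Real.sqrt_mul (by linarith)]
    congr 1; ring
  unfold fB
  congr 2
  ext p
  simp only [Set.mem_ofPred_eq]
  rw [hs β, hs (1 - β), hS, mul_assoc, mul_assoc, ← mul_add, ← mul_sub, mul_le_mul_iff_right₀ h2,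
    mul_le_mul_iff_right₀ h2]

variable {n : ℕ}

/-- The integral over the common field of the `k`-th power of the two-point probability. -/
noncomputable def fieldIntegral (γ β t e : ℝ) (n k : ℕ) : ℝ :=
  ∫ x, (fB γ β (-(Real.sqrt 2 * t) - x / Real.sqrt (2 * n)) + 3 * e) ^ k ∂gaussianReal 0 1

lemma integral_model_factor (a : Fin n → ℝ → ℝ → ℝ) (ha : ∀ v, Continuous fun p : ℝ × ℝ => a v p.1 p.2)
    (ha0 : ∀ v x y, 0 ≤ a v x y) (ha1 : ∀ v x y, a v x y ≤ 1) :
    ∫ z, ∏ v, a v (z (Sum.inl v)) (z (Sum.inr v)) ∂stdPi (Fin n ⊕ Fin n) =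
      ∏ v, ∫ y, ∫ x, a v x y ∂gaussianReal 0 1 ∂gaussianReal 0 1 := by
  have hc : Continuous fun z : Fin n ⊕ Fin n → ℝ => ∏ v, a v (z (Sum.inl v)) (z (Sum.inr v)) :=
    continuous_finsetProd _ fun v _ => (ha v).comp
      (f := fun z : Fin n ⊕ Fin n → ℝ => (z (Sum.inl v), z (Sum.inr v)))
      ((continuous_apply (Sum.inl v)).prodMk (continuous_apply (Sum.inr v)))
  rw [integral_stdPi_sum _ (Integrable.of_bound hc.aestronglyMeasurable 1 (ae_of_all _ fun z => by
    rw [Real.norm_of_nonneg (Finset.prod_nonneg fun v _ => ha0 _ _ _)]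
    exact Finset.prod_le_one (fun v _ => ha0 _ _ _) fun v _ => ha1 _ _ _))]
  simp only [Sum.elim_inl, Sum.elim_inr]
  rw [← integral_fintype_prod_eq_prod (μ := fun _ : Fin n => gaussianReal 0 1)
    (f := fun v y => ∫ x, a v x y ∂gaussianReal 0 1)]
  refine integral_congr_ae (ae_of_all _ fun y => ?_)
  exact integral_fintype_prod_eq_prod (μ := fun _ : Fin n => gaussianReal 0 1)
    (f := fun v x => a v x (y v))

lemma sum_modelCoef_mul (ρ : Fin n → Bool) (v : Fin n) (b : Bool)
    (g : Fin n ⊕ Fin n → ℝ) (x : (Unit ⊕ Unit) ⊕ Unit → ℝ) :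
    ∑ i, modelCoef ρ (v, b) i * Sum.elim g x i =
      (if ρ v then x (Sum.inl (Sum.inl ())) else x (Sum.inl (Sum.inr ()))) +
        Real.sqrt (classSize ρ v) * g (Sum.inl v) +
        spin b * (Real.sqrt (n - classSize ρ v) * g (Sum.inr v) + x (Sum.inr ()) / Real.sqrt 2) := by
  simp only [Fintype.sum_sum_type, modelCoef, Sum.elim_inl, Sum.elim_inr, ite_mul, zero_mul, one_mul,
    Finset.sum_ite_eq, Finset.mem_univ, if_true, Finset.univ_unique, Finset.sum_singleton]
  cases ρ v <;> simp <;> ring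

lemma measurable_fieldIntegrand (γ β t e : ℝ) (n k : ℕ) : Measurable fun x : ℝ =>
    (fB γ β (-(Real.sqrt 2 * t) - x / Real.sqrt (2 * n)) + 3 * e) ^ k := by
  have h : Monotone fun x : ℝ => fB γ β (-(Real.sqrt 2 * t) - x / Real.sqrt (2 * n)) := fun x y hxy =>
    fB_antitone γ β (by gcongr)
  exact (h.measurable.add_const _).pow_const k

lemma integrable_fieldIntegrand {γ β t e : ℝ} (he : 0 ≤ e) {n k : ℕ} {μ : Measure ℝ}
    [IsFiniteMeasure μ] : Integrable (fun x : ℝ =>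
      (fB γ β (-(Real.sqrt 2 * t) - x / Real.sqrt (2 * n)) + 3 * e) ^ k) μ := by
  refine Integrable.of_bound (measurable_fieldIntegrand ..).aestronglyMeasurable ((1 + 3 * e) ^ k)
    (ae_of_all _ fun x => ?_)
  have h := fB_nonneg γ β (-(Real.sqrt 2 * t) - x / Real.sqrt (2 * n))
  rw [Real.norm_of_nonneg (by positivity)]
  gcongr
  exact fB_le_one _ _ _

lemma sum_spin_eq (ρ : Fin n → Bool) :
    ∑ w, spin (ρ w) = 2 * (Finset.univ.filter fun w => ρ w = true).card - n := by
  have h : ∀ w, spin (ρ w) = 2 * (if ρ w = true then 1 else 0) - 1 := fun w => by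
    cases ρ w <;> norm_num [spin]
  rw [Finset.sum_congr rfl fun w _ => h w, Finset.sum_sub_distrib, ← Finset.mul_sum]
  simp

theorem pairProb_le_fieldIntegral (ρ : Fin n → Bool) {l t γ : ℝ} {u : ℕ} (hl : 0 ≤ l)
    (hl4 : 4 * l ≤ 1) (ht : 0 ≤ t) (hu : (Finset.univ.filter fun w => ρ w = true).card = u)
    (hu0 : 0 < u) (hun : u < n) :
    pairProb n (Real.sqrt 2 * γ * Real.sqrt n) ρ ≤
      Real.exp (2 * n * Real.exp (-(l * (t * Real.sqrt n))) +
        (300 * n ^ 2 * (4 * l) ^ 3 + 5 * l * n)) *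
      (fieldIntegral γ (u / n) t (Real.exp (-(l * (t * Real.sqrt n)))) n u *
        fieldIntegral γ (1 - u / n) t (Real.exp (-(l * (t * Real.sqrt n)))) n (n - u)) := by
  have hn : (0 : ℝ) < n := by exact_mod_cast hu0.trans hun
  set τ := t * Real.sqrt n with hτ
  set e := Real.exp (-(l * τ)) with he
  set T := Real.sqrt 2 * γ * Real.sqrt n - τ with hT
  have hτ0 : 0 ≤ τ := mul_nonneg ht (Real.sqrt_nonneg _)
  refine (pairProb_le_integral_model ρ hl hl4 (T := T) (τ := τ) (by rw [hT]; ring)).trans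
    (mul_le_mul_of_nonneg_left ?_ (Real.exp_pos _).le)
  set P : ((Fin n ⊕ Fin n) ⊕ ((Unit ⊕ Unit) ⊕ Unit) → ℝ) → ℝ := fun z =>
    ∏ r, Real.sigmoid (-(l * T) + l * ∑ i, modelCoef ρ r i * z i) with hP
  have hPi : Integrable P (stdPi ((Fin n ⊕ Fin n) ⊕ ((Unit ⊕ Unit) ⊕ Unit))) := by
    refine Integrable.of_bound (Continuous.aestronglyMeasurable (continuous_finsetProd _ fun r _ =>
        continuous_sigmoid.comp (by fun_prop))) 1 (ae_of_all _ fun z => ?_)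
    rw [Real.norm_of_nonneg (prod_sigmoid_nonneg _)]
    exact prod_sigmoid_le_one _
  rw [integral_stdPi_sum P hPi]
  set φ : ℝ → ℝ → ℝ := fun β x => fB γ β (-(Real.sqrt 2 * t) - x / Real.sqrt (2 * n)) + 3 * e with hφ
  have hφ0 : ∀ β x, 0 ≤ φ β x := fun β x => add_nonneg (fB_nonneg _ _ _) (by positivity)
  have hinner : ∀ x : (Unit ⊕ Unit) ⊕ Unit → ℝ,
      ∫ g, P (Sum.elim g x) ∂stdPi (Fin n ⊕ Fin n) ≤
        φ (u / n) (x (Sum.inl (Sum.inl ()))) ^ u *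
          φ (1 - u / n) (x (Sum.inl (Sum.inr ()))) ^ (n - u) := by
    intro x
    set A : Fin n → ℝ := fun v =>
      if ρ v then x (Sum.inl (Sum.inl ())) else x (Sum.inl (Sum.inr ())) with hA
    set s := x (Sum.inr ()) / Real.sqrt 2 with hs
    set a : Fin n → ℝ → ℝ → ℝ := fun v p q =>
      Real.sigmoid (l * (A v + Real.sqrt (classSize ρ v) * p +
          (Real.sqrt (n - classSize ρ v) * q + s) - T)) *
        Real.sigmoid (l * (A v + Real.sqrt (classSize ρ v) * p -
          (Real.sqrt (n - classSize ρ v) * q + s) - T)) with ha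
    have hPa : ∀ g, P (Sum.elim g x) = ∏ v, a v (g (Sum.inl v)) (g (Sum.inr v)) := fun g => by
      rw [hP]
      simp only [Fintype.prod_prod_type, Fintype.prod_bool, sum_modelCoef_mul, ha, hA, hs]
      refine Finset.prod_congr rfl fun v _ => ?_
      congr 2 <;> simp <;> ring
    simp only [hPa]
    rw [integral_model_factor a
      (fun v => (continuous_sigmoid.comp (by fun_prop)).mul (continuous_sigmoid.comp (by fun_prop)))
      (fun v p q => mul_nonneg (Real.sigmoid_nonneg _) (Real.sigmoid_nonneg _))
      (fun v p q => mul_le_one₀ (Real.sigmoid_lt_one _).le (Real.sigmoid_nonneg _)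
        (Real.sigmoid_lt_one _).le)]
    have hprod : φ (u / n) (x (Sum.inl (Sum.inl ()))) ^ u *
        φ (1 - u / n) (x (Sum.inl (Sum.inr ()))) ^ (n - u) =
        ∏ v, if ρ v then φ (u / n) (x (Sum.inl (Sum.inl ())))
          else φ (1 - u / n) (x (Sum.inl (Sum.inr ()))) := by
      rw [Finset.prod_ite, Finset.prod_const, Finset.prod_const, hu]
      congr 2
      have h := Finset.card_filter_add_card_filter_not (s := Finset.univ) fun w => ρ w = true
      rw [hu, Finset.card_univ, Fintype.card_fin] at h
      omega
    rw [hprod]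
    have hsc : Real.sqrt (2 * n) = Real.sqrt 2 * Real.sqrt n := Real.sqrt_mul (by norm_num) _
    have hq2 : Real.sqrt 2 * Real.sqrt 2 = 2 := Real.mul_self_sqrt (by norm_num)
    have hq : 0 < Real.sqrt (2 * n) := Real.sqrt_pos.2 (by linarith)
    have hS : ∀ y : ℝ, T - τ - y =
        Real.sqrt (2 * n) * (γ + (-(Real.sqrt 2 * t) - y / Real.sqrt (2 * n))) := fun y => by
      rw [mul_add, mul_sub, mul_div_cancel₀ _ hq.ne', hsc, hT, hτ]
      linear_combination (t * Real.sqrt n) * hq2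
    refine Finset.prod_le_prod (fun v _ => integral_nonneg fun _ => integral_nonneg fun _ =>
      mul_nonneg (Real.sigmoid_nonneg _) (Real.sigmoid_nonneg _)) fun v _ => ?_
    have hun' : (u : ℝ) < n := by exact_mod_cast hun
    have hu0' : (0 : ℝ) < u := by exact_mod_cast hu0
    cases hv : ρ v
    · have hc : classSize ρ v = (1 - u / n) * n := by
        rw [classSize, sum_spin_eq, hu, hv, sub_mul, div_mul_cancel₀ _ hn.ne']
        simp [spin]; ring
      have hm : (n : ℝ) - classSize ρ v = (1 - (1 - u / n)) * n := by rw [hc]; ring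
      have h := integral_sigmoid_mul_le (l := l) (T := T) (τ := τ) (A := A v) (s := s)
        (c := classSize ρ v) (m := n - classSize ρ v) hl hτ0 (by rw [hm]; field_simp; linarith)
      rw [hm, hc, gauss2_scale hn (hS _)] at h
      simp only [ha]
      rw [hm, hc]
      simpa only [hA, hv, hφ, if_true, Bool.false_eq_true, if_false] using h
    · have hc : classSize ρ v = (u / n) * n := by
        rw [classSize, sum_spin_eq, hu, hv, div_mul_cancel₀ _ hn.ne']
        simp [spin]
      have hm : (n : ℝ) - classSize ρ v = (1 - u / n) * n := by rw [hc]; ring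
      have h := integral_sigmoid_mul_le (l := l) (T := T) (τ := τ) (A := A v) (s := s)
        (c := classSize ρ v) (m := n - classSize ρ v) hl hτ0
        (by rw [hm]; field_simp; linarith)
      rw [hm, hc, gauss2_scale hn (hS _)] at h
      simp only [ha]
      rw [hm, hc]
      simpa only [hA, hv, hφ, if_true, Bool.false_eq_true, if_false] using h
  have hm1 : Measurable fun x => φ (u / n) x ^ u := measurable_fieldIntegrand ..
  have hm2 : Measurable fun x => φ (1 - u / n) x ^ (n - u) := measurable_fieldIntegrand ..
  have hb : ∀ β x, ∀ k : ℕ, φ β x ^ k ≤ (1 + 3 * e) ^ k := fun β x k =>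
    pow_le_pow_left₀ (hφ0 _ _) (by simp only [hφ]; linarith [fB_le_one γ β (-(Real.sqrt 2 * t) - x / Real.sqrt (2 * n))]) k
  have hbd : ∀ x y, ‖φ (u / n) x ^ u * φ (1 - u / n) y ^ (n - u)‖ ≤
      (1 + 3 * e) ^ u * (1 + 3 * e) ^ (n - u) := fun x y => by
    rw [Real.norm_of_nonneg (mul_nonneg (pow_nonneg (hφ0 _ _) _) (pow_nonneg (hφ0 _ _) _))]
    exact mul_le_mul (hb _ _ _) (hb _ _ _) (pow_nonneg (hφ0 _ _) _) (by positivity)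
  have hi2 : Integrable (fun x : Unit ⊕ Unit → ℝ => φ (u / n) (x (Sum.inl ())) ^ u *
      φ (1 - u / n) (x (Sum.inr ())) ^ (n - u)) (stdPi (Unit ⊕ Unit)) :=
    Integrable.of_bound ((hm1.comp (measurable_pi_apply _)).mul
      (hm2.comp (measurable_pi_apply _))).aestronglyMeasurable _ (ae_of_all _ fun x => hbd _ _)
  have hi3 : Integrable (fun x : (Unit ⊕ Unit) ⊕ Unit → ℝ => φ (u / n) (x (Sum.inl (Sum.inl ()))) ^ u *
      φ (1 - u / n) (x (Sum.inl (Sum.inr ()))) ^ (n - u)) (stdPi ((Unit ⊕ Unit) ⊕ Unit)) :=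
    Integrable.of_bound ((hm1.comp (measurable_pi_apply _)).mul
      (hm2.comp (measurable_pi_apply _))).aestronglyMeasurable _ (ae_of_all _ fun x => hbd _ _)
  refine (integral_mono_of_nonneg (ae_of_all _ fun x => integral_nonneg fun g =>
    prod_sigmoid_nonneg _) hi3 (ae_of_all _ hinner)).trans (le_of_eq ?_)
  rw [integral_stdPi_sum _ hi3]
  simp only [Sum.elim_inl]
  rw [integral_const, probReal_univ, one_smul, integral_stdPi_sum _ hi2]
  simp only [Sum.elim_inl, Sum.elim_inr, integral_stdPi_unit]
  simp_rw [integral_mul_const]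
  rw [integral_const_mul]
  rfl

end PairUpper

section SingleLower

lemma gaussTail_nonneg (y : ℝ) : 0 ≤ gaussTail y := ENNReal.toReal_nonneg

lemma gaussTail_le_one (y : ℝ) : gaussTail y ≤ 1 :=
  ENNReal.toReal_le_of_le_ofReal zero_le_one (by simpa using prob_le_one)

lemma gaussianReal_Icc_ge (x : ℝ) :
    Real.exp (-(|x| + 1) ^ 2 / 2) / 3 ≤ (gaussianReal 0 1).real (Set.Icc x (x + 1)) := by
  have hd : ∀ y ∈ Set.Icc x (x + 1), Real.exp (-(|x| + 1) ^ 2 / 2) / 3 ≤ gaussianPDFReal 0 1 y := by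
    intro y hy
    have hy' : |y| ≤ |x| + 1 := by
      have := abs_le.1 (le_refl |x|)
      exact abs_le.2 ⟨by linarith [hy.1], by linarith [hy.2, this.2]⟩
    have hsq : y ^ 2 ≤ (|x| + 1) ^ 2 := sq_le_sq' (by linarith [neg_abs_le y]) ((le_abs_self y).trans hy')
    have h1 : Real.sqrt (2 * Real.pi) ≤ 3 := by
      rw [Real.sqrt_le_left (by norm_num)]
      linarith [Real.pi_lt_four]
    have h2 : 0 < Real.sqrt (2 * Real.pi) := Real.sqrt_pos.2 (by positivity)
    simp only [gaussianPDFReal, sub_zero, NNReal.coe_one, mul_one]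
    rw [div_eq_mul_inv, mul_comm]
    gcongr
  have hreal : (gaussianReal 0 1).real (Set.Icc x (x + 1)) =
      ∫ y in Set.Icc x (x + 1), gaussianPDFReal 0 1 y := by
    rw [Measure.real, gaussianReal_apply_eq_integral _ one_ne_zero,
      ENNReal.toReal_ofReal (setIntegral_nonneg measurableSet_Icc fun y _ => gaussianPDFReal_nonneg 0 1 y)]
  rw [hreal]
  have h := setIntegral_mono_on (μ := volume) (s := Set.Icc x (x + 1))
    (f := fun _ => Real.exp (-(|x| + 1) ^ 2 / 2) / 3) (integrableOn_const (by simp))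
    (integrable_gaussianPDFReal 0 1).integrableOn measurableSet_Icc hd
  simpa using h

lemma gaussTail_le_integral_sigmoid {l T τ x a y : ℝ} (hl : 0 ≤ l) (ha : 0 ≤ a)
    (hy : T + τ - x ≤ a * y) :
    Real.exp (-Real.exp (-(l * τ))) * gaussTail y ≤
      ∫ g, Real.sigmoid (-(l * T) + l * (a * g + x)) ∂gaussianReal 0 1 := by
  have hm : MeasurableSet {g : ℝ | y ≤ g} := measurableSet_Ici
  have hi : Integrable (fun g : ℝ => Real.sigmoid (-(l * T) + l * (a * g + x))) (gaussianReal 0 1) := by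
    refine Integrable.of_bound (Continuous.aestronglyMeasurable
      (continuous_sigmoid.comp (by fun_prop))) 1 (ae_of_all _ fun g => ?_)
    rw [Real.norm_of_nonneg (Real.sigmoid_nonneg _)]
    exact (Real.sigmoid_lt_one _).le
  have h := integral_mono ((integrable_const (Real.exp (-Real.exp (-(l * τ))))).indicator hm) hi (by
    intro g
    by_cases hg : y ≤ g
    · rw [Set.indicator_of_mem (by exact hg)]
      have h1 := one_le_mul_sigmoid (l := l) (T := T) (τ := τ) (r := a * g + x) hl (by
        have := mul_le_mul_of_nonneg_left hg ha
        linarith)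
      rw [Real.exp_neg, inv_le_iff_one_le_mul₀' (Real.exp_pos _)]
      rwa [show l * (a * g + x - T) = -(l * T) + l * (a * g + x) by ring] at h1
    · rw [Set.indicator_of_notMem (by exact hg)]
      exact Real.sigmoid_nonneg _)
  rw [integral_indicator_const _ hm] at h
  simpa [gaussTail, Measure.real, mul_comm] using h

variable {n : ℕ}

theorem singleProb_ge (hn : 20 ≤ n) {κ l t x y : ℝ} (hκ : κ ≤ 0.8) (hl : 0 ≤ l) (hl4 : 4 * l ≤ 1)
    (hy : (κ + 2 * t) * Real.sqrt n - x ≤ Real.sqrt (n - 2) * y) :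
    Real.exp (-(|x| + 1) ^ 2 / 2) / 3 * gaussTail y ^ n ≤
      Real.exp ((10 ^ 14 + 1) * Real.exp (-(l * (t * Real.sqrt n))) * n + 300 * n ^ 2 * (4 * l) ^ 3) *
        singleProb n (κ * Real.sqrt n) := by
  set τ := t * Real.sqrt n with hτ
  set e := Real.exp (-(l * τ)) with he
  set T := (κ + t) * Real.sqrt n with hT
  have hn2 : (0 : ℝ) ≤ n - 2 := by
    have : (20 : ℝ) ≤ n := by exact_mod_cast hn
    linarith
  set m : Fin n → Fin n ⊕ Unit → ℝ := fun v =>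
    Sum.elim (fun u => if v = u then Real.sqrt (n - 2) else 0) fun _ => 1 with hm
  have h1 := singleProb_ge_of_prod hn κ e hκ (Real.exp_pos _).le
    (fun r => Real.sigmoid (l * (r - T))) (fun r => Real.sigmoid_nonneg _) (fun r => by
      have := sigmoid_le_step (T := T) (τ := τ) (r := r) hl
      rwa [show T - τ = κ * Real.sqrt n by rw [hT, hτ]; ring] at this)
  set σ : Fin n → Bool := fun _ => true with hσ
  have hle : ∀ e, ∑ v, |l * rowCoef σ v e| ≤ 4 * l := fun e => by
    simp only [abs_mul, abs_of_nonneg hl, ← Finset.mul_sum]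
    have := mul_le_mul_of_nonneg_left (sum_abs_rowCoef_le σ e) hl
    linarith
  have h2 := integral_prod_sigmoid_le (ι := EdgeIdx n) (fun _ : Fin n => -(l * T))
    (fun v e => l * rowCoef σ v e) (fun e => (hle e).trans hl4)
  have hlaw : ∫ z, ∏ v, Real.sigmoid (-(l * T) + ∑ i, l * rowCoef σ v i * z i) ∂stdPi (EdgeIdx n) =
      ∫ z, ∏ v, Real.sigmoid (-(l * T) + l * ∑ i, m v i * z i) ∂stdPi (Fin n ⊕ Unit) := by
    have h := integral_linear_stdPi_congr (rowCoef σ) m (fun v w => by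
      rw [sum_rowCoef_mul, Fintype.sum_sum_type]
      by_cases hvw : v = w
      · subst hvw
        simp [hσ, hm, spin, Real.mul_self_sqrt hn2]
        ring
      · simp [hσ, hm, spin, hvw]) (f := fun y => ∏ v, Real.sigmoid (-(l * T) + l * y v))
      (Continuous.measurable (continuous_finsetProd _ fun r _ =>
        continuous_sigmoid.comp (by fun_prop)))
    simpa only [Finset.mul_sum, mul_assoc] using h
  rw [hlaw] at h2
  have hsum : ∑ e : EdgeIdx n, 300 * (∑ v, |l * rowCoef σ v e|) ^ 3 ≤ 300 * n ^ 2 * (4 * l) ^ 3 := by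
    calc _ ≤ ∑ _e : EdgeIdx n, 300 * (4 * l) ^ 3 := Finset.sum_le_sum fun e _ => by
          have h := pow_le_pow_left₀ (Finset.sum_nonneg fun v _ => abs_nonneg _) (hle e) 3
          linarith
      _ = Fintype.card (EdgeIdx n) * (300 * (4 * l) ^ 3) := by simp
      _ ≤ (n : ℝ) ^ 2 * (300 * (4 * l) ^ 3) := by
          gcongr
          exact card_edgeIdx_le n
      _ = _ := by ring
  set Φ : ℝ → ℝ := fun x =>
    ∫ g, Real.sigmoid (-(l * T) + l * (Real.sqrt (n - 2) * g + x)) ∂gaussianReal 0 1 with hΦ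
  have hsplit : ∫ z, ∏ v, Real.sigmoid (-(l * T) + l * ∑ i, m v i * z i) ∂stdPi (Fin n ⊕ Unit) =
      ∫ x, Φ x ^ n ∂gaussianReal 0 1 := by
    rw [integral_stdPi_sum (fun z : Fin n ⊕ Unit → ℝ =>
      ∏ v, Real.sigmoid (-(l * T) + l * ∑ i, m v i * z i)) (Integrable.of_bound (Continuous.aestronglyMeasurable
      (continuous_finsetProd _ fun r _ => continuous_sigmoid.comp (by fun_prop))) 1
        (ae_of_all _ fun z => by
          rw [Real.norm_of_nonneg (prod_sigmoid_nonneg _)]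
          exact prod_sigmoid_le_one _)), integral_stdPi_unit]
    refine integral_congr_ae (ae_of_all _ fun x => ?_)
    simp only [Fintype.sum_sum_type, hm, Sum.elim_inl, Sum.elim_inr, ite_mul, zero_mul, one_mul,
      Finset.sum_ite_eq, Finset.mem_univ, if_true, Finset.univ_unique, Finset.sum_singleton]
    rw [integral_fintype_prod_eq_prod (μ := fun _ : Fin n => gaussianReal 0 1)
      (f := fun _ g => Real.sigmoid (-(l * T) + l * (Real.sqrt (n - 2) * g + x)))]
    simp [hΦ]
  have hΦ0 : ∀ x, 0 ≤ Φ x := fun x => integral_nonneg fun _ => Real.sigmoid_nonneg _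
  have hΦ1 : ∀ x, Φ x ≤ 1 := fun x => by
    have h := integral_mono_of_nonneg (μ := gaussianReal 0 1) (g := fun _ => (1 : ℝ))
      (f := fun g => Real.sigmoid (-(l * T) + l * (Real.sqrt (n - 2) * g + x)))
      (ae_of_all _ fun _ => Real.sigmoid_nonneg _) (integrable_const 1)
      (ae_of_all _ fun _ => (Real.sigmoid_lt_one _).le)
    simpa using h
  have hmono : Monotone Φ := fun a b hab => by
    have hi : ∀ x, Integrable (fun g : ℝ => Real.sigmoid (-(l * T) + l * (Real.sqrt (n - 2) * g + x)))
        (gaussianReal 0 1) := fun x => Integrable.of_bound (Continuous.aestronglyMeasurable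
          (continuous_sigmoid.comp (by fun_prop))) 1 (ae_of_all _ fun g => by
            rw [Real.norm_of_nonneg (Real.sigmoid_nonneg _)]
            exact (Real.sigmoid_lt_one _).le)
    refine integral_mono (hi a) (hi b) fun g => Real.sigmoid_monotone ?_
    gcongr
  have hlow : Real.exp (-(|x| + 1) ^ 2 / 2) / 3 * (Real.exp (-e) * gaussTail y) ^ n ≤
      ∫ x, Φ x ^ n ∂gaussianReal 0 1 := by
    have hS : MeasurableSet (Set.Icc x (x + 1)) := measurableSet_Icc
    have hi : Integrable (fun x => Φ x ^ n) (gaussianReal 0 1) :=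
      Integrable.of_bound (hmono.measurable.pow_const n).aestronglyMeasurable 1
        (ae_of_all _ fun x => by
          rw [Real.norm_of_nonneg (pow_nonneg (hΦ0 x) n)]
          exact pow_le_one₀ (hΦ0 x) (hΦ1 x))
    have h := integral_mono ((integrable_const ((Real.exp (-e) * gaussTail y) ^ n)).indicator hS) hi (by
      intro z
      by_cases hz : z ∈ Set.Icc x (x + 1)
      · rw [Set.indicator_of_mem hz]
        refine pow_le_pow_left₀ (mul_nonneg (Real.exp_pos _).le (gaussTail_nonneg _)) ?_ n
        refine gaussTail_le_integral_sigmoid hl (Real.sqrt_nonneg _) ?_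
        have : T + τ = (κ + 2 * t) * Real.sqrt n := by rw [hT, hτ]; ring
        linarith [hz.1]
      · rw [Set.indicator_of_notMem hz]
        exact pow_nonneg (hΦ0 z) n)
    rw [integral_indicator_const _ hS, smul_eq_mul] at h
    refine le_trans (mul_le_mul_of_nonneg_right (gaussianReal_Icc_ge x) ?_) h
    exact pow_nonneg (mul_nonneg (Real.exp_pos _).le (gaussTail_nonneg _)) n
  rw [← hsplit] at hlow
  have h3 := hlow.trans h2
  have h4 : Real.exp (-(|x| + 1) ^ 2 / 2) / 3 * gaussTail y ^ n =
      Real.exp (e * n) * (Real.exp (-(|x| + 1) ^ 2 / 2) / 3 * (Real.exp (-e) * gaussTail y) ^ n) := by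
    rw [mul_pow, ← Real.exp_nat_mul]
    have : Real.exp (e * n) * Real.exp (n * -e) = 1 := by
      rw [← Real.exp_add]; simp [mul_comm]
    linear_combination (-(Real.exp (-(|x| + 1) ^ 2 / 2) / 3 * gaussTail y ^ n)) * this
  have h5 : 𝔼 x : EdgeIdx n → Bool, ∏ v, Real.sigmoid (-(l * T) + ∑ i, l * rowCoef σ v i * spin (x i)) =
      𝔼 x, ∏ v, Real.sigmoid (l * (rowOn x Finset.univ σ v - T)) := by
    refine Finset.expect_congr rfl fun x _ => Finset.prod_congr rfl fun v _ => ?_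
    rw [rowOn_eq_sum_rowCoef, mul_sub, Finset.mul_sum]
    congr 1
    simp only [mul_assoc]
    ring
  rw [h5] at h3
  rw [h4]
  calc _ ≤ Real.exp (e * n) * (Real.exp (300 * n ^ 2 * (4 * l) ^ 3) *
        (Real.exp (10 ^ 14 * e * n) * singleProb n (κ * Real.sqrt n))) := by
        refine mul_le_mul_of_nonneg_left (h3.trans ?_) (Real.exp_pos _).le
        exact mul_le_mul (Real.exp_le_exp.2 hsum) h1
          (Finset.expect_nonneg fun x _ => prod_sigmoid_nonneg _) (Real.exp_pos _).le
    _ = _ := by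
        rw [← mul_assoc, ← mul_assoc, ← Real.exp_add, ← Real.exp_add]
        congr 2; ring

end SingleLower

section GaussTail

lemma gaussianReal_real_Ico_le {s t : ℝ} (h : s ≤ t) :
    (gaussianReal 0 1).real (Set.Ico s t) ≤ 0.4 * (t - s) := by
  have h1 : (2.5 : ℝ) ≤ Real.sqrt (2 * Real.pi) := by
    refine Real.le_sqrt_of_sq_le ?_
    linarith [Real.pi_gt_d4]
  have hd : ∀ y, gaussianPDFReal 0 1 y ≤ 0.4 := fun y => by
    simp only [gaussianPDFReal, sub_zero, NNReal.coe_one, mul_one]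
    have h2 : Real.exp (-y ^ 2 / 2) ≤ 1 := Real.exp_le_one_iff.2 (by nlinarith [sq_nonneg y])
    have h3 : (Real.sqrt (2 * Real.pi))⁻¹ ≤ 0.4 := by
      rw [inv_le_comm₀ (by linarith) (by norm_num)]
      exact le_trans (by norm_num) h1
    calc _ ≤ (0.4 : ℝ) * 1 := mul_le_mul h3 h2 (Real.exp_pos _).le (by norm_num)
      _ = _ := mul_one _
  rw [Measure.real, gaussianReal_apply_eq_integral _ one_ne_zero,
    ENNReal.toReal_ofReal (setIntegral_nonneg measurableSet_Ico fun y _ => gaussianPDFReal_nonneg 0 1 y)]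
  have h2 := setIntegral_mono (μ := volume) (s := Set.Ico s t)
    (integrable_gaussianPDFReal 0 1).integrableOn
    (g := fun _ => 0.4) (integrableOn_const (by simp)) hd
  simpa [h, mul_comm] using h2

lemma gaussTail_sub {s t : ℝ} (h : s ≤ t) :
    gaussTail s - gaussTail t = (gaussianReal 0 1).real (Set.Ico s t) := by
  have h1 : Set.Ici s = Set.Ico s t ∪ Set.Ici t := (Set.Ico_union_Ici_eq_Ici h).symm
  have h2 : (gaussianReal 0 1).real (Set.Ici s) =
      (gaussianReal 0 1).real (Set.Ico s t) + (gaussianReal 0 1).real (Set.Ici t) := by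
    rw [h1]
    refine measureReal_union ?_ measurableSet_Ici
    exact Set.disjoint_left.2 fun x hx hx' => (hx.2.trans_le hx').false
  have h3 : ∀ x, gaussTail x = (gaussianReal 0 1).real (Set.Ici x) := fun x => rfl
  rw [h3, h3]
  linarith

lemma gaussTail_strictAnti : StrictAnti gaussTail := fun s t h => by
  have h1 := gaussTail_sub h.le
  have h2 : 0 < (gaussianReal 0 1).real (Set.Ico s t) := by
    refine ENNReal.toReal_pos (fun h0 => ?_) (measure_ne_top _ _)
    have := gaussianReal_absolutelyContinuous' 0 one_ne_zero h0
    simp at this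
    exact h.not_ge this
  linarith

lemma gaussTail_pos (x : ℝ) : 0 < gaussTail x :=
  (gaussTail_nonneg (x + 1)).trans_lt (gaussTail_strictAnti (by linarith))

lemma continuous_gaussTail : Continuous gaussTail := by
  refine (LipschitzWith.of_le_add_mul 1 fun s t => ?_).continuous
  rw [Real.dist_eq, NNReal.coe_one, one_mul]
  rcases le_total s t with h | h
  · have h1 := gaussTail_sub h
    have h2 := gaussianReal_real_Ico_le h
    rw [abs_of_nonpos (by linarith)]
    linarith
  · have := gaussTail_strictAnti.antitone h
    linarith [abs_nonneg (s - t)]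

lemma gaussTail_zero_le : gaussTail 0 ≤ 1 / 2 := by
  have h1 : (gaussianReal 0 1).real (Set.Ici 0) = (gaussianReal 0 1).real (Set.Iic 0) := by
    have h := gaussianReal_map_neg (μ := 0) (v := 1)
    rw [neg_zero] at h
    conv_lhs => rw [← h]
    rw [map_measureReal_apply measurable_neg measurableSet_Ici]
    congr 1
    ext x
    simp
  have h2 : (gaussianReal 0 1).real (Set.Iic 0) ≤ (gaussianReal 0 1).real (Set.Iio 0) := by
    have := nullSingletonClass_gaussianReal (μ := 0) (v := 1) one_ne_zero
    exact (measureReal_congr Iio_ae_eq_Iic).ge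
  have h3 : (gaussianReal 0 1).real (Set.Iio 0) = 1 - (gaussianReal 0 1).real (Set.Ici 0) := by
    rw [← probReal_compl_eq_one_sub measurableSet_Ici, Set.compl_Ici]
  have h4 : gaussTail 0 = (gaussianReal 0 1).real (Set.Ici 0) := rfl
  linarith

lemma gaussTail_neg_le {a : ℝ} (ha : 0 ≤ a) : gaussTail (-a) ≤ 1 / 2 + 0.4 * a := by
  have h1 := gaussTail_sub (s := -a) (t := 0) (by linarith)
  have h2 := gaussianReal_real_Ico_le (s := -a) (t := 0) (by linarith)
  linarith [gaussTail_zero_le]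

end GaussTail

section FirstMoment

lemma continuous_F1 (γ : ℝ) : Continuous (F1 γ) := by
  unfold F1
  refine ((continuous_const).sub (continuous_pow 2)).add (Continuous.log ?_ fun x => (gaussTail_pos _).ne')
  exact continuous_gaussTail.comp (by fun_prop)

lemma F1_le (γ α : ℝ) : F1 γ α ≤ Real.log 2 - α ^ 2 := by
  have := Real.log_nonpos (gaussTail_nonneg ((γ + α) * Real.sqrt 2)) (gaussTail_le_one _)
  unfold F1
  linarith

lemma exists_F1_max (γ : ℝ) : ∃ α, ∀ α', F1 γ α' ≤ F1 γ α := by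
  refine (continuous_F1 γ).exists_forall_ge ?_
  have h : Filter.Tendsto (fun α : ℝ => Real.log 2 - α ^ 2) (Filter.cocompact ℝ) Filter.atBot := by
    have h2 := (Filter.tendsto_pow_atTop (α := ℝ) two_ne_zero).comp (tendsto_norm_cocompact_atTop (E := ℝ))
    simp only [Function.comp_def, Real.norm_eq_abs, sq_abs] at h2
    simp only [sub_eq_add_neg]
    exact Filter.tendsto_atBot_add_const_left _ _ (Filter.tendsto_neg_atTop_atBot.comp h2)
  exact Filter.tendsto_atBot_mono (F1_le γ) h

lemma iSup_F1_eq {γ α : ℝ} (h : ∀ α', F1 γ α' ≤ F1 γ α) : ⨆ α, F1 γ α = F1 γ α :=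
  le_antisymm (ciSup_le h) (le_ciSup ⟨F1 γ α, by rintro _ ⟨x, rfl⟩; exact h x⟩ α)

lemma F1_strictAnti {γ γ' : ℝ} (h : γ < γ') (α : ℝ) : F1 γ' α < F1 γ α := by
  unfold F1
  have h1 : gaussTail ((γ' + α) * Real.sqrt 2) < gaussTail ((γ + α) * Real.sqrt 2) :=
    gaussTail_strictAnti (mul_lt_mul_of_pos_right (by linarith) (by positivity))
  have := Real.log_lt_log (gaussTail_pos _) h1
  linarith

lemma IsGammaCrit.F1_eq_zero {γ α : ℝ} (hγ : IsGammaCrit γ) (h : ∀ α', F1 γ α' ≤ F1 γ α) :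
    F1 γ α = 0 := by
  have h1 : ⨆ α : ℝ, (-α ^ 2 + Real.log (gaussTail ((γ + α) * Real.sqrt 2))) =
      -α ^ 2 + Real.log (gaussTail ((γ + α) * Real.sqrt 2)) := by
    have hle : ∀ α', -α' ^ 2 + Real.log (gaussTail ((γ + α') * Real.sqrt 2)) ≤
        -α ^ 2 + Real.log (gaussTail ((γ + α) * Real.sqrt 2)) := fun α' => by
      have := h α'
      unfold F1 at this
      linarith
    exact le_antisymm (ciSup_le hle) (le_ciSup ⟨_, by rintro _ ⟨x, rfl⟩; exact hle x⟩ α)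
  have h2 := hγ.2
  rw [h1] at h2
  unfold F1
  linarith

lemma F1_neg_of_large {γ : ℝ} (hγ : 0.8 ≤ Real.sqrt 2 * γ) (α : ℝ) : F1 γ α < 0 := by
  have hs : Real.sqrt 2 * Real.sqrt 2 = 2 := Real.mul_self_sqrt (by norm_num)
  have hs0 : 0 < Real.sqrt 2 := by positivity
  have hγ0 : 0 < γ := by
    by_contra h
    nlinarith
  suffices h : 2 * gaussTail ((γ + α) * Real.sqrt 2) < Real.exp (α ^ 2) by
    have h1 := Real.log_lt_log (mul_pos two_pos (gaussTail_pos _)) h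
    rw [Real.log_mul two_ne_zero (gaussTail_pos _).ne', Real.log_exp] at h1
    unfold F1
    linarith
  have hexp := Real.add_one_le_exp (α ^ 2)
  rcases lt_trichotomy (γ + α) 0 with hx | hx | hx
  · set a := -((γ + α) * Real.sqrt 2) with ha
    have ha0 : 0 ≤ a := by nlinarith
    have h1 := gaussTail_neg_le ha0
    have h2 : (γ + α) * Real.sqrt 2 = -a := by rw [ha]; ring
    rw [h2]
    have h3 : α ^ 2 = (γ + α) ^ 2 + Real.sqrt 2 * a * γ + γ ^ 2 := by
      rw [ha]
      linear_combination (γ * (γ + α)) * hs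
    have h4 : 0.8 * a ≤ Real.sqrt 2 * a * γ := by nlinarith
    nlinarith [sq_nonneg (γ + α), sq_pos_of_pos hγ0]
  · rw [hx, zero_mul]
    have : 0 < α ^ 2 := by
      have : α = -γ := by linarith
      rw [this, neg_sq]; positivity
    linarith [gaussTail_zero_le]
  · have := gaussTail_strictAnti (mul_pos hx hs0)
    linarith [gaussTail_zero_le, sq_nonneg α]

lemma IsGammaCrit.sqrt_two_mul_lt {γ : ℝ} (hγ : IsGammaCrit γ) : Real.sqrt 2 * γ < 0.8 := by
  by_contra h
  obtain ⟨α, hα⟩ := exists_F1_max γ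
  exact (F1_neg_of_large (not_lt.1 h) α).ne (hγ.F1_eq_zero hα)

lemma IsGammaCrit.F1_max_pos {γ γ' α : ℝ} (hγ : IsGammaCrit γ) (h : γ' < γ)
    (hα : ∀ α', F1 γ' α' ≤ F1 γ' α) : 0 < F1 γ' α := by
  obtain ⟨α₀, h₀⟩ := exists_F1_max γ
  exact (hγ.F1_eq_zero h₀).ge.trans_lt ((F1_strictAnti h α₀).trans_le (hα α₀))

end FirstMoment

section TwoPoint

lemma gauss2_line_eq_zero (a c : ℝ) {b : ℝ} (hb : b ≠ 0) :
    gauss2 {p : ℝ × ℝ | a * p.1 + b * p.2 = c} = 0 := by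
  have hm : MeasurableSet {p : ℝ × ℝ | a * p.1 + b * p.2 = c} :=
    measurableSet_eq_fun (by fun_prop) (by fun_prop)
  have := nullSingletonClass_gaussianReal (μ := 0) (v := 1) one_ne_zero
  rw [gauss2, Measure.measure_prod_null hm]
  refine Filter.Eventually.of_forall fun x => ?_
  refine Set.Subsingleton.measure_zero (fun y hy z hz => ?_) _
  have h1 : a * x + b * y = c := hy
  have h2 : a * x + b * z = c := hz
  exact mul_left_cancel₀ hb (by linarith)

lemma continuousAt_fB {γ : ℝ} {p : ℝ × ℝ} (hp : p.1 < 1) :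
    ContinuousAt (fun p : ℝ × ℝ => fB γ p.1 p.2) p := by
  have hb : Real.sqrt ((1 - p.1) / 2) ≠ 0 := (Real.sqrt_pos.2 (by linarith)).ne'
  set q : ℝ × ℝ → ℝ × ℝ → ℝ := fun p z =>
    min (Real.sqrt (p.1 / 2) * z.1 + Real.sqrt ((1 - p.1) / 2) * z.2)
      (Real.sqrt (p.1 / 2) * z.1 - Real.sqrt ((1 - p.1) / 2) * z.2) - (γ + p.2) with hq
  have hS : ∀ p : ℝ × ℝ, {z : ℝ × ℝ |
      γ + p.2 ≤ Real.sqrt (p.1 / 2) * z.1 + Real.sqrt ((1 - p.1) / 2) * z.2 ∧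
      γ + p.2 ≤ Real.sqrt (p.1 / 2) * z.1 - Real.sqrt ((1 - p.1) / 2) * z.2} =
      {z | 0 ≤ q p z} := fun p => by
    ext z
    simp only [Set.mem_ofPred_eq, hq, sub_nonneg, le_min_iff]
  have hm : ∀ p, MeasurableSet {z | 0 ≤ q p z} := fun p => by
    rw [← hS]
    exact measurableSet_wedge _ _ _
  have hmean : ∀ p : ℝ × ℝ, fB γ p.1 p.2 = ∫ z, {z | 0 ≤ q p z}.indicator (fun _ => (1 : ℝ)) z ∂gauss2 :=
    fun p => by
      rw [integral_indicator_const _ (hm p), fB, hS]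
      simp [Measure.real]
  simp only [hmean]
  refine continuousAt_of_dominated (bound := fun _ => 1)
    (Filter.Eventually.of_forall fun p =>
      ((measurable_const.indicator (hm p)).aestronglyMeasurable))
    (Filter.Eventually.of_forall fun p => ae_of_all _ fun z => ?_) (integrable_const 1) ?_
  · by_cases hz : 0 ≤ q p z <;> simp [hz]
  · have h1 := gauss2_line_eq_zero (Real.sqrt (p.1 / 2)) (γ + p.2) hb
    have h2 := gauss2_line_eq_zero (Real.sqrt (p.1 / 2)) (γ + p.2) (neg_ne_zero.2 hb)
    filter_upwards [measure_eq_zero_iff_ae_notMem.1 h1, measure_eq_zero_iff_ae_notMem.1 h2] with z hz1 hz2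
    have hz : q p z ≠ 0 := by
      intro h
      rcases min_choice (Real.sqrt (p.1 / 2) * z.1 + Real.sqrt ((1 - p.1) / 2) * z.2)
        (Real.sqrt (p.1 / 2) * z.1 - Real.sqrt ((1 - p.1) / 2) * z.2) with h' | h' <;>
        simp only [hq, h'] at h
      · exact hz1 (by linarith)
      · exact hz2 (by linarith)
    have hc : Continuous fun p => q p z := by
      simp only [hq]
      fun_prop
    have hev : (fun p => {z | 0 ≤ q p z}.indicator (fun _ => (1 : ℝ)) z) =ᶠ[nhds p]
        fun _ => {z | 0 ≤ q p z}.indicator (fun _ => (1 : ℝ)) z := by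
      rcases lt_or_gt_of_ne hz with h | h
      · filter_upwards [hc.continuousAt.eventually_lt continuousAt_const h] with p' hp'
        simp only [Set.indicator_apply, Set.mem_ofPred_eq, not_le.2 h, not_le.2 hp', if_false]
      · filter_upwards [continuousAt_const.eventually_lt hc.continuousAt h] with p' hp'
        simp only [Set.indicator_apply, Set.mem_ofPred_eq, h.le, hp'.le, if_true]
    exact continuousAt_const.congr hev.symm

lemma fB_pos {γ β α : ℝ} (hβ : 0 < β) : 0 < fB γ β α := by
  have ha : 0 < Real.sqrt (β / 2) := Real.sqrt_pos.2 (by linarith)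
  set a := Real.sqrt (β / 2)
  set b := Real.sqrt ((1 - β) / 2) with hb
  have hb0 : 0 ≤ b := Real.sqrt_nonneg _
  set K := (γ + α + b) / a
  have hsub : Set.Ici K ×ˢ Set.Icc (-1 : ℝ) 1 ⊆ {p : ℝ × ℝ |
      γ + α ≤ a * p.1 + b * p.2 ∧ γ + α ≤ a * p.1 - b * p.2} := by
    rintro ⟨x, y⟩ ⟨hx, hy⟩
    have h1 : γ + α + b ≤ x * a := (div_le_iff₀ ha).1 hx
    have h2 : -b ≤ b * y := by nlinarith [hy.1]
    have h3 : b * y ≤ b := by nlinarith [hy.2]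
    exact ⟨by simp only; linarith, by simp only; linarith⟩
  refine ENNReal.toReal_pos (fun h0 => ?_) (measure_ne_top _ _)
  have h := measure_mono_null hsub h0
  rw [gauss2, Measure.prod_prod, mul_eq_zero] at h
  rcases h with h | h
  · have := gaussianReal_absolutelyContinuous' 0 one_ne_zero h
    simp at this
  · have := gaussianReal_absolutelyContinuous' 0 one_ne_zero h
    norm_num at this

lemma F2_symm (γ β α₁ α₂ : ℝ) : F2 γ (1 - β) α₂ α₁ = F2 γ β α₁ α₂ := by
  unfold F2
  rw [sub_sub_cancel]
  ring

lemma F2_le {γ β α₁ α₂ : ℝ} (hβ : 0 ≤ β) (hβ' : β ≤ 1) : F2 γ β α₁ α₂ ≤ 4 * Real.log 2 := by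
  have h1 := Real.binEntropy_le_log_two (p := β)
  rw [Real.binEntropy_eq_negMulLog_add_negMulLog_one_sub, Real.negMulLog, Real.negMulLog] at h1
  have h2 := Real.log_nonpos (fB_nonneg γ β α₁) (fB_le_one _ _ _)
  have h3 := Real.log_nonpos (fB_nonneg γ (1 - β) α₂) (fB_le_one _ _ _)
  have h4 := mul_nonpos_of_nonneg_of_nonpos hβ h2
  have h5 := mul_nonpos_of_nonneg_of_nonpos (sub_nonneg.2 hβ') h3
  unfold F2
  nlinarith [sq_nonneg α₁, sq_nonneg α₂]

lemma continuousOn_F2 (γ : ℝ) : ContinuousOn (fun p : ℝ × ℝ × ℝ => F2 γ p.1 p.2.1 p.2.2)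
    {p | 0 < p.1 ∧ p.1 < 1} := by
  intro p hp
  refine ContinuousAt.continuousWithinAt ?_
  have h1 : ContinuousAt (fun p : ℝ × ℝ × ℝ => fB γ p.1 p.2.1) p :=
    ContinuousAt.comp (g := fun q : ℝ × ℝ => fB γ q.1 q.2) (f := fun p : ℝ × ℝ × ℝ => (p.1, p.2.1))
      (continuousAt_fB hp.2) (by fun_prop)
  have h2 : ContinuousAt (fun p : ℝ × ℝ × ℝ => fB γ (1 - p.1) p.2.2) p :=
    ContinuousAt.comp (g := fun q : ℝ × ℝ => fB γ q.1 q.2)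
      (f := fun p : ℝ × ℝ × ℝ => (1 - p.1, p.2.2))
      (continuousAt_fB (by have := hp.1; simp only; linarith)) (by fun_prop)
  have h3 := h1.log (fB_pos hp.1).ne'
  have h4 := h2.log (fB_pos (sub_pos.2 hp.2)).ne'
  have h5 : ContinuousAt (fun p : ℝ × ℝ × ℝ => Real.log p.1) p :=
    ContinuousAt.log (by fun_prop) hp.1.ne'
  have h6 : ContinuousAt (fun p : ℝ × ℝ × ℝ => Real.log (1 - p.1)) p :=
    ContinuousAt.log (by fun_prop) (sub_pos.2 hp.2).ne'
  unfold F2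
  fun_prop

lemma exists_fB_ge (γ M : ℝ) {ν : ℝ} (hν : 0 < ν) :
    ∃ c > 0, ∀ β ∈ Set.Icc ν (1 - ν), ∀ α ∈ Set.Icc (-M) M, c ≤ fB γ β α := by
  have hK : IsCompact (Set.Icc ν (1 - ν) ×ˢ Set.Icc (-M) M) := isCompact_Icc.prod isCompact_Icc
  have hc : ContinuousOn (fun p : ℝ × ℝ => fB γ p.1 p.2) (Set.Icc ν (1 - ν) ×ˢ Set.Icc (-M) M) :=
    fun p hp => (continuousAt_fB (by have := hp.1.2; linarith)).continuousWithinAt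
  rcases (Set.Icc ν (1 - ν) ×ˢ Set.Icc (-M) M).eq_empty_or_nonempty with h | h
  · refine ⟨1, one_pos, fun β hβ α hα => ?_⟩
    exact absurd (h ▸ Set.mk_mem_prod hβ hα : (β, α) ∈ (∅ : Set (ℝ × ℝ))) (Set.notMem_empty _)
  · obtain ⟨p, hp, hmin⟩ := hK.exists_isMinOn h hc
    exact ⟨fB γ p.1 p.2, fB_pos (hν.trans_le hp.1.1), fun β hβ α hα => hmin (Set.mk_mem_prod hβ hα)⟩

end TwoPoint

section QuadraticMax

open Filter Topology

variable {E : Type*} [NormedAddCommGroup E] [NormedSpace ℝ E] [FiniteDimensional ℝ E] [Nontrivial E]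

/-- Near a local maximum with negative definite Hessian a function decays quadratically. -/
lemma exists_quadratic_decay {g : E → ℝ} {p : E} (hmax : IsLocalMax g p)
    (hneg : ∀ v : E, v ≠ 0 → iteratedFDeriv ℝ 2 g p ![v, v] < 0) :
    ∃ c > 0, ∀ᶠ x in 𝓝 p, g x ≤ g p - c * ‖x - p‖ ^ 2 := by
  set D := fderiv ℝ g with hD
  set B := fderiv ℝ D p with hB
  have hneg' : ∀ v : E, v ≠ 0 → B v v < 0 := fun v hv => by
    simpa [iteratedFDeriv_two_apply] using hneg v hv
  have hdiff : DifferentiableAt ℝ D p := by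
    by_contra h
    obtain ⟨v, hv⟩ := exists_ne (0 : E)
    have := hneg' v hv
    rw [hB, fderiv_zero_of_not_differentiableAt h] at this
    simp at this
  have hD0 : D p = 0 := hmax.fderiv_eq_zero
  obtain ⟨c, hc, hBc⟩ : ∃ c > 0, ∀ v, B v v ≤ -c * ‖v‖ ^ 2 := by
    have hcont : Continuous fun v => B v v := by fun_prop
    obtain ⟨w, hw, hmx⟩ := (isCompact_sphere (0 : E) 1).exists_isMaxOn
      (NormedSpace.sphere_nonempty.2 zero_le_one) hcont.continuousOn
    have hw1 : ‖w‖ = 1 := by simpa using hw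
    refine ⟨-B w w, neg_pos.2 (hneg' w (by rintro rfl; simp at hw1)), fun v => ?_⟩
    rcases eq_or_ne v 0 with rfl | hv
    · simp
    have hv' : ‖v‖ ≠ 0 := norm_ne_zero_iff.2 hv
    have h : B (‖v‖⁻¹ • v) (‖v‖⁻¹ • v) ≤ B w w :=
      hmx (by simp [norm_smul, hv'])
    simp only [map_smul, _root_.smul_apply, smul_eq_mul] at h
    have h2 := mul_le_mul_of_nonneg_right h (sq_nonneg ‖v‖)
    have h3 : ‖v‖⁻¹ * (‖v‖⁻¹ * B v v) * ‖v‖ ^ 2 = B v v := by field_simp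
    linarith
  have hsmall := (hasFDerivAt_iff_isLittleO.1 hdiff.hasFDerivAt).def (show 0 < c / 2 by positivity)
  rw [hD0] at hsmall
  obtain ⟨r, hr, hball⟩ := Metric.eventually_nhds_iff_ball.1 (hsmall.and hmax)
  have hdir : ∀ v : E, v ≠ 0 → ‖v‖ < r → D (p + v) v ≤ -(c / 2) * ‖v‖ ^ 2 := fun v hv hvr => by
    have h1 := (hball (p + v) (by simpa using hvr)).1
    simp only [sub_zero, add_sub_cancel_left] at h1
    have h2 := (D (p + v) - B v).le_opNorm v
    have h3 : |D (p + v) v - B v v| ≤ c / 2 * ‖v‖ * ‖v‖ :=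
      (by simpa using h2 : |D (p + v) v - B v v| ≤ _).trans
        (mul_le_mul_of_nonneg_right h1 (norm_nonneg v))
    nlinarith [hBc v, (abs_le.1 h3).2]
  refine ⟨c / 8, by positivity, Metric.eventually_nhds_iff_ball.2 ⟨r, hr, fun x hx => ?_⟩⟩
  rcases eq_or_ne x p with rfl | hxp
  · simp
  set v := x - p with hv
  have hv0 : v ≠ 0 := sub_ne_zero.2 hxp
  have hvr : ‖v‖ < r := by simpa [hv, dist_eq_norm] using hx
  have hder : ∀ s ∈ Set.Icc (1 / 2 : ℝ) 1,
      HasDerivAt (fun s : ℝ => g (p + s • v)) (D (p + s • v) v) s ∧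
        D (p + s • v) v ≤ -(c / 4) * ‖v‖ ^ 2 := by
    intro s hs
    have hs0 : 0 < s := by linarith [hs.1]
    have hsv : ‖s • v‖ = s * ‖v‖ := by rw [norm_smul, Real.norm_of_nonneg hs0.le]
    have h1 := hdir (s • v) (smul_ne_zero hs0.ne' hv0)
      (by rw [hsv]; nlinarith [norm_nonneg v, hs.2])
    rw [map_smul, smul_eq_mul, hsv] at h1
    have hvn : 0 < ‖v‖ := norm_pos_iff.2 hv0
    have h2 : D (p + s • v) v ≤ -(c / 2) * s * ‖v‖ ^ 2 := by
      refine le_of_mul_le_mul_left ?_ hs0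
      linarith
    have h3 : D (p + s • v) v ≤ -(c / 4) * ‖v‖ ^ 2 := by
      have : 0 < c * ‖v‖ ^ 2 := by positivity
      nlinarith [hs.1]
    refine ⟨?_, h3⟩
    have hdg : DifferentiableAt ℝ g (p + s • v) := by
      by_contra h
      have h4 : D (p + s • v) = 0 := fderiv_zero_of_not_differentiableAt h
      rw [h4] at h3
      have : 0 < c * ‖v‖ ^ 2 := by positivity
      simp only [_root_.zero_apply] at h3
      linarith
    have hline : HasDerivAt (fun s : ℝ => p + s • v) v s := by
      simpa using ((hasDerivAt_id s).smul_const v).const_add p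
    exact hdg.hasFDerivAt.comp_hasDerivAt s hline
  obtain ⟨s, hs, hmv⟩ := exists_hasDerivAt_eq_slope (fun s : ℝ => g (p + s • v))
    (fun s => D (p + s • v) v) (show (1 / 2 : ℝ) < 1 by norm_num)
    (fun s hs => (hder s hs).1.continuousAt.continuousWithinAt)
    (fun s hs => (hder s (Set.Ioo_subset_Icc_self hs)).1)
  have h1 := (hder s (Set.Ioo_subset_Icc_self hs)).2
  have h2 : g (p + (1 / 2 : ℝ) • v) ≤ g p := (hball _ (by
    simp only [Metric.mem_ball, dist_self_add_left, norm_smul]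
    norm_num
    linarith [norm_nonneg v])).2
  have h3 : p + (1 : ℝ) • v = x := by simp [hv]
  simp only [hmv, h3] at h1
  rw [div_le_iff₀ (by norm_num)] at h1
  linarith

end QuadraticMax

section SecondMoment

open Filter Topology

theorem AssumptionStar.exists_F2_le {γcrit γ α₀ : ℝ} (hstar : AssumptionStar γcrit)
    (hγ : γ ∈ Set.Icc (γcrit - (10 : ℝ) ^ (-25 : ℤ)) (γcrit + (10 : ℝ) ^ (-25 : ℤ)))
    (hα : ∀ α, F1 γ α ≤ F1 γ α₀) (hpos : 0 < F1 γ α₀) (M : ℝ) :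
    ∃ c > 0, c ≤ 1 ∧ ∀ β ∈ Set.Icc (0 : ℝ) 1, ∀ α₁ ∈ Set.Icc (-M) M, ∀ α₂ ∈ Set.Icc (-M) M,
      F2 γ β α₁ α₂ ≤ 4 * F1 γ α₀ - c * (β - 1 / 2) ^ 2 := by
  obtain ⟨h1, h2, h3⟩ := hstar γ hγ
  obtain ⟨hhess, huniq⟩ := h3 α₀ hα
  rw [iSup_F1_eq hα] at h1 h2
  set p : ℝ × ℝ × ℝ := (1 / 2, α₀, α₀) with hp
  set g : ℝ × ℝ × ℝ → ℝ := fun p => F2 γ p.1 p.2.1 p.2.2 with hg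
  have hgp : g p = 4 * F1 γ α₀ := by
    rw [← h2]
    symm
    apply IsGreatest.csSup_eq
    refine ⟨⟨1 / 2, by norm_num, α₀, α₀, rfl⟩, ?_⟩
    rintro _ ⟨β, hβ, α₁, α₂, rfl⟩
    exact (huniq β hβ α₁ α₂).1
  have hlow : ∀ β ∈ Set.Icc (0 : ℝ) 0.001, ∀ α₁ α₂, F2 γ β α₁ α₂ ≤ 2 * F1 γ α₀ := by
    intro β hβ α₁ α₂
    rw [← h1]
    refine le_csSup ⟨4 * Real.log 2, ?_⟩ ⟨β, hβ, α₁, α₂, rfl⟩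
    rintro _ ⟨β, hβ, α₁, α₂, rfl⟩
    exact F2_le hβ.1 (hβ.2.trans (by norm_num))
  have hmax : IsLocalMax g p := by
    have hopen : {q : ℝ × ℝ × ℝ | 0.001 < q.1 ∧ q.1 < 0.999} ∈ 𝓝 p := by
      refine IsOpen.mem_nhds ((isOpen_lt continuous_const continuous_fst).inter
        (isOpen_lt continuous_fst continuous_const)) ?_
      constructor <;> norm_num [hp]
    filter_upwards [hopen] with q hq
    exact (huniq q.1 ⟨hq.1.le, hq.2.le⟩ q.2.1 q.2.2).1
  obtain ⟨c₁, hc₁, hev⟩ := exists_quadratic_decay hmax hhess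
  obtain ⟨r, hr, hball⟩ := Metric.eventually_nhds_iff_ball.1 hev
  set K : Set (ℝ × ℝ × ℝ) := (Set.Icc (0.001 : ℝ) 0.999 ×ˢ Set.Icc (-M) M ×ˢ Set.Icc (-M) M) \
    Metric.ball p r with hK
  obtain ⟨c₂, hc₂, hfar⟩ : ∃ c > 0, ∀ q ∈ K, g q ≤ g p - c := by
    have hKc : IsCompact K := (isCompact_Icc.prod (isCompact_Icc.prod isCompact_Icc)).diff
      Metric.isOpen_ball
    have hcont : ContinuousOn g K := (continuousOn_F2 γ).mono fun q hq => by
      have := hq.1.1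
      exact ⟨by linarith [this.1], by linarith [this.2]⟩
    rcases K.eq_empty_or_nonempty with h | h
    · exact ⟨1, one_pos, fun q hq => absurd (h ▸ hq) (Set.notMem_empty q)⟩
    · obtain ⟨q, hq, hqm⟩ := hKc.exists_isMaxOn h hcont
      refine ⟨g p - g q, sub_pos.2 ?_, fun x hx => by linarith [show g x ≤ g q from hqm hx]⟩
      obtain ⟨hle, heq⟩ := huniq q.1 hq.1.1 q.2.1 q.2.2
      refine lt_of_le_of_ne hle fun h' => hq.2 ?_
      have h'' : q = p := heq h'
      rw [h'']
      exact Metric.mem_ball_self hr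
  set c := min 1 (min c₁ (min c₂ (2 * F1 γ α₀))) with hc
  have hc0 : 0 < c := lt_min one_pos (lt_min hc₁ (lt_min hc₂ (by linarith)))
  have hcc₁ : c ≤ c₁ := (min_le_right _ _).trans (min_le_left _ _)
  have hcc₂ : c ≤ c₂ := (min_le_right _ _).trans ((min_le_right _ _).trans (min_le_left _ _))
  have hcc₃ : c ≤ 2 * F1 γ α₀ :=
    (min_le_right _ _).trans ((min_le_right _ _).trans (min_le_right _ _))
  refine ⟨c, hc0, min_le_left _ _, fun β hβ α₁ hα₁ α₂ hα₂ => ?_⟩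
  have hsq : c * (β - 1 / 2) ^ 2 ≤ c := by
    have : (β - 1 / 2) ^ 2 ≤ 1 := by nlinarith [hβ.1, hβ.2]
    nlinarith
  rcases le_or_gt β 0.001 with hb | hb
  · linarith [hlow β ⟨hβ.1, hb⟩ α₁ α₂]
  rcases le_or_gt 0.999 β with hb' | hb'
  · have := hlow (1 - β) ⟨by linarith [hβ.2], by linarith⟩ α₂ α₁
    rw [F2_symm] at this
    linarith
  rw [← hgp]
  by_cases hq : (β, α₁, α₂) ∈ Metric.ball p r
  · have h := hball _ hq
    have hn : |β - 1 / 2| ≤ ‖((β, α₁, α₂) : ℝ × ℝ × ℝ) - p‖ := norm_fst_le (((β, α₁, α₂) : ℝ × ℝ × ℝ) - p)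
    have h2 : (β - 1 / 2) ^ 2 ≤ ‖((β, α₁, α₂) : ℝ × ℝ × ℝ) - p‖ ^ 2 := by
      rw [← sq_abs (β - 1 / 2)]
      exact pow_le_pow_left₀ (abs_nonneg _) hn 2
    have h3 : c * (β - 1 / 2) ^ 2 ≤ c₁ * ‖((β, α₁, α₂) : ℝ × ℝ × ℝ) - p‖ ^ 2 :=
      mul_le_mul hcc₁ h2 (sq_nonneg _) hc₁.le
    linarith
  · have h := hfar (β, α₁, α₂) ⟨⟨⟨hb.le, hb'.le⟩, hα₁, hα₂⟩, hq⟩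
    linarith

end SecondMoment

section ExponentialBounds

variable {n : ℕ}

theorem exp_F1_le_singleProb {γ α l t : ℝ} (hn : 20 ≤ n) (hκ : Real.sqrt 2 * γ ≤ 0.8)
    (hl : 0 ≤ l) (hl4 : 4 * l ≤ 1) (ht : 0 ≤ t) (ht1 : t ≤ 1)
    (he : Real.exp (-(l * (t * Real.sqrt n))) ≤ t) (hl3 : 300 * (n : ℝ) ^ 2 * (4 * l) ^ 3 ≤ t * n)
    (htn : Real.sqrt n ≤ t * n) (ht2 : 2 * |(γ + α) * Real.sqrt 2| ≤ t * n) :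
    Real.exp (n * (F1 γ α - Real.log 2) - (10 ^ 14 + 20 + 8 * |α|) * (t * n)) ≤
      singleProb n (Real.sqrt 2 * γ * Real.sqrt n) := by
  set y := (γ + α) * Real.sqrt 2 with hy
  set N := Real.sqrt n with hN
  have hn' : (20 : ℝ) ≤ n := by exact_mod_cast hn
  have hN2 : N ^ 2 = n := Real.sq_sqrt (by linarith)
  have hN1 : 1 ≤ N := by rw [hN, Real.one_le_sqrt]; linarith
  set r := Real.sqrt 2 with hr
  have hr2 : r ^ 2 = 2 := Real.sq_sqrt (by norm_num)
  have hr0 : 0 ≤ r := Real.sqrt_nonneg 2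
  have hr1 : r ≤ 1.5 := by nlinarith
  set x := (3 * t - r * α) * N with hx
  have hyx : (r * γ + 2 * t) * N - x ≤ Real.sqrt (n - 2) * y := by
    have h1 : (r * γ + 2 * t) * N - x = N * y - t * N := by rw [hx, hy]; ring
    set m := Real.sqrt ((n : ℝ) - 2) with hm
    have hm2 : m ^ 2 = n - 2 := Real.sq_sqrt (by linarith)
    have hm0 : 0 ≤ m := Real.sqrt_nonneg _
    have hmN : m ≤ N := Real.sqrt_le_sqrt (by linarith)
    have h2 : N * (N - m) ≤ 2 := by nlinarith
    have h3 : (N - m) * |y| ≤ t * N := by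
      have h4 : N * ((N - m) * |y|) ≤ N * (t * N) := by
        calc N * ((N - m) * |y|) = N * (N - m) * |y| := by ring
          _ ≤ 2 * |y| := by gcongr
          _ ≤ t * n := ht2
          _ = N * (t * N) := by rw [← hN2]; ring
      exact le_of_mul_le_mul_left h4 (by linarith)
    have h5 : (N - m) * y ≤ (N - m) * |y| :=
      mul_le_mul_of_nonneg_left (le_abs_self y) (by linarith)
    rw [h1]
    nlinarith
  have hmain := singleProb_ge (κ := r * γ) (t := t) (x := x) (y := y) hn hκ hl hl4 hyx
  have hx1 : |x| ≤ (3 * t + r * |α|) * N := by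
    rw [hx, abs_mul, abs_of_nonneg (by linarith : (0 : ℝ) ≤ N)]
    gcongr
    calc |3 * t - r * α| ≤ |3 * t| + |r * α| := abs_sub _ _
      _ = 3 * t + r * |α| := by rw [abs_mul, abs_mul, abs_of_nonneg ht, abs_of_nonneg hr0]; norm_num
  have hα0 := abs_nonneg α
  have hx2 : (|x| + 1) ^ 2 / 2 ≤ n * α ^ 2 + (8 * |α| + 12) * (t * n) := by
    have h1 : (|x| + 1) ^ 2 ≤ ((3 * t + r * |α|) * N + 1) ^ 2 := by gcongr
    have h2 : ((3 * t + r * |α|) * N + 1) ^ 2 = 9 * (t * (t * n)) + 6 * (r * |α|) * (t * n)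
        + 2 * (n * α ^ 2) + 2 * (3 * t + r * |α|) * N + 1 := by
      have : ((3 * t + r * |α|) * N + 1) ^ 2 = 9 * (t * (t * N ^ 2)) + 6 * (r * |α|) * (t * N ^ 2)
        + r ^ 2 * (N ^ 2 * |α| ^ 2) + 2 * (3 * t + r * |α|) * N + 1 := by ring
      rw [this, hN2, hr2, sq_abs]
    have h3 : t * (t * n) ≤ 1 * (t * n) := by gcongr
    have h4 : r * |α| ≤ 1.5 * |α| := by gcongr
    have h5 : 6 * (r * |α|) * (t * n) ≤ 6 * (1.5 * |α|) * (t * n) := by gcongr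
    have h6 : 2 * (3 * t + r * |α|) * N ≤ 2 * (3 * 1 + 1.5 * |α|) * (t * n) := by gcongr
    have h7 : 0 ≤ |α| * (t * n) := by positivity
    nlinarith
  have hlog : gaussTail y ^ n = Real.exp (n * Real.log (gaussTail y)) := by
    rw [Real.exp_nat_mul, Real.exp_log (gaussTail_pos y)]
  have h3 : Real.exp (-2) ≤ 1 / 3 := by
    rw [Real.exp_neg, ← one_div]
    apply one_div_le_one_div_of_le (by norm_num)
    have := Real.add_one_le_exp (2 : ℝ)
    linarith
  have hE : Real.exp (n * (F1 γ α - Real.log 2) - (10 ^ 14 + 20 + 8 * |α|) * (t * n)) *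
      Real.exp ((10 ^ 14 + 1) * Real.exp (-(l * (t * N))) * n + 300 * (n : ℝ) ^ 2 * (4 * l) ^ 3) ≤
      Real.exp (-(|x| + 1) ^ 2 / 2) / 3 * gaussTail y ^ n := by
    calc _ ≤ Real.exp (-(|x| + 1) ^ 2 / 2) * Real.exp (-2) * Real.exp (n * Real.log (gaussTail y)) := by
          rw [← Real.exp_add, ← Real.exp_add, ← Real.exp_add]
          apply Real.exp_le_exp.2
          have h5 : F1 γ α - Real.log 2 = -α ^ 2 + Real.log (gaussTail y) := by
            rw [F1, hy]; ring
          have h6 : Real.exp (-(l * (t * N))) * n ≤ t * n := by gcongr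
          rw [h5]
          nlinarith
      _ ≤ Real.exp (-(|x| + 1) ^ 2 / 2) * (1 / 3) * gaussTail y ^ n := by rw [hlog]; gcongr
      _ = _ := by ring
  refine le_of_mul_le_mul_right ?_ (Real.exp_pos ((10 ^ 14 + 1) * Real.exp (-(l * (t * N))) * n + 300 * (n : ℝ) ^ 2 * (4 * l) ^ 3))
  rw [mul_comm (singleProb _ _)]
  exact hE.trans hmain

theorem choose_le_exp_binEntropy {u : ℕ} (hu : u ≤ n) :
    (n.choose u : ℝ) ≤ Real.exp (n * Real.binEntropy (u / n)) := by
  rcases Nat.eq_zero_or_pos u with rfl | hu0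
  · simp
  rcases hu.eq_or_lt with rfl | hun
  · simp [div_self (show (u : ℝ) ≠ 0 by positivity)]
  have hn : (0 : ℝ) < n := by exact_mod_cast hu0.trans hun
  have hu0' : (0 : ℝ) < u := by exact_mod_cast hu0
  have hun' : (u : ℝ) < n := by exact_mod_cast hun
  set β : ℝ := u / n with hβ
  have hβ0 : 0 < β := by positivity
  have hβ1 : 0 < 1 - β := by rw [hβ, sub_pos, div_lt_one hn]; exact hun'
  have h1 : β ^ u * (1 - β) ^ (n - u) * n.choose u ≤ 1 := by
    calc β ^ u * (1 - β) ^ (n - u) * n.choose u ≤ (β + (1 - β)) ^ n := by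
          rw [add_pow]
          exact Finset.single_le_sum (f := fun m => β ^ m * (1 - β) ^ (n - m) * (n.choose m : ℝ))
            (fun m _ => by positivity) (Finset.mem_range.2 (by omega))
      _ = 1 := by simp
  have h2 : β ^ u * (1 - β) ^ (n - u) = Real.exp (-(n * Real.binEntropy β)) := by
    have h3 : β ^ u = Real.exp (u * Real.log β) := by rw [Real.exp_nat_mul, Real.exp_log hβ0]
    have h4 : (1 - β) ^ (n - u) = Real.exp ((n - u : ℕ) * Real.log (1 - β)) := by
      rw [Real.exp_nat_mul, Real.exp_log hβ1]
    rw [h3, h4, ← Real.exp_add, Real.binEntropy, Real.log_inv, Real.log_inv, Nat.cast_sub hun.le]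
    congr 1
    have : (u : ℝ) = n * β := by rw [hβ]; field_simp
    rw [this]
    ring
  rw [h2, Real.exp_neg, inv_mul_le_iff₀ (Real.exp_pos _), mul_one] at h1
  exact h1

lemma integral_mul_integral_le {μ : Measure ℝ} [IsProbabilityMeasure μ] {f g p : ℝ → ℝ} {S : Set ℝ}
    {X P B η : ℝ} (hS : MeasurableSet S) (hf : Integrable f μ) (hg : Integrable g μ)
    (hp : IntegrableOn p S μ) (hf0 : ∀ x, 0 ≤ f x) (hg0 : ∀ x, 0 ≤ g x) (hX : 0 ≤ X)
    (hpP : ∫ x in S, p x ∂μ ≤ P) (hP : 0 ≤ ∫ x in S, p x ∂μ)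
    (hfg : ∀ x ∈ S, ∀ y ∈ S, f x * g y ≤ X * (p x * p y)) (hfB : ∀ x, f x ≤ B)
    (hgB : ∀ x, g x ≤ B) (hη : μ.real Sᶜ ≤ η) (hη1 : η ≤ 1) :
    (∫ x, f x ∂μ) * ∫ x, g x ∂μ ≤ X * P ^ 2 + 3 * η * B ^ 2 := by
  have hB : 0 ≤ B := (hf0 0).trans (hfB 0)
  have hη0 : 0 ≤ η := measureReal_nonneg.trans hη
  set I := ∫ x in S, f x ∂μ with hI
  set J := ∫ x in S, g x ∂μ with hJ
  set Q := ∫ x in S, p x ∂μ with hQ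
  have hI0 : 0 ≤ I := integral_nonneg hf0
  have hJ0 : 0 ≤ J := integral_nonneg hg0
  have key : ∀ f : ℝ → ℝ, Integrable f μ → (∀ x, 0 ≤ f x) → (∀ x, f x ≤ B) →
      ∫ x, f x ∂μ ≤ (∫ x in S, f x ∂μ) + η * B ∧ ∫ x in S, f x ∂μ ≤ B := by
    intro f hf hf0 hfB
    constructor
    · rw [← integral_add_compl hS hf]
      have : ∫ x in Sᶜ, f x ∂μ ≤ ∫ x in Sᶜ, B ∂μ :=
        integral_mono hf.integrableOn (integrable_const B) hfB
      rw [setIntegral_const, smul_eq_mul] at this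
      have h2 : μ.real Sᶜ * B ≤ η * B := by gcongr
      linarith
    · calc ∫ x in S, f x ∂μ ≤ ∫ x, f x ∂μ :=
            setIntegral_le_integral hf (Filter.Eventually.of_forall hf0)
        _ ≤ ∫ x, B ∂μ := integral_mono hf (integrable_const B) hfB
        _ = B := by simp
  obtain ⟨h1, h1'⟩ := key f hf hf0 hfB
  obtain ⟨h2, h2'⟩ := key g hg hg0 hgB
  have h3 : I * J ≤ X * P ^ 2 := by
    have h4 : ∀ x ∈ S, f x * J ≤ X * Q * p x := by
      intro x hx
      rw [hJ, ← integral_const_mul]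
      calc ∫ y in S, f x * g y ∂μ ≤ ∫ y in S, X * p x * p y ∂μ :=
            setIntegral_mono_on (hg.integrableOn.const_mul _) (hp.const_mul _) hS
              fun y hy => (hfg x hx y hy).trans_eq (by ring)
        _ = X * Q * p x := by rw [integral_const_mul]; ring
    calc I * J = ∫ x in S, f x * J ∂μ := by rw [integral_mul_const]
      _ ≤ ∫ x in S, X * Q * p x ∂μ :=
          setIntegral_mono_on (hf.integrableOn.mul_const _) (hp.const_mul _) hS h4
      _ = X * Q ^ 2 := by rw [integral_const_mul]; ring
      _ ≤ X * P ^ 2 := by gcongr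
  have hηB : 0 ≤ η * B := by positivity
  calc (∫ x, f x ∂μ) * ∫ x, g x ∂μ ≤ (I + η * B) * (J + η * B) :=
        mul_le_mul h1 h2 (integral_nonneg hg0) (by positivity)
    _ = I * J + (I + J) * (η * B) + η * (η * B ^ 2) := by ring
    _ ≤ X * P ^ 2 + (B + B) * (η * B) + 1 * (η * B ^ 2) := by gcongr
    _ = X * P ^ 2 + 3 * η * B ^ 2 := by ring

lemma integral_exp_sq_gaussianReal_le {a : ℝ} (ha : 0 ≤ a) :
    IntegrableOn (fun x => Real.exp (x ^ 2 / 2)) (Set.Icc (-a) a) (gaussianReal 0 1) ∧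
    0 ≤ ∫ x in Set.Icc (-a) a, Real.exp (x ^ 2 / 2) ∂gaussianReal 0 1 ∧
    ∫ x in Set.Icc (-a) a, Real.exp (x ^ 2 / 2) ∂gaussianReal 0 1 ≤ 2 * a := by
  refine ⟨(Continuous.continuousOn (by fun_prop)).integrableOn_compact isCompact_Icc,
    integral_nonneg fun x => (Real.exp_pos _).le, ?_⟩
  rw [gaussianReal_of_var_ne_zero 0 one_ne_zero, restrict_withDensity measurableSet_Icc,
    integral_withDensity_eq_integral_toReal_smul (measurable_gaussianPDF 0 1)
      (Filter.Eventually.of_forall fun x => gaussianPDF_lt_top)]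
  have : ∀ x : ℝ, (gaussianPDF 0 1 x).toReal • Real.exp (x ^ 2 / 2) = (Real.sqrt (2 * Real.pi))⁻¹ := by
    intro x
    rw [toReal_gaussianPDF, gaussianPDFReal, smul_eq_mul, mul_assoc, ← Real.exp_add]
    simp [neg_div]
  simp only [this]
  rw [setIntegral_const, Real.volume_real_Icc_of_le (by linarith), smul_eq_mul]
  have h1 : (Real.sqrt (2 * Real.pi))⁻¹ ≤ 1 := by
    apply inv_le_one_of_one_le₀
    rw [Real.one_le_sqrt]
    linarith [Real.pi_gt_three]
  nlinarith

lemma gaussianReal_compl_Icc_le {a : ℝ} (ha : 0 ≤ a) :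
    (gaussianReal 0 1).real (Set.Icc (-a) a)ᶜ ≤ 2 * Real.exp (-(a ^ 2 / 2)) := by
  have h1 : (gaussianReal 0 1).real {x | a ≤ x} ≤ Real.exp (-(a ^ 2 / 2)) := by
    have h := measure_ge_le_exp_mul_mgf (μ := gaussianReal 0 1) (X := id) a ha
      (integrable_exp_mul_gaussianReal a)
    rw [mgf_id_gaussianReal, ← Real.exp_add] at h
    refine h.trans_eq ?_
    congr 1
    simp
    ring
  have h2 : (gaussianReal 0 1).real {x | x ≤ -a} ≤ Real.exp (-(a ^ 2 / 2)) := by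
    have h := measure_le_le_exp_mul_mgf (μ := gaussianReal 0 1) (X := id) (-a) (neg_nonpos.2 ha)
      (integrable_exp_mul_gaussianReal (-a))
    rw [mgf_id_gaussianReal, ← Real.exp_add] at h
    refine h.trans_eq ?_
    congr 1
    simp
    ring
  calc (gaussianReal 0 1).real (Set.Icc (-a) a)ᶜ
      ≤ (gaussianReal 0 1).real ({x | a ≤ x} ∪ {x | x ≤ -a}) := by
        refine measureReal_mono (fun x hx => ?_) (measure_ne_top _ _)
        by_contra h
        simp only [Set.mem_union, Set.mem_ofPred_eq, not_or, not_le] at h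
        exact hx ⟨h.2.le, h.1.le⟩
    _ ≤ _ := measureReal_union_le _ _
    _ ≤ 2 * Real.exp (-(a ^ 2 / 2)) := by linarith

lemma field_shift_bound {t x : ℝ} (hn : 0 < n) (ht : 0 ≤ t) (ht1 : t ≤ 0.1)
    (hx : x ∈ Set.Icc (-(4 * Real.sqrt n)) (4 * Real.sqrt n)) :
    (-(Real.sqrt 2 * t) - x / Real.sqrt (2 * n)) ∈ Set.Icc (-5 : ℝ) 5 ∧
      n * (-(Real.sqrt 2 * t) - x / Real.sqrt (2 * n)) ^ 2 ≤ x ^ 2 / 2 + 10 * (t * n) := by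
  have hn' : (0 : ℝ) < n := by exact_mod_cast hn
  set N := Real.sqrt n with hN
  have hN2 : N ^ 2 = n := Real.sq_sqrt hn'.le
  have hN0 : 0 < N := Real.sqrt_pos.2 hn'
  set r := Real.sqrt 2 with hr
  have hr2 : r ^ 2 = 2 := Real.sq_sqrt (by norm_num)
  have hr0 : 0 ≤ r := Real.sqrt_nonneg 2
  have hr1 : r ≤ 1.5 := by nlinarith
  set z := x / Real.sqrt (2 * n) with hz
  have hz2 : z ^ 2 = x ^ 2 / (2 * n) := by rw [hz, div_pow, Real.sq_sqrt (by positivity)]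
  have hx2 : x ^ 2 ≤ 16 * n := by
    rw [← hN2]
    nlinarith [hx.1, hx.2]
  have hz8 : z ^ 2 ≤ 8 := by
    rw [hz2, div_le_iff₀ (by positivity)]
    linarith
  obtain ⟨hz4, hz5⟩ : -3 ≤ z ∧ z ≤ 3 := abs_le_of_sq_le_sq' (by linarith) (by norm_num)
  have hrt : r * t ≤ 0.15 := by nlinarith
  have hrt0 : 0 ≤ r * t := by positivity
  refine ⟨⟨by linarith, by linarith⟩, ?_⟩
  have h1 : n * z ^ 2 = x ^ 2 / 2 := by rw [hz2]; field_simp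
  have h2 : (-(r * t) - z) ^ 2 ≤ z ^ 2 + 10 * t := by
    have : (-(r * t) - z) ^ 2 = z ^ 2 + r ^ 2 * t * t + 2 * t * (r * z) := by ring
    rw [this, hr2]
    have : r * z ≤ 4.5 := by nlinarith
    nlinarith
  calc n * (-(r * t) - z) ^ 2 ≤ n * (z ^ 2 + 10 * t) := by gcongr
    _ = x ^ 2 / 2 + 10 * (t * n) := by rw [mul_add, h1]; ring

lemma add_pow_le_exp {b m e t k : ℝ} {i : ℕ} (hk : 0 < k) (hb : k ≤ b) (he : 0 ≤ e) (he1 : e ≤ t)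
    (him : (i : ℝ) = n * m) :
    (b + 3 * e) ^ i ≤ Real.exp (n * (m * Real.log b) + 3 / k * (t * n) * m) := by
  have hb0 : 0 < b := hk.trans_le hb
  have ht : 0 ≤ t := he.trans he1
  calc (b + 3 * e) ^ i ≤ (Real.exp (Real.log b + 3 / k * t)) ^ i := by
        apply pow_le_pow_left₀ (by positivity)
        rw [Real.exp_add, Real.exp_log hb0]
        have h1 : 1 + 3 / k * t ≤ Real.exp (3 / k * t) := by
          linarith [Real.add_one_le_exp (3 / k * t)]
        have h2 : 3 * e ≤ b * (3 / k * t) := by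
          calc 3 * e ≤ 3 * t := by linarith
            _ = k * (3 / k * t) := by field_simp
            _ ≤ b * (3 / k * t) := by gcongr
        nlinarith
    _ = Real.exp (n * (m * Real.log b) + 3 / k * (t * n) * m) := by
        rw [← Real.exp_nat_mul, him]
        ring_nf

theorem fieldIntegral_mul_le {γ t e Φ c ν k : ℝ} {u : ℕ} (hΦ : 0 ≤ Φ) (hc1 : c ≤ 1)
    (hν : 0 < ν) (hk : 0 < k) (ht : 0 ≤ t) (ht1 : t ≤ 0.1) (he : 0 ≤ e) (he1 : e ≤ t)
    (hF2 : ∀ β ∈ Set.Icc (0 : ℝ) 1, ∀ α₁ ∈ Set.Icc (-5 : ℝ) 5, ∀ α₂ ∈ Set.Icc (-5 : ℝ) 5,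
      F2 γ β α₁ α₂ ≤ 4 * Φ - c * (β - 1 / 2) ^ 2)
    (hfB : ∀ β ∈ Set.Icc ν (1 - ν), ∀ α ∈ Set.Icc (-5 : ℝ) 5, k ≤ fB γ β α)
    (hn : 0 < n) (hun : u ≤ n) (hu : (u / n : ℝ) ∈ Set.Icc ν (1 - ν)) :
    fieldIntegral γ (u / n) t e n u * fieldIntegral γ (1 - u / n) t e n (n - u) ≤
      70 * n * Real.exp (n * (2 * Φ - Real.log 2 - c / 2 * (u / n - 1 / 2) ^ 2
        - Real.binEntropy (u / n)) + (20 + 3 / k) * (t * n)) := by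
  set β : ℝ := u / n with hβ
  have hn' : (0 : ℝ) < n := by exact_mod_cast hn
  set N := Real.sqrt n with hN
  have hN2 : N ^ 2 = n := Real.sq_sqrt hn'.le
  have hN0 : 0 < N := Real.sqrt_pos.2 hn'
  have hnβ : (u : ℝ) = n * β := by rw [hβ]; field_simp
  have hnβ' : ((n - u : ℕ) : ℝ) = n * (1 - β) := by rw [Nat.cast_sub hun, hnβ]; ring
  have hβ0 : 0 < β := hν.trans_le hu.1
  have hβ1 : 0 < 1 - β := by linarith [hu.2]
  set f := fun x : ℝ => (fB γ β (-(Real.sqrt 2 * t) - x / Real.sqrt (2 * n)) + 3 * e) ^ u with hf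
  set g := fun x : ℝ => (fB γ (1 - β) (-(Real.sqrt 2 * t) - x / Real.sqrt (2 * n)) + 3 * e) ^ (n - u)
    with hg
  have hpt := fun x hx => field_shift_bound (n := n) (x := x) (t := t) hn ht ht1 hx
  set X := Real.exp (n * (2 * Φ - Real.log 2 - c / 2 * (β - 1 / 2) ^ 2 - Real.binEntropy β) +
    (20 + 3 / k) * (t * n)) with hX
  have hfg : ∀ x ∈ Set.Icc (-(4 * N)) (4 * N), ∀ y ∈ Set.Icc (-(4 * N)) (4 * N),
      f x * g y ≤ X * (Real.exp (x ^ 2 / 2) * Real.exp (y ^ 2 / 2)) := by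
    intro x hx y hy
    obtain ⟨hx1, hx2⟩ := hpt x hx
    obtain ⟨hy1, hy2⟩ := hpt y hy
    simp only [hf, hg]
    set α₁ := -(Real.sqrt 2 * t) - x / Real.sqrt (2 * n)
    set α₂ := -(Real.sqrt 2 * t) - y / Real.sqrt (2 * n)
    have h1 := add_pow_le_exp hk (hfB β hu α₁ hx1) he he1 hnβ
    have h2 := add_pow_le_exp hk
      (hfB (1 - β) ⟨by linarith [hu.2], by linarith [hu.1]⟩ α₂ hy1) he he1 hnβ'
    refine (mul_le_mul h1 h2 (pow_nonneg (add_nonneg (fB_nonneg _ _ _) (by linarith)) _)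
      (Real.exp_pos _).le).trans ?_
    rw [hX, ← Real.exp_add, ← Real.exp_add, ← Real.exp_add]
    apply Real.exp_le_exp.2
    have h3 := hF2 β ⟨hβ0.le, by linarith⟩ α₁ hx1 α₂ hy1
    have h4 : β * Real.log (fB γ β α₁) + (1 - β) * Real.log (fB γ (1 - β) α₂) ≤
        2 * Φ - c / 2 * (β - 1 / 2) ^ 2 - Real.log 2 - Real.binEntropy β + α₁ ^ 2 + α₂ ^ 2 := by
      rw [Real.binEntropy, Real.log_inv, Real.log_inv]
      rw [F2] at h3
      linarith
    have h5 := mul_le_mul_of_nonneg_left h4 hn'.le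
    have h6 : 3 / k * (t * n) * β + 3 / k * (t * n) * (1 - β) = 3 / k * (t * n) := by ring
    linarith
  obtain ⟨hp1, hp2, hp3⟩ := integral_exp_sq_gaussianReal_le (a := 4 * N) (by positivity)
  have hη := gaussianReal_compl_Icc_le (a := 4 * N) (by positivity)
  rw [show (4 * N) ^ 2 / 2 = 8 * n by rw [mul_pow, hN2]; ring] at hη
  have hB : ∀ m : ℝ, ∀ i : ℕ, i ≤ n → 0 ≤ m → m ≤ 1 → (m + 3 * e) ^ i ≤ Real.exp (3 * (t * n)) := by
    intro m i hi hm0 hm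
    calc (m + 3 * e) ^ i ≤ (Real.exp (3 * t)) ^ i := by
          apply pow_le_pow_left₀ (by positivity)
          linarith [Real.add_one_le_exp (3 * t)]
      _ = Real.exp (i * (3 * t)) := by rw [Real.exp_nat_mul]
      _ ≤ Real.exp (n * (3 * t)) := by gcongr
      _ = _ := by ring_nf
  have h28 : 2 * Real.exp (-(8 * n : ℝ)) ≤ 1 := by
    have hn1 : (1 : ℝ) ≤ n := by exact_mod_cast hn
    rw [Real.exp_neg, ← div_eq_mul_inv, div_le_one (Real.exp_pos _)]
    linarith [Real.add_one_le_exp (8 * n : ℝ)]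
  have hmain := integral_mul_integral_le (μ := gaussianReal 0 1) (f := f) (g := g)
    (p := fun x => Real.exp (x ^ 2 / 2)) (S := Set.Icc (-(4 * N)) (4 * N)) (X := X)
    (P := 2 * (4 * N)) (B := Real.exp (3 * (t * n))) (η := 2 * Real.exp (-(8 * n : ℝ)))
    measurableSet_Icc (integrable_fieldIntegrand he) (integrable_fieldIntegrand he) hp1
    (fun x => pow_nonneg (add_nonneg (fB_nonneg _ _ _) (by linarith)) _)
    (fun x => pow_nonneg (add_nonneg (fB_nonneg _ _ _) (by linarith)) _)
    (Real.exp_pos _).le hp3 hp2 hfg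
    (fun x => hB _ _ hun (fB_nonneg _ _ _) (fB_le_one _ _ _))
    (fun x => hB _ _ (Nat.sub_le _ _) (fB_nonneg _ _ _) (fB_le_one _ _ _)) hη h28
  have htail : Real.exp (-(8 * n : ℝ)) * Real.exp (3 * (t * n)) ^ 2 ≤ X := by
    rw [← Real.exp_nat_mul, ← Real.exp_add]
    apply Real.exp_le_exp.2
    have h1 : Real.binEntropy β ≤ 1 := Real.binEntropy_le_log_two.trans (by linarith [Real.log_two_lt_d9])
    have h2 : Real.log 2 ≤ 1 := by linarith [Real.log_two_lt_d9]
    have h3 : (β - 1 / 2) ^ 2 ≤ 1 := by nlinarith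
    have h4 : c / 2 * (β - 1 / 2) ^ 2 ≤ 1 := by nlinarith [sq_nonneg (β - 1 / 2)]
    have h5 : n * (-8) ≤ n * (2 * Φ - Real.log 2 - c / 2 * (β - 1 / 2) ^ 2 - Real.binEntropy β) :=
      mul_le_mul_of_nonneg_left (by linarith) hn'.le
    have h6 : 0 ≤ 3 / k * (t * n) := by positivity
    have h7 : 0 ≤ t * n := by positivity
    push_cast
    linarith
  have hn1 : (1 : ℝ) ≤ n := by exact_mod_cast hn
  calc fieldIntegral γ β t e n u * fieldIntegral γ (1 - β) t e n (n - u)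
      = (∫ x, f x ∂gaussianReal 0 1) * ∫ x, g x ∂gaussianReal 0 1 := rfl
    _ ≤ _ := hmain
    _ = 64 * n * X + 6 * (Real.exp (-(8 * n : ℝ)) * Real.exp (3 * (t * n)) ^ 2) := by
        rw [← hN2]; ring
    _ ≤ 64 * n * X + 6 * (n * X) := by
        have : X ≤ n * X := le_mul_of_one_le_left (Real.exp_pos _).le hn1
        linarith
    _ = 70 * n * X := by ring

theorem choose_mul_pairProb_le {γ l t Φ c ν k : ℝ} (ρ : Fin n → Bool) {u : ℕ} (hΦ : 0 ≤ Φ)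
    (hc1 : c ≤ 1) (hν : 0 < ν) (hk : 0 < k) (hl : 0 ≤ l) (hl4 : 4 * l ≤ 1)
    (ht : 0 ≤ t) (ht1 : t ≤ 0.1) (he : Real.exp (-(l * (t * Real.sqrt n))) ≤ t)
    (hl3 : 300 * (n : ℝ) ^ 2 * (4 * l) ^ 3 ≤ t * n) (hl5 : 5 * l ≤ t)
    (hF2 : ∀ β ∈ Set.Icc (0 : ℝ) 1, ∀ α₁ ∈ Set.Icc (-5 : ℝ) 5, ∀ α₂ ∈ Set.Icc (-5 : ℝ) 5,
      F2 γ β α₁ α₂ ≤ 4 * Φ - c * (β - 1 / 2) ^ 2)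
    (hfB : ∀ β ∈ Set.Icc ν (1 - ν), ∀ α ∈ Set.Icc (-5 : ℝ) 5, k ≤ fB γ β α)
    (hρ : (Finset.univ.filter fun w => ρ w = true).card = u) (hn : 0 < n)
    (hu : (u / n : ℝ) ∈ Set.Icc ν (1 - ν)) :
    n.choose u * pairProb n (Real.sqrt 2 * γ * Real.sqrt n) ρ ≤
      70 * n * Real.exp (n * (2 * Φ - Real.log 2 - c / 2 * (u / n - 1 / 2) ^ 2) +
        (24 + 3 / k) * (t * n)) := by
  have hn' : (0 : ℝ) < n := by exact_mod_cast hn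
  have hu0 : 0 < u := by
    have := hν.trans_le hu.1
    rw [div_pos_iff_of_pos_right hn'] at this
    exact_mod_cast this
  have hun : u < n := by
    have : (u / n : ℝ) < 1 := by linarith [hu.2]
    rw [div_lt_one hn'] at this
    exact_mod_cast this
  have h1 := pairProb_le_fieldIntegral (γ := γ) ρ hl hl4 ht hρ hu0 hun
  set e := Real.exp (-(l * (t * Real.sqrt n))) with hedef
  have h2 := fieldIntegral_mul_le (n := n) (u := u) hΦ hc1 hν hk ht ht1 (Real.exp_pos _).le he hF2 hfB hn
    hun.le hu
  have h3 := choose_le_exp_binEntropy hun.le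
  have hE : Real.exp (2 * n * e + (300 * (n : ℝ) ^ 2 * (4 * l) ^ 3 + 5 * l * n)) ≤
      Real.exp (4 * (t * n)) := by
    apply Real.exp_le_exp.2
    have h4 : 2 * n * e ≤ 2 * n * t := by gcongr
    have h5 : 5 * l * n ≤ t * n := by gcongr
    linarith
  calc n.choose u * pairProb n (Real.sqrt 2 * γ * Real.sqrt n) ρ
      ≤ Real.exp (n * Real.binEntropy (u / n)) * (Real.exp (4 * (t * n)) * (70 * n * Real.exp (n * (2 * Φ - Real.log 2 - c / 2 * (u / n - 1 / 2) ^ 2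
        - Real.binEntropy (u / n)) + (20 + 3 / k) * (t * n)))) := by
        refine mul_le_mul h3 (h1.trans ?_) (unifProb_nonneg _) (Real.exp_pos _).le
        refine mul_le_mul hE h2 ?_ (Real.exp_pos _).le
        refine mul_nonneg (integral_nonneg fun x => ?_) (integral_nonneg fun x => ?_) <;>
        exact pow_nonneg (add_nonneg (fB_nonneg _ _ _) (by positivity)) _
    _ = 70 * n * (Real.exp (n * Real.binEntropy (u / n)) * Real.exp (4 * (t * n)) * Real.exp (n * (2 * Φ - Real.log 2 - c / 2 * (u / n - 1 / 2) ^ 2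
        - Real.binEntropy (u / n)) + (20 + 3 / k) * (t * n))) := by ring
    _ = _ := by
        rw [← Real.exp_add, ← Real.exp_add]
        ring_nf

lemma sum_inv_choose_card : ∑ ρ : Fin n → Bool,
    ((n.choose (Finset.univ.filter fun w => ρ w = true).card : ℕ) : ℝ)⁻¹ = n + 1 := by
  let e : (Fin n → Bool) ≃ Finset (Fin n) :=
    { toFun := fun ρ => Finset.univ.filter fun w => ρ w = true
      invFun := fun A w => decide (w ∈ A)
      left_inv := fun ρ => by ext w; simp
      right_inv := fun A => by ext w; simp }
  rw [Fintype.sum_equiv e (fun ρ => ((n.choose (Finset.univ.filter fun w => ρ w = true).card : ℕ) : ℝ)⁻¹)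
    (fun A => ((n.choose A.card : ℕ) : ℝ)⁻¹) fun ρ => rfl]
  rw [← Finset.powerset_univ, Finset.sum_powerset_apply_card (fun m => ((n.choose m : ℕ) : ℝ)⁻¹)]
  rw [Finset.card_univ, Fintype.card_fin]
  rw [Finset.sum_congr rfl (g := fun _ => (1 : ℝ))]
  · simp
  · intro m hm
    have : (n.choose m : ℝ) ≠ 0 := by
      exact_mod_cast (Nat.choose_pos (Nat.lt_succ_iff.1 (Finset.mem_range.1 hm))).ne'
    rw [nsmul_eq_mul, mul_inv_cancel₀ this]

lemma sum_le_of_choose_mul_le (S : Finset (Fin n → Bool)) (f : (Fin n → Bool) → ℝ) {X : ℝ} (hX : 0 ≤ X)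
    (h : ∀ ρ ∈ S, (n.choose (Finset.univ.filter fun w => ρ w = true).card : ℝ) * f ρ ≤ X) :
    ∑ ρ ∈ S, f ρ ≤ (n + 1) * X := by
  calc ∑ ρ ∈ S, f ρ
      ≤ ∑ ρ ∈ S, ((n.choose (Finset.univ.filter fun w => ρ w = true).card : ℕ) : ℝ)⁻¹ * X := by
        refine Finset.sum_le_sum fun ρ hρ => ?_
        have hpos : (0 : ℝ) < (n.choose (Finset.univ.filter fun w => ρ w = true).card : ℕ) := by
          exact_mod_cast Nat.choose_pos ((Finset.card_le_univ _).trans_eq (Fintype.card_fin n))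
        rw [inv_mul_eq_div, le_div_iff₀ hpos, mul_comm]
        exact h ρ hρ
    _ ≤ ∑ ρ : Fin n → Bool, ((n.choose (Finset.univ.filter fun w => ρ w = true).card : ℕ) : ℝ)⁻¹ * X :=
        Finset.sum_le_sum_of_subset_of_nonneg (Finset.subset_univ S) fun ρ _ _ => by positivity
    _ = (n + 1) * X := by rw [← Finset.sum_mul, sum_inv_choose_card]

end ExponentialBounds

section SecondMomentAsymptotics

open Filter Topology

variable {n : ℕ}

theorem exp_le_unifProb_hasGoodFamily (hn : 0 < n) (G : Finset (Fin n → Bool))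
    (hG : (2 : ℝ) ^ n ≤ G.card * (n + 1)) (U d : ℝ) {Φ W Z Y s : ℝ}
    (hW : 4 * ((n : ℝ) + 1) ^ 2 ≤ Real.exp W) (hY : 8 * W + 1 + Z ≤ Y) (hY0 : 0 ≤ Y)
    (hYΦ : Y ≤ 3 * (n * Φ) / 4) (hs : 4 * W + 1 ≤ s)
    (hπ : Real.exp (n * (Φ - Real.log 2) - W) ≤ singleProb n U)
    (hall : ∀ ρ : Fin n → Bool,
      n.choose (Finset.univ.filter fun w => ρ w = true).card * pairProb n U ρ ≤
        Real.exp (n * (2 * Φ - Real.log 2) + W) ∨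
      n.choose (Finset.univ.filter fun w => ρ w = true).card * pairProb n U ρ ≤
        Real.exp (n * Φ / 4) * singleProb n U)
    (hbad : ∀ ρ : Fin n → Bool, d < |∑ w, spin (ρ w)| →
      n.choose (Finset.univ.filter fun w => ρ w = true).card * pairProb n U ρ ≤
        Real.exp (n * (2 * Φ - Real.log 2) + W - Y) ∨
      n.choose (Finset.univ.filter fun w => ρ w = true).card * pairProb n U ρ ≤
        Real.exp (n * Φ / 4) * singleProb n U) :
    Real.exp (-s) ≤ unifProb fun x => HasGoodFamily x G d (Real.exp (-Z)) U := by
  classical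
  set π := singleProb n U with hπdef
  have hπ0 : 0 < π := (Real.exp_pos _).trans_le hπ
  have hn1 : (0 : ℝ) < (n : ℝ) + 1 := by positivity
  have h2n : (2 : ℝ) ^ n = Real.exp (n * Real.log 2) := by
    rw [Real.exp_nat_mul, Real.exp_log (by norm_num)]
  have hGne : G.Nonempty := by
    rw [Finset.nonempty_iff_ne_empty]
    rintro rfl
    have : (0 : ℝ) < 2 ^ n := by positivity
    simp at hG
    linarith
  set D := (G.card : ℝ) * π ^ 2 with hD
  have hGπ : Real.exp (n * Φ - W) ≤ (n + 1) * (G.card * π) := by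
    calc Real.exp (n * Φ - W) = Real.exp (n * Real.log 2) * Real.exp (n * (Φ - Real.log 2) - W) := by
          rw [← Real.exp_add]; ring_nf
      _ ≤ (G.card * (n + 1)) * π := by
          rw [← h2n]
          exact mul_le_mul hG hπ (Real.exp_pos _).le (by positivity)
      _ = _ := by ring
  have hcen : ∀ y, Real.exp (n * (2 * Φ - Real.log 2) + W - y) ≤ (n + 1) * Real.exp (3 * W - y) * D := by
    intro y
    calc Real.exp (n * (2 * Φ - Real.log 2) + W - y)
        = Real.exp (3 * W - y) * (Real.exp (n * Φ - W) * Real.exp (n * (Φ - Real.log 2) - W)) := by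
          rw [← Real.exp_add, ← Real.exp_add]; ring_nf
      _ ≤ Real.exp (3 * W - y) * ((n + 1) * (G.card * π) * π) := by gcongr
      _ = _ := by rw [hD]; ring
  have hext : Real.exp (n * Φ / 4) * π ≤ (n + 1) * Real.exp (3 * W - Y) * D := by
    have hW0 : 0 ≤ W := by
      have h4 : (1 : ℝ) ≤ Real.exp W := by
        refine le_trans ?_ hW
        nlinarith [(Nat.cast_nonneg n : (0 : ℝ) ≤ n)]
      exact Real.one_le_exp_iff.1 h4
    calc Real.exp (n * Φ / 4) * π ≤ Real.exp (3 * W - Y) * Real.exp (n * Φ - W) * π := by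
          gcongr
          rw [← Real.exp_add]
          apply Real.exp_le_exp.2
          linarith
      _ ≤ Real.exp (3 * W - Y) * ((n + 1) * (G.card * π)) * π := by gcongr
      _ = _ := by rw [hD]; ring
  have hD0 : 0 < D := by
    have : (0 : ℝ) < G.card := by exact_mod_cast hGne.card_pos
    positivity
  have h2 : ∑ ρ, pairProb n U ρ ≤ ((n + 1) * ((n + 1) * Real.exp (3 * W))) * D := by
    have := sum_le_of_choose_mul_le Finset.univ (pairProb n U)
      (X := (n + 1) * Real.exp (3 * W) * D) (by positivity) (fun ρ _ => by
        rcases hall ρ with h | h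
        · have := hcen 0
          simp only [sub_zero] at this
          exact h.trans this
        · refine (h.trans hext).trans ?_
          gcongr
          linarith)
    linarith
  have h3 : ∑ ρ : Fin n → Bool with d < |∑ w, spin (ρ w)|, pairProb n U ρ ≤
      ((n + 1) * ((n + 1) * Real.exp (3 * W - Y))) * D := by
    have := sum_le_of_choose_mul_le (Finset.univ.filter fun ρ : Fin n → Bool => d < |∑ w, spin (ρ w)|)
      (pairProb n U) (X := (n + 1) * Real.exp (3 * W - Y) * D) (by positivity) (fun ρ hρ => by
        rcases hbad ρ (Finset.mem_filter.1 hρ).2 with h | h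
        · exact h.trans (hcen Y)
        · exact h.trans hext)
    linarith
  refine le_trans ?_ (unifProb_hasGoodFamily_ge G hGne U d (Real.exp (-Z)) _ _ hπ0 (by positivity)
    (Real.exp_pos _) h2 h3)
  have h4 : Real.exp (-(4 * W)) ≤ 1 / (4 * ((n + 1) * ((n + 1) * Real.exp (3 * W)))) := by
    rw [Real.exp_neg, ← one_div]
    apply one_div_le_one_div_of_le (by positivity)
    calc 4 * (((n : ℝ) + 1) * ((n + 1) * Real.exp (3 * W))) = 4 * ((n : ℝ) + 1) ^ 2 * Real.exp (3 * W) := by ring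
      _ ≤ Real.exp W * Real.exp (3 * W) := by gcongr
      _ = Real.exp (4 * W) := by rw [← Real.exp_add]; ring_nf
  have h5 : 4 * ((n + 1) * ((n + 1) * Real.exp (3 * W - Y))) / Real.exp (-Z) ≤ Real.exp (-(4 * W) - 1) := by
    rw [div_le_iff₀ (Real.exp_pos _), ← Real.exp_add]
    calc 4 * (((n : ℝ) + 1) * ((n + 1) * Real.exp (3 * W - Y))) = 4 * ((n : ℝ) + 1) ^ 2 * Real.exp (3 * W - Y) := by ring
      _ ≤ Real.exp W * Real.exp (3 * W - Y) := by gcongr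
      _ = Real.exp (4 * W - Y) := by rw [← Real.exp_add]; ring_nf
      _ ≤ _ := Real.exp_le_exp.2 (by linarith)
  have h6 : 2 * Real.exp (-(4 * W) - 1) ≤ Real.exp (-(4 * W)) := by
    rw [Real.exp_sub, ← mul_div_assoc, div_le_iff₀ (Real.exp_pos _), mul_comm]
    gcongr
    linarith [Real.add_one_le_exp (1 : ℝ)]
  have h7 : Real.exp (-s) ≤ Real.exp (-(4 * W) - 1) := Real.exp_le_exp.2 (by linarith)
  linarith

lemma eventually_mul_rpow_le (C : ℝ) {a b : ℝ} (h : a < b) :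
    ∀ᶠ n : ℕ in atTop, C * (n : ℝ) ^ a ≤ (n : ℝ) ^ b := by
  have h1 : Tendsto (fun n : ℕ => (n : ℝ) ^ (b - a)) atTop atTop :=
    (tendsto_rpow_atTop (sub_pos.2 h)).comp tendsto_natCast_atTop_atTop
  filter_upwards [h1.eventually_ge_atTop C, eventually_gt_atTop 0] with n hn hn0
  have hn0' : (0 : ℝ) < n := by exact_mod_cast hn0
  calc C * (n : ℝ) ^ a ≤ (n : ℝ) ^ (b - a) * (n : ℝ) ^ a := by gcongr
    _ = (n : ℝ) ^ b := by rw [← Real.rpow_add hn0']; ring_nf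

lemma eventually_mul_log_mul_rpow_le {C : ℝ} (hC : 0 ≤ C) {a b : ℝ} (h : a < b) :
    ∀ᶠ n : ℕ in atTop, C * (Real.log (n + 1) * (n : ℝ) ^ a) ≤ (n : ℝ) ^ b := by
  set c := (b - a) / 2 with hc
  have hc0 : 0 < c := by rw [hc]; linarith
  filter_upwards [eventually_mul_rpow_le (C * (2 ^ c / c)) (show a + c < b by rw [hc]; linarith),
    eventually_gt_atTop 0] with n hn hn0
  have hn0' : (0 : ℝ) < n := by exact_mod_cast hn0
  have hn1 : (1 : ℝ) ≤ n := by exact_mod_cast hn0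
  have hlog : Real.log (n + 1) ≤ 2 ^ c / c * (n : ℝ) ^ c := by
    calc Real.log (n + 1) ≤ Real.log (2 * n) := Real.log_le_log (by positivity) (by linarith)
      _ ≤ (2 * n) ^ c / c := Real.log_le_rpow_div (by positivity) hc0
      _ = 2 ^ c / c * (n : ℝ) ^ c := by rw [Real.mul_rpow (by norm_num) hn0'.le]; ring
  calc C * (Real.log (n + 1) * (n : ℝ) ^ a) ≤ C * (2 ^ c / c * (n : ℝ) ^ c * (n : ℝ) ^ a) := by gcongr
    _ = C * (2 ^ c / c) * (n : ℝ) ^ (a + c) := by rw [Real.rpow_add hn0']; ring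
    _ ≤ _ := hn

lemma exists_binEntropy_le {η : ℝ} (hη : 0 < η) :
    ∃ ν > 0, ν < 1 / 2 ∧ ∀ β ∈ Set.Icc (0 : ℝ) 1, β ∉ Set.Icc ν (1 - ν) → Real.binEntropy β ≤ η := by
  have h := Metric.continuousAt_iff.1 (Real.binEntropy_continuous.continuousAt (x := 0)) η hη
  obtain ⟨r, hr, h⟩ := h
  refine ⟨min r (1 / 3), by positivity, (min_le_right _ _).trans_lt (by norm_num), ?_⟩
  have key : ∀ β : ℝ, 0 ≤ β → β < r → Real.binEntropy β ≤ η := by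
    intro β h0 hβ
    have := h (x := β) (by rwa [Real.dist_eq, sub_zero, abs_of_nonneg h0])
    rw [Real.binEntropy_zero, Real.dist_eq, sub_zero] at this
    exact (le_abs_self _).trans this.le
  intro β hβ hout
  rcases lt_or_ge β (min r (1 / 3)) with h1 | h1
  · exact key β hβ.1 (h1.trans_le (min_le_left _ _))
  · have h2 : 1 - min r (1 / 3) < β := by
      by_contra h3
      exact hout ⟨h1, not_lt.1 h3⟩
    rw [← Real.binEntropy_one_sub]
    refine key _ (by linarith [hβ.2]) ?_
    have := min_le_left r (1 / 3)
    linarith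

set_option maxHeartbeats 1000000 in
theorem eventually_hasGoodFamily {γ α c : ℝ} (hκ : Real.sqrt 2 * γ ≤ 0.8) (hΦ : 0 < F1 γ α)
    (hc : 0 < c) (hc1 : c ≤ 1)
    (hF2 : ∀ β ∈ Set.Icc (0 : ℝ) 1, ∀ α₁ ∈ Set.Icc (-5 : ℝ) 5, ∀ α₂ ∈ Set.Icc (-5 : ℝ) 5,
      F2 γ β α₁ α₂ ≤ 4 * F1 γ α - c * (β - 1 / 2) ^ 2) :
    ∀ᶠ n : ℕ in atTop, ∀ G : Finset (Fin n → Bool), (2 : ℝ) ^ n ≤ G.card * (n + 1) →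
      Real.exp (-(n : ℝ) ^ (0.91 : ℝ)) ≤ unifProb fun x =>
        HasGoodFamily x G ((n : ℝ) ^ (-0.01 : ℝ) * n) (Real.exp (-(n : ℝ) ^ (0.97 : ℝ)))
          (Real.sqrt 2 * γ * Real.sqrt n) := by
  set Φ := F1 γ α with hΦdef
  obtain ⟨ν, hν, hν2, hent⟩ := exists_binEntropy_le (η := Φ / 4) (by positivity)
  obtain ⟨k, hk, hfB⟩ := exists_fB_ge γ 5 hν
  set y := (γ + α) * Real.sqrt 2 with hy
  set K := (10 : ℝ) ^ 14 + 20 + 8 * |α| + (24 + 3 / k) with hK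
  filter_upwards [eventually_ge_atTop 20,
    eventually_mul_rpow_le 4 (show (-0.38 : ℝ) < 0 by norm_num),
    eventually_mul_rpow_le 10 (show (-0.1 : ℝ) < 0 by norm_num),
    eventually_mul_log_mul_rpow_le (C := 1) (by norm_num) (show (0 : ℝ) < 0.02 by norm_num),
    eventually_mul_rpow_le 19200 (show (0.86 : ℝ) < 0.9 by norm_num),
    eventually_mul_rpow_le 5 (show (-0.38 : ℝ) < -0.1 by norm_num),
    eventually_mul_rpow_le 1 (show (1 / 2 : ℝ) < 0.9 by norm_num),
    eventually_mul_rpow_le (2 * |y|) (show (0 : ℝ) < 0.9 by norm_num),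
    eventually_mul_rpow_le (2 * K) (show (0.9 : ℝ) < 0.905 by norm_num),
    eventually_mul_log_mul_rpow_le (C := 20) (by norm_num) (show (0 : ℝ) < 0.905 by norm_num),
    eventually_mul_rpow_le (20 / c) (show (0.975 : ℝ) < 0.98 by norm_num),
    eventually_mul_rpow_le (2 / Φ) (show (0.975 : ℝ) < 1 by norm_num),
    eventually_mul_rpow_le 3 (show (0.97 : ℝ) < 0.975 by norm_num),
    eventually_mul_rpow_le 30 (show (0.905 : ℝ) < 0.91 by norm_num),
    eventually_mul_rpow_le 30 (show (0.905 : ℝ) < 0.97 by norm_num)]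
    with n hn e1 e2 e3 e4 e5 e6 e7 e8 e9 e10 e11 e12 e13 e14
  intro G hG
  have hn' : (20 : ℝ) ≤ n := by exact_mod_cast hn
  have hn0 : (0 : ℝ) < n := by linarith
  set l := (n : ℝ) ^ (-0.38 : ℝ) with hl
  set t := (n : ℝ) ^ (-0.1 : ℝ) with ht
  set W := (n : ℝ) ^ (0.905 : ℝ) with hW
  set Y := (n : ℝ) ^ (0.975 : ℝ) with hY
  simp only [Real.rpow_zero, mul_one, one_mul, Real.rpow_one] at e1 e2 e3 e7 e9 e11
  have hl0 : 0 < l := by positivity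
  have ht0 : 0 < t := by positivity
  have htn : t * n = (n : ℝ) ^ (0.9 : ℝ) := by
    rw [ht, ← Real.rpow_add_one hn0.ne']; norm_num
  rw [← htn] at e4 e6 e7 e8
  rw [← Real.sqrt_eq_rpow, one_mul] at e6
  have hlt : l * (t * Real.sqrt n) = (n : ℝ) ^ (0.02 : ℝ) := by
    rw [hl, ht, Real.sqrt_eq_rpow, ← Real.rpow_add hn0, ← Real.rpow_add hn0]; norm_num
  have he : Real.exp (-(l * (t * Real.sqrt n))) ≤ t := by
    rw [hlt, ht, Real.rpow_def_of_pos hn0 (-0.1)]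
    apply Real.exp_le_exp.2
    have h1 : Real.log n ≤ Real.log (n + 1) := Real.log_le_log hn0 (by linarith)
    have h2 : 0 ≤ Real.log n := Real.log_nonneg (by linarith)
    linarith
  have hl3 : 300 * (n : ℝ) ^ 2 * (4 * l) ^ 3 ≤ t * n := by
    refine le_trans (le_of_eq ?_) e4
    have h1 : l ^ 3 = (n : ℝ) ^ (-1.14 : ℝ) := by
      rw [hl, ← Real.rpow_natCast, ← Real.rpow_mul hn0.le]; norm_num
    have h2 : (n : ℝ) ^ (0.86 : ℝ) = (n : ℝ) ^ 2 * (n : ℝ) ^ (-1.14 : ℝ) := by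
      rw [← Real.rpow_natCast, ← Real.rpow_add hn0]; norm_num
    rw [mul_pow, h1, h2]
    ring
  have ht1 : t ≤ 0.1 := by linarith
  have hW1 : 1 ≤ W := Real.one_le_rpow (by linarith) (by norm_num)
  have hlog : Real.log (n + 1) ≤ W / 20 := by linarith
  have hK1 : (10 ^ 14 + 20 + 8 * |α|) * (t * n) ≤ W := by
    have h1 : (10 ^ 14 + 20 + 8 * |α|) ≤ 2 * K := by
      rw [hK]
      have := abs_nonneg α
      have : 0 ≤ 3 / k := by positivity
      linarith
    exact (mul_le_mul_of_nonneg_right h1 (by positivity)).trans e8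
  have hK2 : (24 + 3 / k) * (t * n) ≤ W / 2 := by
    have h1 : (24 + 3 / k) ≤ K := by
      rw [hK]
      have := abs_nonneg α
      linarith
    have h2 := mul_le_mul_of_nonneg_right h1 (show 0 ≤ t * n by positivity)
    linarith
  have hpoly : ∀ m : ℕ, ((n : ℝ) + 1) ^ m = Real.exp (m * Real.log (n + 1)) := fun m => by
    rw [Real.exp_nat_mul, Real.exp_log (by linarith)]
  have h70 : 70 * (n : ℝ) * Real.exp ((24 + 3 / k) * (t * n)) ≤ Real.exp W := by
    calc 70 * (n : ℝ) * Real.exp ((24 + 3 / k) * (t * n)) ≤ ((n : ℝ) + 1) ^ 3 * Real.exp (W / 2) := by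
          gcongr
          nlinarith
      _ ≤ Real.exp W := by
          rw [hpoly, ← Real.exp_add]
          apply Real.exp_le_exp.2
          push_cast
          linarith
  have hcentral : ∀ ρ : Fin n → Bool, ((Finset.univ.filter fun w => ρ w = true).card / n : ℝ) ∈ Set.Icc ν (1 - ν) →
      n.choose (Finset.univ.filter fun w => ρ w = true).card * pairProb n (Real.sqrt 2 * γ * Real.sqrt n) ρ ≤
        Real.exp (n * (2 * Φ - Real.log 2) + W - n * (c / 2 * ((Finset.univ.filter fun w => ρ w = true).card / n - 1 / 2) ^ 2)) := by
    intro ρ hρ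
    refine (choose_mul_pairProb_le ρ hΦ.le hc1 hν hk hl0.le e1 ht0.le ht1 he hl3 e5 hF2 hfB rfl
      (by omega) hρ).trans ?_
    set z := c / 2 * ((Finset.univ.filter fun w => ρ w = true).card / n - 1 / 2 : ℝ) ^ 2
    calc 70 * n * Real.exp (n * (2 * Φ - Real.log 2 - z) + (24 + 3 / k) * (t * n))
        = Real.exp (n * (2 * Φ - Real.log 2 - z)) * (70 * n * Real.exp ((24 + 3 / k) * (t * n))) := by
          rw [Real.exp_add]; ring
      _ ≤ Real.exp (n * (2 * Φ - Real.log 2 - z)) * Real.exp W := by gcongr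
      _ = _ := by rw [← Real.exp_add]; ring_nf
  have hextreme : ∀ ρ : Fin n → Bool, ((Finset.univ.filter fun w => ρ w = true).card / n : ℝ) ∉ Set.Icc ν (1 - ν) →
      n.choose (Finset.univ.filter fun w => ρ w = true).card * pairProb n (Real.sqrt 2 * γ * Real.sqrt n) ρ ≤
        Real.exp (n * Φ / 4) * singleProb n (Real.sqrt 2 * γ * Real.sqrt n) := by
    intro ρ hρ
    have hle : (Finset.univ.filter fun w => ρ w = true).card ≤ n :=
      (Finset.card_le_univ _).trans_eq (Fintype.card_fin n)
    have h1 := hent _ ⟨by positivity, (div_le_one hn0).2 (by exact_mod_cast hle)⟩ hρ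
    refine mul_le_mul ((choose_le_exp_binEntropy hle).trans (Real.exp_le_exp.2 ?_))
      (pairProb_le_singleProb _ _) (unifProb_nonneg _) (Real.exp_pos _).le
    rw [mul_div_assoc]
    gcongr
  refine exp_le_unifProb_hasGoodFamily (Φ := Φ) (W := W) (Y := Y) (by omega) G hG _ _ ?_ ?_ (by positivity) ?_ ?_ ?_ ?_ ?_
  · calc 4 * ((n : ℝ) + 1) ^ 2 ≤ ((n : ℝ) + 1) ^ 3 := by nlinarith [sq_nonneg ((n : ℝ) + 1)]
      _ ≤ Real.exp W := by
          rw [hpoly]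
          apply Real.exp_le_exp.2
          push_cast
          linarith
  · linarith
  · rw [div_mul_eq_mul_div, div_le_iff₀ hΦ] at e11
    nlinarith
  · linarith
  · exact (Real.exp_le_exp.2 (by linarith)).trans (exp_F1_le_singleProb hn hκ hl0.le e1 ht0.le
      (by linarith) he hl3 e6 e7)
  · intro ρ
    by_cases h : ((Finset.univ.filter fun w => ρ w = true).card / n : ℝ) ∈ Set.Icc ν (1 - ν)
    · refine Or.inl ((hcentral ρ h).trans (Real.exp_le_exp.2 ?_))
      have : 0 ≤ n * (c / 2 * ((Finset.univ.filter fun w => ρ w = true).card / n - 1 / 2 : ℝ) ^ 2) := by positivity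
      linarith
    · exact Or.inr (hextreme ρ h)
  · intro ρ hbad
    by_cases h : ((Finset.univ.filter fun w => ρ w = true).card / n : ℝ) ∈ Set.Icc ν (1 - ν)
    · refine Or.inl ((hcentral ρ h).trans (Real.exp_le_exp.2 ?_))
      rw [sum_spin_eq] at hbad
      set u : ℝ := ((Finset.univ.filter fun w => ρ w = true).card : ℝ) with hu
      have h1 : (u / n - 1 / 2) = (2 * u - n) / (2 * n) := by field_simp
      have h2 : ((n : ℝ) ^ (-0.01 : ℝ) * n) ^ 2 ≤ (2 * u - n) ^ 2 := by
        rw [← sq_abs (2 * u - n)]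
        exact pow_le_pow_left₀ (mul_nonneg (Real.rpow_nonneg hn0.le _) hn0.le) hbad.le 2
      have h3 : (n : ℝ) ^ (0.98 : ℝ) = ((n : ℝ) ^ (-0.01 : ℝ) * n) ^ 2 / n := by
        rw [eq_div_iff hn0.ne', ← Real.rpow_add_one hn0.ne', ← Real.rpow_add_one hn0.ne',
          ← Real.rpow_natCast, ← Real.rpow_mul hn0.le]
        norm_num
      have h4 : n * (c / 2 * ((2 * u - n) / (2 * n)) ^ 2) = c / 8 * ((2 * u - n) ^ 2 / n) := by
        field_simp
        ring
      have h5 : c / 8 * (n : ℝ) ^ (0.98 : ℝ) ≤ c / 8 * ((2 * u - n) ^ 2 / n) := by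
        rw [h3]
        gcongr
      have h6 : Y ≤ c / 8 * (n : ℝ) ^ (0.98 : ℝ) := by
        rw [div_mul_eq_mul_div, div_le_iff₀ hc] at e10
        have : 0 < Y := by positivity
        linarith
      rw [h1, h4]
      linarith
    · exact Or.inr (hextreme ρ h)

end SecondMomentAsymptotics

section RandomSigns

open Filter Topology

/-- Spin configurations with `⌊n/2⌋` positive spins. -/
def balanced (n : ℕ) : Finset (Fin n → Bool) :=
  Finset.univ.filter fun σ => (Finset.univ.filter fun w => σ w = true).card = n / 2

variable {n : ℕ}

lemma abs_sum_spin_le_one_of_mem_balanced {σ : Fin n → Bool} (hσ : σ ∈ balanced n) :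
    |∑ w, spin (σ w)| ≤ 1 := by
  have h := (Finset.mem_filter.1 hσ).2
  rw [sum_spin_eq, h, abs_le]
  have h1 : n ≤ 2 * (n / 2) + 1 := by omega
  have h2 : 2 * (n / 2) ≤ n := by omega
  have h1' : (n : ℝ) ≤ 2 * ((n / 2 : ℕ) : ℝ) + 1 := by exact_mod_cast h1
  have h2' : 2 * ((n / 2 : ℕ) : ℝ) ≤ n := by exact_mod_cast h2
  constructor <;> linarith

lemma card_balanced (n : ℕ) : (balanced n).card = n.choose (n / 2) := by
  rw [← Finset.card_fin n, ← Finset.card_powersetCard, Finset.card_fin]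
  refine Finset.card_nbij' (fun σ => Finset.univ.filter fun w => σ w = true)
    (fun A w => decide (w ∈ A)) ?_ ?_ ?_ ?_
  · intro σ hσ
    simp only [balanced, Finset.coe_filter, Finset.mem_univ, true_and, Set.mem_ofPred_eq] at hσ
    simpa [Finset.mem_powersetCard] using hσ
  · intro A hA
    simp only [Finset.mem_coe, Finset.mem_powersetCard] at hA
    simpa [balanced] using hA.2
  · intro σ _
    ext w
    simp
  · intro A _
    ext w
    simp

lemma two_pow_le_card_balanced (n : ℕ) : (2 : ℝ) ^ n ≤ (balanced n).card * (n + 1) := by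
  rw [card_balanced]
  have h : 2 ^ n ≤ n.choose (n / 2) * (n + 1) := by
    rw [← Nat.sum_range_choose, mul_comm]
    calc ∑ m ∈ Finset.range (n + 1), n.choose m
        ≤ ∑ m ∈ Finset.range (n + 1), n.choose (n / 2) :=
          Finset.sum_le_sum fun m _ => Nat.choose_le_middle m n
      _ = (n + 1) * n.choose (n / 2) := by simp
  exact_mod_cast h

lemma size_le_log {k n : ℕ} (hkn : k ≤ n) : (Nat.size k : ℝ) ≤ 1 + 2 * Real.log (n + 1) := by
  have hlog : 0 ≤ Real.log ((n : ℝ) + 1) := Real.log_nonneg (by linarith [(Nat.cast_nonneg n : (0 : ℝ) ≤ n)])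
  rcases Nat.eq_zero_or_pos (Nat.size k) with h | h
  · rw [h]; push_cast; linarith
  · have h0 : 2 ^ (Nat.size k - 1) ≤ k := Nat.lt_size.1 (by omega)
    have h1 : 2 ^ (Nat.size k - 1) ≤ n + 1 := by omega
    have h2 : (2 : ℝ) ^ (Nat.size k - 1) ≤ n + 1 := by exact_mod_cast h1
    have h3 := Real.log_le_log (by positivity) h2
    rw [Real.log_pow, Nat.cast_sub h] at h3
    have h4 := Real.log_two_gt_d9
    have h5 : (1 : ℝ) ≤ Nat.size k := by exact_mod_cast h
    push_cast at h3
    nlinarith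

set_option maxHeartbeats 1000000 in
theorem tendsto_unifProb_exists_balanced {γ α c θ : ℝ} (hκ : Real.sqrt 2 * γ ≤ 0.8)
    (hΦ : 0 < F1 γ α) (hc : 0 < c) (hc1 : c ≤ 1)
    (hF2 : ∀ β ∈ Set.Icc (0 : ℝ) 1, ∀ α₁ ∈ Set.Icc (-5 : ℝ) 5, ∀ α₂ ∈ Set.Icc (-5 : ℝ) 5,
      F2 γ β α₁ α₂ ≤ 4 * F1 γ α - c * (β - 1 / 2) ^ 2) (hθ : θ < Real.sqrt 2 * γ) :
    Tendsto (fun n : ℕ => unifProb fun x : EdgeIdx n → Bool =>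
      ∃ σ ∈ balanced n, ∀ v, θ * Real.sqrt n ≤ rowOn x Finset.univ σ v) atTop (𝓝 1) := by
  have hgap : 0 < Real.sqrt 2 * γ - θ := sub_pos.2 hθ
  have hbound : ∀ᶠ n : ℕ in atTop, 1 - 4 * (1 / ((n : ℝ) + 1)) ≤ unifProb fun x : EdgeIdx n → Bool =>
      ∃ σ ∈ balanced n, ∀ v, θ * Real.sqrt n ≤ rowOn x Finset.univ σ v := by
    set A : ℝ := Real.log (4 * 10 ^ 28) with hA
    have hA0 : 0 ≤ A := Real.log_nonneg (by norm_num)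
    filter_upwards [eventually_hasGoodFamily hκ hΦ hc hc1 hF2, eventually_ge_atTop 20,
      eventually_mul_log_mul_rpow_le (C := 1) (by norm_num) (show (0 : ℝ) < 0.91 by norm_num),
      eventually_mul_log_mul_rpow_le (C := 16 * 53) (by norm_num) (show (0.965 : ℝ) < 0.98 by norm_num),
      eventually_mul_rpow_le (13 * 20) (show (0.965 : ℝ) < 1 by norm_num),
      eventually_mul_log_mul_rpow_le (C := 7 / (Real.sqrt 2 * γ - θ)) (by positivity)
        (show (0.49 : ℝ) < 1 / 2 by norm_num),
      eventually_mul_log_mul_rpow_le (C := 26 * A + 1) (by positivity) (show (0.965 : ℝ) < 0.97 by norm_num),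
      eventually_mul_log_mul_rpow_le (C := 32 * 10 ^ 14 * 21) (by norm_num) (show (0 : ℝ) < 0.005 by norm_num)]
      with n hfam hn e1 e2 e3 e4 e5 e6
    have hn' : (20 : ℝ) ≤ n := by exact_mod_cast hn
    have hn0 : (0 : ℝ) < n := by linarith
    have hn1 : (1 : ℝ) ≤ n := by linarith
    simp only [Real.rpow_zero, mul_one, one_mul, Real.rpow_one] at e1 e3 e6
    set Λ := Real.log ((n : ℝ) + 1) with hΛ
    have hΛ1 : 1 ≤ Λ := by
      rw [hΛ, Real.le_log_iff_exp_le (by linarith)]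
      linarith [Real.exp_one_lt_d9]
    set q := (n : ℝ) ^ (0.965 : ℝ) with hq
    have hq1 : 1 ≤ q := Real.one_le_rpow hn1 (by norm_num)
    set d := (n : ℝ) ^ (0.49 : ℝ) with hd
    have hd0 : 0 < d := by positivity
    set δ := (n : ℝ) ^ (-0.01 : ℝ) with hδ
    have hδ0 : 0 < δ := by positivity
    set k₀ := ⌈12 * q⌉₊ with hk₀
    have hk1 : 12 * q ≤ k₀ := Nat.le_ceil _
    have hk2 : (k₀ : ℝ) ≤ 13 * q := by
      have := Nat.ceil_lt_add_one (show 0 ≤ 12 * q by positivity)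
      linarith
    have hk3 : (k₀ : ℝ) ≤ 0.05 * n := by linarith
    have hk4 : k₀ ≤ n := by
      have : (k₀ : ℝ) ≤ n := by linarith
      exact_mod_cast this
    have hsmall : ∀ y : ℝ, Λ ≤ y → Real.exp (-y) ≤ 1 / ((n : ℝ) + 1) := by
      intro y hy
      rw [one_div, ← Real.exp_log (show (0 : ℝ) < (n : ℝ) + 1 by linarith), ← Real.exp_neg]
      exact Real.exp_le_exp.2 (by linarith)
    have hpow : ∀ m : ℕ, ((n : ℝ) + 1) ^ m = Real.exp (m * Λ) := fun m => by
      rw [Real.exp_nat_mul, hΛ, Real.exp_log (by linarith)]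
    have hU : θ * Real.sqrt n + 2 * d * Nat.size k₀ + d ≤ Real.sqrt 2 * γ * Real.sqrt n := by
      have h1 := size_le_log hk4
      rw [← hΛ] at h1
      have h2 : 2 * d * Nat.size k₀ ≤ 2 * d * (1 + 2 * Λ) := by gcongr
      rw [div_mul_eq_mul_div, div_le_iff₀ hgap, ← Real.sqrt_eq_rpow] at e4
      have h3 : d ≤ Λ * d := le_mul_of_one_le_left hd0.le hΛ1
      linarith
    have hb : Real.exp (-(n : ℝ) ^ (0.97 : ℝ)) ≤ badRatio n k₀ := by
      have h1 : badRatio n k₀ = Real.exp (-(2 * k₀ * A + Real.log n)) := by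
        have h2 : (4 * 10 ^ 28 : ℝ) ^ (2 * k₀) = Real.exp (2 * k₀ * A) := by
          rw [show (2 * k₀ * A : ℝ) = ((2 * k₀ : ℕ) : ℝ) * A by push_cast; ring, Real.exp_nat_mul, hA,
            Real.exp_log (by norm_num)]
        rw [badRatio, h2, neg_add, Real.exp_add, Real.exp_neg, Real.exp_neg, Real.exp_log hn0]
        rfl
      rw [h1]
      apply Real.exp_le_exp.2
      have h3 : Real.log n ≤ Λ := Real.log_le_log hn0 (by linarith)
      have h4 : 2 * k₀ * A ≤ 2 * (13 * q) * A := by gcongr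
      have h5 : Λ * 1 ≤ Λ * q := by gcongr
      have h6 : 1 * (26 * A * q) ≤ Λ * (26 * A * q) := by gcongr
      linarith
    have hqq : Real.exp (1 / 4 - 10 ^ (-14 : ℤ) /
        Real.sqrt (32 * (δ + k₀ / n + 1 / n) + 512 / n)) ≤ ((1 / ((n : ℝ) + 1)) ^ 5) ^ 4 := by
      set r := (n : ℝ) ^ (0.005 : ℝ) with hr
      have hr0 : 0 < r := by positivity
      have hδr : δ = (1 / r) ^ 2 := by
        rw [hδ, one_div, ← Real.rpow_neg hn0.le, ← Real.rpow_natCast, ← Real.rpow_mul hn0.le]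
        norm_num
      have h1 : 1 / (n : ℝ) ≤ δ := by
        rw [one_div, ← Real.rpow_neg_one]
        exact Real.rpow_le_rpow_of_exponent_le hn1 (by norm_num)
      have h2 : k₀ / n ≤ 13 * δ := by
        have h3 : q / n ≤ δ := by
          rw [hq, ← Real.rpow_sub_one hn0.ne']
          exact Real.rpow_le_rpow_of_exponent_le hn1 (by norm_num)
        calc (k₀ : ℝ) / n ≤ 13 * q / n := by gcongr
          _ = 13 * (q / n) := by ring
          _ ≤ 13 * δ := by gcongr
      have h3 : Real.sqrt (32 * (δ + k₀ / n + 1 / n) + 512 / n) ≤ 32 * (1 / r) := by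
        rw [show 32 * (1 / r) = Real.sqrt ((32 * (1 / r)) ^ 2) from (Real.sqrt_sq (by positivity)).symm]
        apply Real.sqrt_le_sqrt
        rw [mul_pow, ← hδr]
        have : 512 / (n : ℝ) = 512 * (1 / n) := by ring
        linarith
      have h4 : 0 < Real.sqrt (32 * (δ + k₀ / n + 1 / n) + 512 / n) := Real.sqrt_pos.2 (by positivity)
      have h5 : (10 : ℝ) ^ (-14 : ℤ) / 32 * r ≤
          10 ^ (-14 : ℤ) / Real.sqrt (32 * (δ + k₀ / n + 1 / n) + 512 / n) := by
        rw [le_div_iff₀ h4]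
        calc (10 : ℝ) ^ (-14 : ℤ) / 32 * r * Real.sqrt (32 * (δ + k₀ / n + 1 / n) + 512 / n)
            ≤ (10 : ℝ) ^ (-14 : ℤ) / 32 * r * (32 * (1 / r)) := by gcongr
          _ = 10 ^ (-14 : ℤ) := by field_simp
      rw [← pow_mul, one_div_pow, hpow, one_div (Real.exp _), ← Real.exp_neg]
      apply Real.exp_le_exp.2
      have h6 : (10 : ℝ) ^ (-14 : ℤ) / 32 * (32 * 10 ^ 14 * 21 * Λ) ≤ (10 : ℝ) ^ (-14 : ℤ) / 32 * r := by
        gcongr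
      have h7 : (10 : ℝ) ^ (-14 : ℤ) / 32 * (32 * 10 ^ 14 * 21 * Λ) = 21 * Λ := by
        norm_num
        ring
      push_cast
      linarith
    have hD : 12 * (Real.sqrt ((n : ℝ) ^ (0.91 : ℝ)) * n) ≤ k₀ * d := by
      have h1 : Real.sqrt ((n : ℝ) ^ (0.91 : ℝ)) * n = q * d := by
        rw [Real.sqrt_eq_rpow, ← Real.rpow_mul hn0.le, ← Real.rpow_add_one hn0.ne', hq, hd,
          ← Real.rpow_add hn0]
        norm_num
      rw [h1, ← mul_assoc]
      gcongr
    have hfin := unifProb_not_exists_good_le (by omega : 1 < n) (balanced n) k₀ (θ * Real.sqrt n) d δ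
      (Real.sqrt 2 * γ) (Real.exp (-(n : ℝ) ^ (0.97 : ℝ))) ((n : ℝ) ^ (0.91 : ℝ)) hδ0.le hκ hd0
      (by positivity) hU hb hk3 hqq hD (hfam _ (two_pow_le_card_balanced n))
    rw [unifProb_not] at hfin
    have h1 := hsmall _ e1
    have h2 : ((n : ℝ) + 1) ^ (4 * k₀) * Real.exp (-(d ^ 2 / 16)) ≤ 1 / ((n : ℝ) + 1) := by
      rw [hpow, ← Real.exp_add]
      have h3 : d ^ 2 = (n : ℝ) ^ (0.98 : ℝ) := by
        rw [hd, ← Real.rpow_natCast, ← Real.rpow_mul hn0.le]; norm_num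
      have h4 : Λ * k₀ ≤ Λ * (13 * q) := by gcongr
      have h5 : Λ * 1 ≤ Λ * q := by gcongr
      refine le_trans (le_of_eq ?_) (hsmall (d ^ 2 / 16 - 4 * k₀ * Λ) ?_)
      · push_cast; ring_nf
      · rw [h3]; linarith
    have h6 : 2 / ((n : ℝ) + 1) = 2 * (1 / ((n : ℝ) + 1)) := by ring
    linarith
  refine tendsto_of_tendsto_of_tendsto_of_le_of_le' ?_ tendsto_const_nhds hbound
    (Eventually.of_forall fun n => unifProb_le_one _)
  simpa using (tendsto_one_div_add_atTop_nhds_zero_nat (𝕜 := ℝ)).const_mul 4 |>.const_sub 1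

end RandomSigns

section GraphTranslation

open Filter Topology

variable {n : ℕ}

/-- The graph whose edges are the pairs carrying the sign `+1`. -/
def graphOf (x : EdgeIdx n → Bool) : SimpleGraph (Fin n) where
  Adj v w := edgeSign x v w = 1
  symm := ⟨fun v w h => by rw [edgeSign_comm]; exact h⟩
  loopless := ⟨fun v h => by rw [edgeSign_self] at h; exact zero_ne_one h⟩

lemma graphOf_adj (x : EdgeIdx n → Bool) (v w : Fin n) :
    (graphOf x).Adj v w ↔ edgeSign x v w = 1 := Iff.rfl

lemma spin_eq_one_iff (b : Bool) : spin b = 1 ↔ b = true := by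
  cases b <;> norm_num [spin]

lemma bijective_graphOf : Function.Bijective (graphOf : (EdgeIdx n → Bool) → SimpleGraph (Fin n)) := by
  classical
  constructor
  · intro x y h
    ext e
    have h1 : (graphOf x).Adj e.1.1 e.1.2 ↔ (graphOf y).Adj e.1.1 e.1.2 := by rw [h]
    rw [graphOf_adj, graphOf_adj, edgeSign_of_lt, edgeSign_of_lt, spin_eq_one_iff, spin_eq_one_iff] at h1
    exact Bool.eq_iff_iff.2 h1
  · intro G
    refine ⟨fun e => decide (G.Adj e.1.1 e.1.2), ?_⟩
    have key : ∀ v w : Fin n, v < w →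
        ((graphOf fun e : EdgeIdx n => decide (G.Adj e.1.1 e.1.2)).Adj v w ↔ G.Adj v w) := by
      intro v w h
      rw [graphOf_adj, edgeSign_of_lt _ ⟨(v, w), h⟩, spin_eq_one_iff]
      simp
    ext v w
    rcases lt_trichotomy v w with h | h | h
    · exact key v w h
    · subst h; simp
    · rw [SimpleGraph.adj_comm, key w v h, SimpleGraph.adj_comm]

lemma card_edgeIdx (n : ℕ) : Fintype.card (EdgeIdx n) = n.choose 2 := by
  have h1 : Fintype.card (EdgeIdx n) = ∑ j : Fin n, (j : ℕ) := by
    rw [Fintype.card_subtype, Finset.card_filter, Fintype.sum_prod_type_right]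
    refine Finset.sum_congr rfl fun j _ => ?_
    rw [← Finset.card_filter]
    rw [show (Finset.univ.filter fun i : Fin n => i < j) = Finset.Iio j by ext; simp, Fin.card_Iio]
  rw [h1, Fin.sum_univ_eq_sum_range fun i => i, Finset.sum_range_id, Nat.choose_two_right]

lemma graphProb_eq_unifProb (n : ℕ) (P : SimpleGraph (Fin n) → Prop) :
    graphProb n P = unifProb fun x : EdgeIdx n → Bool => P (graphOf x) := by
  classical
  have h1 : Nat.card {G : SimpleGraph (Fin n) // P G} =
      (Finset.univ.filter fun x : EdgeIdx n → Bool => P (graphOf x)).card := by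
    rw [← Fintype.card_subtype, ← Nat.card_eq_fintype_card]
    exact (Nat.card_congr ((Equiv.ofBijective _ bijective_graphOf).subtypeEquiv fun _ => Iff.rfl)).symm
  rw [graphProb, h1, unifProb, Fintype.expect_eq_sum_div_card]
  congr 1
  · simp
  · simp [card_edgeIdx]

lemma degIn_graphOf (x : EdgeIdx n → Bool) (v : Fin n) (S : Finset (Fin n)) :
    (degIn (graphOf x) v S : ℝ) = ∑ w ∈ S, (1 + edgeSign x v w - if v = w then 1 else 0) / 2 := by
  classical
  have h1 : degIn (graphOf x) v S = (S.filter fun w => (graphOf x).Adj v w).card := by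
    rw [degIn, Nat.card_eq_fintype_card, Fintype.card_subtype]
    congr 1
    ext w
    simp
  rw [h1, Finset.card_filter]
  push_cast
  refine Finset.sum_congr rfl fun w _ => ?_
  rw [graphOf_adj]
  by_cases hvw : v = w
  · subst hvw; simp [edgeSign_self]
  · have : edgeSign x v w = 1 ∨ edgeSign x v w = -1 := by
      rcases lt_or_gt_of_ne hvw with h | h
      · rw [edgeSign_of_lt x ⟨(v, w), h⟩]; exact spin_eq_or _
      · rw [edgeSign_comm, edgeSign_of_lt x ⟨(w, v), h⟩]; exact spin_eq_or _
    rcases this with h | h <;> norm_num [h, hvw]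

lemma degIn_sub_degIn (x : EdgeIdx n → Bool) (σ : Fin n → Bool) (v : Fin n) :
    spin (σ v) * ((degIn (graphOf x) v (Finset.univ.filter fun w => σ w = true) : ℝ) -
      degIn (graphOf x) v (Finset.univ.filter fun w => σ w = true)ᶜ) =
      (rowOn x Finset.univ σ v + spin (σ v) * ∑ w, spin (σ w) - 1) / 2 := by
  rw [degIn_graphOf, degIn_graphOf]
  set F := fun w => (1 + edgeSign x v w - if v = w then 1 else 0) / 2 with hF
  have h1 : ∑ w ∈ Finset.univ.filter (fun w => σ w = true), F w -
      ∑ w ∈ (Finset.univ.filter fun w => σ w = true)ᶜ, F w = ∑ w, spin (σ w) * F w := by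
    rw [← Finset.sum_add_sum_compl (Finset.univ.filter fun w => σ w = true) fun w => spin (σ w) * F w,
      sub_eq_add_neg, ← Finset.sum_neg_distrib]
    congr 1
    · refine Finset.sum_congr rfl fun w hw => ?_
      rw [(Finset.mem_filter.1 hw).2]; simp [spin]
    · refine Finset.sum_congr rfl fun w hw => ?_
      have : σ w = false := by simpa using hw
      rw [this]; simp [spin]
  rw [h1, rowOn]
  have h2 : ∀ w, spin (σ w) * F w = (spin (σ w) + edgeSign x v w * spin (σ w) -
      if v = w then spin (σ w) else 0) / 2 := by
    intro w
    simp only [hF]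
    split_ifs <;> ring
  simp only [h2]
  rw [← Finset.sum_div, Finset.sum_sub_distrib, Finset.sum_add_distrib, Finset.sum_ite_eq]
  have := spin_mul_self (σ v)
  simp only [Finset.mem_univ, if_true]
  linarith

lemma hasFriendlyEquipartition_graphOf {x : EdgeIdx n → Bool} {σ : Fin n → Bool}
    (hσ : σ ∈ balanced n) {H : ℝ} (h : ∀ v, 2 * H + 2 ≤ rowOn x Finset.univ σ v) :
    HasFriendlyEquipartition (graphOf x) H := by
  have hsum := abs_sum_spin_le_one_of_mem_balanced hσ
  have key : ∀ v, H ≤ spin (σ v) * ((degIn (graphOf x) v (Finset.univ.filter fun w => σ w = true) : ℝ) -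
      degIn (graphOf x) v (Finset.univ.filter fun w => σ w = true)ᶜ) := by
    intro v
    rw [degIn_sub_degIn]
    have h1 : |spin (σ v) * ∑ w, spin (σ w)| ≤ 1 := by rwa [abs_mul, abs_spin, one_mul]
    have := (abs_le.1 h1).1
    linarith [h v]
  refine ⟨Finset.univ.filter fun w => σ w = true, ?_, fun v hv => ?_, fun v hv => ?_⟩
  · have hc := Finset.card_add_card_compl (Finset.univ.filter fun w => σ w = true)
    rw [Fintype.card_fin] at hc
    have h2 := (Finset.mem_filter.1 hσ).2
    rw [abs_le]
    omega
  · have := key v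
    rw [(Finset.mem_filter.1 hv).2] at this
    simp only [spin, if_true, one_mul] at this
    linarith
  · have := key v
    have hf : σ v = false := by simpa using hv
    rw [hf, spin_false] at this
    linarith

end GraphTranslation

/-- If Assumption (*) holds, then for every `ε > 0` the probability that
`G ∼ G(n,1/2)` admits a `(γ_crit/√2 − ε)·√n`-friendly equipartition tends to `1`. -/
theorem friendly_equipartition_below_threshold
    (γcrit : ℝ) (hγ : IsGammaCrit γcrit) (hstar : AssumptionStar γcrit)
    (ε : ℝ) (hε : 0 < ε) :
    Filter.Tendsto
      (fun n : ℕ => graphProb n (fun G =>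
        HasFriendlyEquipartition G ((γcrit / Real.sqrt 2 - ε) * Real.sqrt n)))
      Filter.atTop (nhds 1) := by
  set η : ℝ := min ((10 : ℝ) ^ (-25 : ℤ)) (ε / 2) with hη
  have hη0 : 0 < η := by positivity
  have hη1 : η ≤ (10 : ℝ) ^ (-25 : ℤ) := min_le_left _ _
  have hη2 : η ≤ ε / 2 := min_le_right _ _
  set r := Real.sqrt 2 with hr
  have hr2 : r ^ 2 = 2 := Real.sq_sqrt (by norm_num)
  have hr0 : 0 < r := Real.sqrt_pos.2 (by norm_num)
  have hr1 : r ≤ 1.5 := by nlinarith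
  set γ := γcrit - η with hγdef
  obtain ⟨α, hα⟩ := exists_F1_max γ
  have hpos : 0 < F1 γ α := hγ.F1_max_pos (by linarith) hα
  obtain ⟨c, hc, hc1, hF2⟩ := hstar.exists_F2_le (γ := γ) ⟨by linarith, by linarith⟩ hα hpos 5
  have hκ : r * γ ≤ 0.8 := by
    have := hγ.sqrt_two_mul_lt
    nlinarith
  have hθ : r * γcrit - ε < r * γ := by
    have : r * η ≤ 1.5 * (ε / 2) := by gcongr
    rw [hγdef, mul_sub]
    linarith
  have hlim := tendsto_unifProb_exists_balanced hκ hpos hc hc1 hF2 hθ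
  have hsqrt : Filter.Tendsto (fun n : ℕ => ε * Real.sqrt n) Filter.atTop Filter.atTop :=
    (Real.tendsto_sqrt_atTop.comp tendsto_natCast_atTop_atTop).const_mul_atTop hε
  refine tendsto_of_tendsto_of_tendsto_of_le_of_le' hlim tendsto_const_nhds ?_
    (Filter.Eventually.of_forall fun n => ?_)
  · filter_upwards [hsqrt.eventually_ge_atTop 2] with n hn
    rw [graphProb_eq_unifProb]
    refine unifProb_mono ?_
    rintro x ⟨σ, hσ, h⟩
    refine hasFriendlyEquipartition_graphOf hσ fun v => le_trans ?_ (h v)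
    have h1 : 2 * (γcrit / r) = r * γcrit := by
      field_simp
      rw [hr2]; ring
    have h2 : 2 * ((γcrit / r - ε) * Real.sqrt n) = (r * γcrit - ε) * Real.sqrt n - ε * Real.sqrt n := by
      rw [← h1]; ring
    rw [h2]
    linarith
  · rw [graphProb_eq_unifProb]
    exact unifProb_le_one _
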